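/- Let v ≥ 3 be odd and k ≥ 3, let F = {C_1, …, C_n} be a (K_v,C_k)-difference system, and let s with 1 ≤ s ≤ n be the number of cycles of F that are of type 1. Then NC(v,k) ≥ ⌈2^s / φ(v)⌉. -/

import Mathlib

namespace CCS

/-- A block: a set of edges of the complete graph on `ZMod v`. -/
abbrev Block (v : ℕ) := Finset (Sym2 (ZMod v))

/-- The edge set of the closed tuple `c = (c 0, c 1, …, c (k-1))`. -/
def edgesOf {v k : ℕ} (c : Fin k → ZMod v) : Block v :=
  Finset.image (fun i : Fin k => s(c i, c ⟨(i.1 + 1) % k, Nat.mod_lt _ i.pos⟩)) Finset.univ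

/-- `E` is the edge set of a `k`-cycle on `ZMod v`. Since for `k ≥ 3` the edge set
determines the closed tuple up to rotation and reversal, a `k`-cycle is identified
with its edge set. -/
def IsCycleBlock (v k : ℕ) (E : Block v) : Prop :=
  ∃ c : Fin k → ZMod v, Function.Injective c ∧ E = edgesOf c

/-- The translate `E + z` of a cycle. -/
def translateBlock {v : ℕ} (E : Block v) (z : ZMod v) : Block v :=
  E.image (Sym2.map (· + z))

/-- A `(K_v, C_k)`-design: a set of `k`-cycles whose edge sets partition the edges of `K_v`. -/
def IsDesign (v k : ℕ) (B : Set (Block v)) : Prop :=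
  (∀ E ∈ B, IsCycleBlock v k E) ∧
  ∀ e : Sym2 (ZMod v), ¬ e.IsDiag → ∃! E, E ∈ B ∧ e ∈ E

/-- A cyclic `(K_v, C_k)`-design. -/
def IsCyclicDesign (v k : ℕ) (B : Set (Block v)) : Prop :=
  IsDesign v k B ∧ ∀ E ∈ B, ∀ z : ZMod v, translateBlock E z ∈ B

/-- Two designs are isomorphic if a bijection of `ZMod v` maps one onto the other. -/
def Isomorphic {v : ℕ} (B B' : Set (Block v)) : Prop :=
  ∃ f : ZMod v ≃ ZMod v, B' = (fun E : Block v => E.image (Sym2.map f)) '' B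

/-- `NC v k`: the number of cyclic `(K_v, C_k)`-designs up to isomorphism. -/
noncomputable def NC (v k : ℕ) : ℕ :=
  Nat.card (Quot fun B B' : {B : Set (Block v) // IsCyclicDesign v k B} =>
    Isomorphic B.1 B'.1)

/-- The type of a cycle: the order of its stabilizer under translations. -/
noncomputable def cycleType {v : ℕ} (E : Block v) : ℕ :=
  Nat.card {z : ZMod v // translateBlock E z = E}

/-- The two differences `±(a-b)` arising from an edge `{a,b}`. -/
def edgeDiffs {v : ℕ} : Sym2 (ZMod v) → Multiset (ZMod v) :=
  Sym2.lift ⟨fun a b => {a - b, b - a}, fun a b => by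
    show (a-b) ::ₘ {b-a} = (b-a) ::ₘ {a-b}; exact Multiset.cons_swap _ _ _⟩

/-- The multiset of the `2k` differences arising from the `k` edges of a cycle.
For a cycle of type `d` this is `d` copies of the list `∂C` of partial differences. -/
def fullDiffs {v : ℕ} (E : Block v) : Multiset (ZMod v) :=
  E.val.bind edgeDiffs

/-- The multiset `∂C` of partial differences of a cycle: each difference is counted
with multiplicity equal to its multiplicity among the `2k` edge differences divided
by the type of the cycle. -/
noncomputable def partialDiffs {v : ℕ} (E : Block v) : Multiset (ZMod v) :=
  (fullDiffs E).toFinset.val.bind fun x =>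
    Multiset.replicate ((fullDiffs E).count x / cycleType E) x

/-- A `(K_v, C_k)`-difference system: a set of `k`-cycles whose partial differences
cover every nonzero element of `ZMod v` exactly once. -/
def IsDifferenceSystem (v k : ℕ) (F : Finset (Block v)) : Prop :=
  (∀ E ∈ F, IsCycleBlock v k E) ∧
  ∀ x : ZMod v, (F.val.bind partialDiffs).count x = if x = 0 then 0 else 1

end CCS

set_option linter.unusedSectionVars false

namespace CCS

/-- The image of a block under a map of the point set. -/
def act {v : ℕ} (f : ZMod v → ZMod v) (E : Block v) : Block v := E.image (Sym2.map f)

/-- The edge set of the closed tuple `c`, indexed by `ZMod k`. -/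
def cyc {v k : ℕ} [NeZero k] (c : ZMod k → ZMod v) : Block v :=
  Finset.univ.image fun i => s(c i, c (i + 1))

section Cycle

variable {v k : ℕ} [NeZero k]

lemma mem_cyc {c : ZMod k → ZMod v} {a b : ZMod v} :
    s(a, b) ∈ cyc c ↔ ∃ i, (a = c i ∧ b = c (i + 1)) ∨ (a = c (i + 1) ∧ b = c i) := by
  simp only [cyc, Finset.mem_image, Finset.mem_univ, true_and, Sym2.eq_iff]
  exact exists_congr fun i => by grind

lemma isCycleBlock_iff {E : Block v} :
    IsCycleBlock v k E ↔ ∃ c : ZMod k → ZMod v, Function.Injective c ∧ E = cyc c := by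
  obtain ⟨n, rfl⟩ : ∃ n, k = n + 1 := ⟨k - 1, by have := NeZero.pos k; omega⟩
  refine exists_congr fun c => and_congr Iff.rfl ?_
  have : edgesOf c = cyc (k := n + 1) c := by
    unfold edgesOf cyc
    refine Finset.image_congr fun i _ => ?_
    have : (⟨(i.1 + 1) % (n + 1), Nat.mod_lt _ i.pos⟩ : Fin (n + 1)) = i + 1 := by
      ext; simp [Fin.val_add]
    simp only [this]
    rfl
  rw [this]

lemma act_cyc (f : ZMod v → ZMod v) (c : ZMod k → ZMod v) : act f (cyc c) = cyc (f ∘ c) := by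
  simp only [act, cyc, Finset.image_image]
  rfl

lemma cyc_shift (c : ZMod k → ZMod v) (a : ZMod k) : cyc (fun i => c (i + a)) = cyc c := by
  ext e
  induction e using Sym2.ind with
  | _ x y =>
    simp only [mem_cyc]
    constructor
    · rintro ⟨i, h⟩
      exact ⟨i + a, by rwa [add_right_comm] at h⟩
    · rintro ⟨i, h⟩
      exact ⟨i - a, by
        rw [show i - a + 1 + a = i + 1 by ring, show i - a + a = i by ring]; exact h⟩

lemma cyc_neg (c : ZMod k → ZMod v) : cyc (fun i => c (-i)) = cyc c := by
  ext e
  induction e using Sym2.ind with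
  | _ x y =>
    simp only [mem_cyc]
    constructor
    · rintro ⟨i, h⟩
      refine ⟨-i - 1, ?_⟩
      rw [show -i - 1 + 1 = -i by ring, show -i - 1 = -(i + 1) by ring]; exact h.symm
    · rintro ⟨i, h⟩
      refine ⟨-i - 1, ?_⟩
      rw [show -(-i - 1 + 1) = i by ring, show -(-i - 1) = i + 1 by ring]; exact h.symm

lemma neighbour {c : ZMod k → ZMod v} (hc : Function.Injective c) {i : ZMod k} {y : ZMod v}
    (h : s(c i, y) ∈ cyc c) : y = c (i + 1) ∨ y = c (i - 1) := by
  obtain ⟨j, ⟨h1, h2⟩ | ⟨h1, h2⟩⟩ := mem_cyc.1 h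
  · left; rw [h2, hc h1]
  · right; rw [h2, hc h1]; simp

lemma two_ne_zero_of (hk : 3 ≤ k) : (2 : ZMod k) ≠ 0 := by
  intro h
  have : ((2 : ℕ) : ZMod k) = 0 := by exact_mod_cast h
  rw [ZMod.natCast_eq_zero_iff] at this
  have := Nat.le_of_dvd (by norm_num) this
  omega

lemma one_ne_zero_of (hk : 3 ≤ k) : (1 : ZMod k) ≠ 0 := by
  intro h
  exact two_ne_zero_of hk (by linear_combination 2 * h)

/-- A parametrisation of a cycle is determined by two adjacent values. -/
lemma param_unique (hk : 3 ≤ k) {c c' : ZMod k → ZMod v} (hc : Function.Injective c)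
    (hc' : Function.Injective c') (h : cyc c' ⊆ cyc c) {a ε : ZMod k} (hε : ε = 1 ∨ ε = -1)
    (h0 : c' 0 = c a) (h1 : c' 1 = c (a + ε)) (m : ZMod k) : c' m = c (a + ε * m) := by
  have key : ∀ n : ℕ, c' n = c (a + ε * n) ∧ c' (n + 1) = c (a + ε * (n + 1)) := by
    intro n
    induction n with
    | zero => simpa using ⟨h0, h1⟩
    | succ n ih =>
      push_cast
      refine ⟨ih.2, ?_⟩
      have hm : s(c (a + ε * (n + 1)), c' (n + 1 + 1)) ∈ cyc c := by
        rw [← ih.2]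
        exact h (mem_cyc.2 ⟨n + 1, Or.inl ⟨rfl, rfl⟩⟩)
      have hne : c' (n + 1 + 1) ≠ c (a + ε * n) := by
        rw [← ih.1]
        intro h'
        have := hc' h'
        exact two_ne_zero_of hk (by linear_combination this)
      rcases neighbour hc hm with h' | h' <;> rcases hε with rfl | rfl
      · rw [h']; congr 1; ring
      · exact absurd (h'.trans (by congr 1; ring)) hne
      · exact absurd (h'.trans (by congr 1; ring)) hne
      · rw [h']; congr 1; ring
  have := (key m.val).1
  simpa using this

/-- An automorphism of a cycle that fixes two adjacent vertices is trivial on the cycle. -/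
lemma fix_of_adjacent (hk : 3 ≤ k) {c : ZMod k → ZMod v} (hc : Function.Injective c)
    {f : ZMod v → ZMod v} (hf : Function.Injective f) (h : act f (cyc c) = cyc c) {x y : ZMod v}
    (hxy : s(x, y) ∈ cyc c) (hx : f x = x) (hy : f y = y) (m : ZMod k) : f (c m) = c m := by
  have main : ∀ a : ZMod k, ∀ ε : ZMod k, (ε = 1 ∨ ε = -1) → f (c a) = c a →
      f (c (a + ε)) = c (a + ε) → ∀ m, f (c m) = c m := by
    intro a ε hε h0 h1 m
    have hsub : cyc (fun i => f (c (a + ε * i))) ⊆ cyc c := by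
      rw [act_cyc] at h
      rcases hε with rfl | rfl
      · have := cyc_shift (f ∘ c) a
        rw [h] at this
        simp only [one_mul, add_comm a]
        exact this.subset
      · have := cyc_neg (fun i => (f ∘ c) (i + a))
        rw [cyc_shift, h] at this
        have e : (fun i => f (c (a + -1 * i))) = fun i => (f ∘ c) (-i + a) := by
          funext i; simp [add_comm]
        rw [e]
        exact this.subset
    have hinj : Function.Injective (fun i => f (c (a + ε * i))) := by
      intro i j hij
      have := hc (hf hij)
      rcases hε with rfl | rfl
      · simpa using this
      · simpa using this
    have := param_unique hk hc hinj hsub hε (a := a) (by simpa using h0) (by simpa using h1)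
      (ε * (m - a))
    have e : ε * (ε * (m - a)) = m - a := by rcases hε with rfl | rfl <;> ring
    simp only [e] at this
    rw [show a + (m - a) = m by ring] at this
    exact this
  obtain ⟨i, ⟨rfl, rfl⟩ | ⟨rfl, rfl⟩⟩ := mem_cyc.1 hxy
  · exact main i 1 (Or.inl rfl) hx hy m
  · exact main i 1 (Or.inl rfl) hy hx m

lemma not_isDiag_of_mem_cyc (hk : 3 ≤ k) {c : ZMod k → ZMod v} (hc : Function.Injective c)
    {a b : ZMod v} (h : s(a, b) ∈ cyc c) : a ≠ b := by
  obtain ⟨j, ⟨rfl, rfl⟩ | ⟨rfl, rfl⟩⟩ := mem_cyc.1 h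
  · intro h; have := hc h; exact one_ne_zero_of hk (by linear_combination -this)
  · intro h; have := hc h; exact one_ne_zero_of hk (by linear_combination this)

end Cycle

section Basic

variable {v k : ℕ}

lemma act_act (f g : ZMod v → ZMod v) (E : Block v) : act f (act g E) = act (f ∘ g) E := by
  simp only [act, Finset.image_image, Sym2.map_comp]

lemma act_id (E : Block v) : act id E = E := by simp [act]

lemma mem_act (f : Equiv.Perm (ZMod v)) {E : Block v} {a b : ZMod v} :
    s(a, b) ∈ act f E ↔ s(f.symm a, f.symm b) ∈ E := by
  have : s(a, b) = Sym2.map f s(f.symm a, f.symm b) := by simp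
  rw [this, act]
  exact (Sym2.map.injective f.injective).mem_finset_image

lemma mem_act_apply (f : Equiv.Perm (ZMod v)) {E : Block v} {a b : ZMod v} :
    s(f a, f b) ∈ act f E ↔ s(a, b) ∈ E := by
  rw [mem_act]; simp

lemma mem_translateBlock {E : Block v} {a b z : ZMod v} :
    s(a, b) ∈ translateBlock E z ↔ s(a - z, b - z) ∈ E := by
  have := mem_act (Equiv.addRight z) (E := E) (a := a) (b := b)
  simp only [Equiv.coe_addRight, Equiv.addRight_symm, ← sub_eq_add_neg] at this
  exact this

lemma translateBlock_translateBlock (E : Block v) (a b : ZMod v) :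
    translateBlock (translateBlock E a) b = translateBlock E (a + b) := by
  refine (act_act (· + b) (· + a) E).trans ?_
  congr 1
  funext x
  simp [add_assoc]

lemma translateBlock_zero (E : Block v) : translateBlock E 0 = E := by
  refine Eq.trans ?_ (act_id E)
  unfold translateBlock act
  congr 2
  funext x
  simp

lemma IsCycleBlock.act {E : Block v} (hk : 3 ≤ k) (h : IsCycleBlock v k E)
    {f : ZMod v → ZMod v} (hf : Function.Injective f) : IsCycleBlock v k (act f E) := by
  have : NeZero k := ⟨by omega⟩
  obtain ⟨c, hc, rfl⟩ := isCycleBlock_iff.1 h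
  exact isCycleBlock_iff.2 ⟨f ∘ c, hf.comp hc, act_cyc f c⟩

lemma IsCycleBlock.ne {E : Block v} (hk : 3 ≤ k) (h : IsCycleBlock v k E) {a b : ZMod v}
    (hab : s(a, b) ∈ E) : a ≠ b := by
  have : NeZero k := ⟨by omega⟩
  obtain ⟨c, hc, rfl⟩ := isCycleBlock_iff.1 h
  exact not_isDiag_of_mem_cyc hk hc hab

lemma IsDesign.act {B : Set (Block v)} (hk : 3 ≤ k) (h : IsDesign v k B)
    (f : Equiv.Perm (ZMod v)) : IsDesign v k (act f '' B) := by
  refine ⟨?_, fun e => ?_⟩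
  · rintro _ ⟨E, hE, rfl⟩
    exact (h.1 E hE).act hk f.injective
  · induction e using Sym2.ind with
    | _ a b =>
      intro hab
      obtain ⟨E, ⟨hE, h1⟩, h2⟩ := h.2 s(f.symm a, f.symm b) (by simpa using hab)
      refine ⟨CCS.act f E, ⟨⟨E, hE, rfl⟩, (mem_act f).2 h1⟩, ?_⟩
      rintro _ ⟨⟨E', hE', rfl⟩, h3⟩
      rw [h2 E' ⟨hE', (mem_act f).1 h3⟩]

lemma IsDesign.eq_of_mem {B : Set (Block v)} (hk : 3 ≤ k) (h : IsDesign v k B) {E E' : Block v}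
    (hE : E ∈ B) (hE' : E' ∈ B) {a b : ZMod v} (h1 : s(a, b) ∈ E) (h2 : s(a, b) ∈ E') :
    E = E' :=
  (h.2 s(a, b) (by simpa using (h.1 E hE).ne hk h1)).unique ⟨hE, h1⟩ ⟨hE', h2⟩

variable [NeZero v]

/-- The set of differences of a block. -/
def diffs (E : Block v) : Finset (ZMod v) :=
  Finset.univ.filter fun x => ∃ b, s(b + x, b) ∈ E

lemma mem_diffs {E : Block v} {x : ZMod v} : x ∈ diffs E ↔ ∃ b, s(b + x, b) ∈ E := by
  simp [diffs]

lemma sub_mem_diffs {E : Block v} {a b : ZMod v} (h : s(a, b) ∈ E) : a - b ∈ diffs E :=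
  mem_diffs.2 ⟨b, by simpa using h⟩

lemma neg_mem_diffs {E : Block v} {x : ZMod v} (h : x ∈ diffs E) : -x ∈ diffs E := by
  obtain ⟨b, hb⟩ := mem_diffs.1 h
  rw [Sym2.eq_swap] at hb
  simpa using sub_mem_diffs hb

lemma diffs_translateBlock (E : Block v) (z : ZMod v) : diffs (translateBlock E z) = diffs E := by
  ext x
  simp only [mem_diffs, mem_translateBlock]
  constructor
  · rintro ⟨b, h⟩
    exact ⟨b - z, by rwa [sub_add_eq_add_sub]⟩
  · rintro ⟨b, h⟩
    exact ⟨b + z, by simpa [add_sub_right_comm] using h⟩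

/-- The image of a block under multiplication by a unit. -/
def mulBlock (u : (ZMod v)ˣ) (E : Block v) : Block v := act (u.mulLeft) E

lemma mem_mulBlock {u : (ZMod v)ˣ} {E : Block v} {a b : ZMod v} :
    s(u * a, u * b) ∈ mulBlock u E ↔ s(a, b) ∈ E :=
  mem_act_apply u.mulLeft

lemma mul_mem_diffs_mulBlock {u : (ZMod v)ˣ} {E : Block v} {x : ZMod v} :
    u * x ∈ diffs (mulBlock u E) ↔ x ∈ diffs E := by
  simp only [mem_diffs]
  constructor
  · rintro ⟨b, h⟩
    refine ⟨u⁻¹ * b, ?_⟩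
    rw [← mem_mulBlock (u := u), mul_add]
    simpa using h
  · rintro ⟨b, h⟩
    refine ⟨u * b, ?_⟩
    rw [← mul_add, mem_mulBlock]
    exact h

lemma mem_diffs_mulBlock {u : (ZMod v)ˣ} {E : Block v} {x : ZMod v} :
    x ∈ diffs (mulBlock u E) ↔ ↑u⁻¹ * x ∈ diffs E := by
  have := mul_mem_diffs_mulBlock (u := u) (E := E) (x := ↑u⁻¹ * x)
  simpa using this

lemma diffs_mulBlock (u : (ZMod v)ˣ) (E : Block v) :
    diffs (mulBlock u E) = (diffs E).image fun x => (u : ZMod v) * x := by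
  ext x
  rw [mem_diffs_mulBlock, Finset.mem_image]
  constructor
  · intro h; exact ⟨_, h, by simp⟩
  · rintro ⟨y, hy, rfl⟩; simpa using hy

lemma mulBlock_mulBlock (u w : (ZMod v)ˣ) (E : Block v) :
    mulBlock u (mulBlock w E) = mulBlock (u * w) E := by
  refine (act_act _ _ E).trans ?_
  unfold mulBlock
  congr 1
  funext x
  simp [mul_assoc]

lemma mulBlock_one (E : Block v) : mulBlock 1 E = E := by
  refine Eq.trans ?_ (act_id E)
  unfold mulBlock
  congr 1
  funext x
  simp

lemma mulBlock_translateBlock (u : (ZMod v)ˣ) (E : Block v) (z : ZMod v) :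
    mulBlock u (translateBlock E z) = translateBlock (mulBlock u E) (u * z) := by
  refine (act_act _ _ E).trans (Eq.trans ?_ (act_act _ _ E).symm)
  congr 1
  funext x
  simp [mul_add]

lemma diffs_neg (E : Block v) : diffs (mulBlock (-1) E) = diffs E := by
  ext x
  rw [mem_diffs_mulBlock]
  simp only [inv_neg, inv_one, Units.val_neg, Units.val_one, neg_mul, one_mul]
  exact ⟨fun h => by simpa using neg_mem_diffs h, neg_mem_diffs⟩

lemma IsCycleBlock.translateBlock {E : Block v} (hk : 3 ≤ k) (h : IsCycleBlock v k E)
    (z : ZMod v) : IsCycleBlock v k (translateBlock E z) := h.act hk (add_left_injective z)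

lemma IsCyclicDesign.mulBlock {B : Set (Block v)} (hk : 3 ≤ k) (h : IsCyclicDesign v k B)
    (u : (ZMod v)ˣ) : IsCyclicDesign v k (mulBlock u '' B) := by
  refine ⟨h.1.act hk _, ?_⟩
  rintro _ ⟨E, hE, rfl⟩ z
  refine ⟨CCS.translateBlock E (↑u⁻¹ * z), h.2 E hE _, ?_⟩
  rw [mulBlock_translateBlock]; simp

lemma IsCycleBlock.zero_notMem_diffs {E : Block v} (hk : 3 ≤ k) (h : IsCycleBlock v k E) :
    (0 : ZMod v) ∉ diffs E := by
  intro h0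
  obtain ⟨b, hb⟩ := mem_diffs.1 h0
  exact h.ne hk hb (by simp)

lemma diffs_nonempty {E : Block v} (hk : 3 ≤ k) (h : IsCycleBlock v k E) : (diffs E).Nonempty := by
  have : NeZero k := ⟨by omega⟩
  obtain ⟨c, hc, rfl⟩ := isCycleBlock_iff.1 h
  exact ⟨_, sub_mem_diffs (mem_cyc.2 ⟨0, Or.inl ⟨rfl, rfl⟩⟩)⟩

namespace IsCyclicDesign

variable {D : Set (Block v)} {E E' : Block v} {x y b b' : ZMod v}

lemma translate_eq (hk : 3 ≤ k) (hD : IsCyclicDesign v k D) (hE : E ∈ D) (hE' : E' ∈ D)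
    (h : s(b + x, b) ∈ E) (h' : s(b' + x, b') ∈ E') : translateBlock E (b' - b) = E' := by
  refine hD.1.eq_of_mem hk (hD.2 E hE _) hE' (a := b' + x) (b := b') ?_ h'
  rw [mem_translateBlock]
  convert h using 2
  · ring
  · ring

lemma exists_mem (hD : IsCyclicDesign v k D) (hx : x ≠ 0) : ∃ E ∈ D, s(x, 0) ∈ E := by
  obtain ⟨E, ⟨h1, h2⟩, -⟩ := hD.1.2 s(x, 0) (by simpa using hx)
  exact ⟨E, h1, h2⟩

lemma exists_diffs (hD : IsCyclicDesign v k D) (hx : x ≠ 0) : ∃ E ∈ D, x ∈ diffs E := by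
  obtain ⟨E, h1, h2⟩ := hD.exists_mem hx
  exact ⟨E, h1, by simpa using sub_mem_diffs h2⟩

lemma exists_translate (hk : 3 ≤ k) (hD : IsCyclicDesign v k D) (hE : E ∈ D) (hE' : E' ∈ D)
    (hx : x ∈ diffs E) (hx' : x ∈ diffs E') : ∃ z, translateBlock E z = E' := by
  obtain ⟨b, hb⟩ := mem_diffs.1 hx
  obtain ⟨b', hb'⟩ := mem_diffs.1 hx'
  exact ⟨_, hD.translate_eq hk hE hE' hb hb'⟩

lemma diffs_eq (hk : 3 ≤ k) (hD : IsCyclicDesign v k D) (hE : E ∈ D) (hE' : E' ∈ D)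
    (hx : x ∈ diffs E) (hx' : x ∈ diffs E') : diffs E = diffs E' := by
  obtain ⟨z, rfl⟩ := hD.exists_translate hk hE hE' hx hx'
  rw [diffs_translateBlock]

lemma ne_zero (hk : 3 ≤ k) (hD : IsCyclicDesign v k D) (hE : E ∈ D) (hx : x ∈ diffs E) :
    x ≠ 0 := by
  rintro rfl
  exact (hD.1.1 E hE).zero_notMem_diffs hk hx

end IsCyclicDesign

lemma mul_mem_addSubgroup (J : AddSubgroup (ZMod v)) (a : ZMod v) {x : ZMod v} (hx : x ∈ J) :
    a * x ∈ J := by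
  have := J.nsmul_mem hx a.val
  simpa [nsmul_eq_mul] using this

/-- A subgroup is closed for `D` if it contains all the differences of a block as soon as it
contains one of them, that is, if it is the point set of a subdesign. -/
def Closed (D : Set (Block v)) (J : AddSubgroup (ZMod v)) : Prop :=
  ∀ E ∈ D, ∀ x ∈ diffs E, x ∈ J → ∀ y ∈ diffs E, y ∈ J

/-- The smallest closed subgroup containing `x`. -/
def cl (D : Set (Block v)) (x : ZMod v) : AddSubgroup (ZMod v) :=
  sInf {J | Closed D J ∧ x ∈ J}

section Closure

variable {D : Set (Block v)} {E : Block v} {x y : ZMod v} {J : AddSubgroup (ZMod v)}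

lemma mem_cl (D : Set (Block v)) (x : ZMod v) : x ∈ cl D x := by
  simp only [cl, AddSubgroup.mem_sInf]
  exact fun J h => h.2

lemma cl_le (h : Closed D J) (hx : x ∈ J) : cl D x ≤ J := sInf_le ⟨h, hx⟩

lemma closed_cl (D : Set (Block v)) (x : ZMod v) : Closed D (cl D x) := by
  intro E hE y hy hyJ z hz
  simp only [cl, AddSubgroup.mem_sInf] at hyJ ⊢
  exact fun J hJ => hJ.1 E hE y hy (hyJ J hJ) z hz

lemma closed_top (D : Set (Block v)) : Closed D ⊤ := fun _ _ _ _ _ _ _ => trivial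

lemma cl_eq_of_mem_diffs (hE : E ∈ D) (hx : x ∈ diffs E) (hy : y ∈ diffs E) :
    cl D x = cl D y :=
  le_antisymm (cl_le (closed_cl D y) (closed_cl D y E hE y hy (mem_cl D y) x hx))
    (cl_le (closed_cl D x) (closed_cl D x E hE x hx (mem_cl D x) y hy))

lemma cl_mul (u : (ZMod v)ˣ) : cl D (u * x) = cl D x := by
  refine le_antisymm (cl_le (closed_cl D x) (mul_mem_addSubgroup _ _ (mem_cl D x)))
    (cl_le (closed_cl D _) ?_)
  have := mul_mem_addSubgroup _ (↑u⁻¹ : ZMod v) (mem_cl D (u * x))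
  simpa using this

lemma mem_of_cl_eq (h : cl D x = J) : x ∈ J := h ▸ mem_cl D x

lemma exists_zmultiples (J : AddSubgroup (ZMod v)) : ∃ x, AddSubgroup.zmultiples x = J := by
  obtain ⟨x, hx⟩ := (AddSubgroup.isAddCyclic_iff_exists_zmultiples_eq_top J).1 inferInstance
  exact ⟨x, hx⟩

lemma cl_eq_of_zmultiples (hJ : Closed D J) (hx : AddSubgroup.zmultiples x = J) : cl D x = J :=
  le_antisymm (cl_le hJ (hx ▸ AddSubgroup.mem_zmultiples x))
    (hx ▸ (AddSubgroup.zmultiples_le_of_mem (mem_cl D x)))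

end Closure

end Basic

section Tame

variable {v k : ℕ} [NeZero v]

/-- A set of points is a subdesign if it contains a block as soon as it contains an edge of it. -/
def PClosed (D : Set (Block v)) (T : Set (ZMod v)) : Prop :=
  ∀ E ∈ D, ∀ a b, s(a, b) ∈ E → a ∈ T → b ∈ T → ∀ c d, s(c, d) ∈ E → c ∈ T

/-- The subdesign generated by a subgroup is a subgroup. -/
def pcl (D : Set (Block v)) (hD : ∀ E ∈ D, ∀ z, translateBlock E z ∈ D)
    (H : AddSubgroup (ZMod v)) : AddSubgroup (ZMod v) :=
  let S : Set (ZMod v) := {x | ∀ T, PClosed D T → (H : Set (ZMod v)) ⊆ T → x ∈ T}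
  have hshift : ∀ T, PClosed D T → ∀ b, PClosed D {x | x + b ∈ T} := by
    intro T hT b E hE x y hxy hx hy c d hcd
    refine hT _ (hD E hE b) (x + b) (y + b) ?_ hx hy (c + b) (d + b) ?_
    · rw [mem_translateBlock]; simpa using hxy
    · rw [mem_translateBlock]; simpa using hcd
  have hH : ∀ x ∈ S, ∀ h ∈ H, x + h ∈ S := by
    intro x hx h hh T hT hHT
    exact hx _ (hshift T hT h) fun y hy => hHT (H.add_mem hy hh)
  have hadd : ∀ x ∈ S, ∀ y ∈ S, x + y ∈ S := by
    intro x hx y hy T hT hHT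
    refine hx _ (hshift T hT y) fun h hh => ?_
    have := hH y hy h hh T hT hHT
    rwa [add_comm] at this
  have hzero : (0 : ZMod v) ∈ S := fun T _ hHT => hHT H.zero_mem
  have hnsmul : ∀ x ∈ S, ∀ n : ℕ, n • x ∈ S := by
    intro x hx n
    induction n with
    | zero => simpa using hzero
    | succ n ih => rw [succ_nsmul]; exact hadd _ ih _ hx
  { carrier := S
    add_mem' := fun {x y} hx hy => hadd x hx y hy
    zero_mem' := hzero
    neg_mem' := fun {x} hx => by
      have := hnsmul x hx (v - 1)
      have e : (v - 1) • x = -x := by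
        rw [nsmul_eq_mul, Nat.cast_sub (NeZero.one_le), ZMod.natCast_self]
        simp
      rwa [e] at this }

lemma mem_pcl {D : Set (Block v)} (hD : ∀ E ∈ D, ∀ z, translateBlock E z ∈ D)
    {H : AddSubgroup (ZMod v)} {x : ZMod v} :
    x ∈ pcl D hD H ↔ ∀ T, PClosed D T → (H : Set (ZMod v)) ⊆ T → x ∈ T := Iff.rfl

lemma closed_pcl {D : Set (Block v)} (hD : ∀ E ∈ D, ∀ z, translateBlock E z ∈ D)
    (H : AddSubgroup (ZMod v)) : Closed D (pcl D hD H) := by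
  intro E hE x hx hxJ y hy
  obtain ⟨b, hb⟩ := mem_diffs.1 hx
  obtain ⟨c, hc⟩ := mem_diffs.1 hy
  have hmem : ∀ p q, s(p, q) ∈ E → p - b ∈ pcl D hD H := by
    intro p q hpq
    rw [mem_pcl]
    intro T hT hHT
    refine hT _ (hD E hE (-b)) x 0 ?_ ((mem_pcl hD).1 hxJ T hT hHT)
      ((mem_pcl hD).1 (zero_mem _) T hT hHT) _ (q - b) ?_
    · rw [mem_translateBlock]; simpa [add_comm] using hb
    · rw [mem_translateBlock]; simpa using hpq
  have h1 := hmem _ _ hc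
  have h2 := hmem _ _ (Sym2.eq_swap ▸ hc : s(c, c + y) ∈ E)
  have := sub_mem h1 h2
  simpa using this

/-- A point `w` generates `D` if every closed subgroup containing it is everything. -/
def Generates (D : Set (Block v)) (w : ZMod v) : Prop := ∀ J, Closed D J → w ∈ J → J = ⊤

lemma eq_one_of_fix (hk : 3 ≤ k) {D : Set (Block v)} (hD : IsCyclicDesign v k D) {w : ZMod v}
    (hw : Generates D w) (h : Equiv.Perm (ZMod v)) (hh : ∀ E ∈ D, act h E ∈ D)
    (hfix : ∀ x ∈ AddSubgroup.zmultiples w, h x = x) : h = 1 := by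
  have : NeZero k := ⟨by omega⟩
  have hP : PClosed D {x | h x = x} := by
    intro E hE a b hab ha hb c d hcd
    obtain ⟨γ, hγ, rfl⟩ := isCycleBlock_iff.1 (hD.1.1 E hE)
    have hfixE : act h (cyc γ) = cyc γ := by
      refine hD.1.eq_of_mem hk (hh _ hE) hE (a := a) (b := b) ?_ hab
      have := (mem_act_apply h).2 hab
      rwa [show h a = a from ha, show h b = b from hb] at this
    have := fix_of_adjacent hk hγ h.injective hfixE hab ha hb
    obtain ⟨i, ⟨rfl, -⟩ | ⟨rfl, -⟩⟩ := mem_cyc.1 hcd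
    · exact this i
    · exact this (i + 1)
  have htop := hw _ (closed_pcl hD.2 (AddSubgroup.zmultiples w))
    ((mem_pcl hD.2).2 fun T _ hT => hT (AddSubgroup.mem_zmultiples w))
  ext1 x
  have hx : x ∈ pcl D hD.2 (AddSubgroup.zmultiples w) := htop ▸ AddSubgroup.mem_top x
  exact (mem_pcl hD.2).1 hx {y | h y = y} hP hfix

/-- The affine permutation `x ↦ u * x + b`. -/
def affinePerm (p : (ZMod v)ˣ × ZMod v) : Equiv.Perm (ZMod v) :=
  Equiv.addRight p.2 * p.1.mulLeft

lemma affine_of_conj (hk : 3 ≤ k) {B D : Set (Block v)} (hB : IsCyclicDesign v k B)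
    (hD : IsCyclicDesign v k D) {w w' : ZMod v} (hw : Generates D w')
    (a : Equiv.Perm (ZMod v)) (hBD : act a '' B = D) (ha : ∀ x, a (x + w) = a x + w') :
    ∃ p, a = affinePerm p := by
  let c := a 1 - a 0
  let τ : Equiv.Perm (ZMod v) := Equiv.addRight 1
  let h : Equiv.Perm (ZMod v) := Equiv.addRight (-(a (a.symm 0 + 1))) * (a * τ * a⁻¹)
  have h_apply : ∀ x, h x = a (a.symm x + 1) - a (a.symm 0 + 1) := by
    intro x; simp [h, τ, sub_eq_add_neg, Equiv.Perm.inv_def]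
  have hh : ∀ E ∈ D, act h E ∈ D := by
    intro E hE
    rw [← hBD] at hE
    obtain ⟨E', hE', rfl⟩ := hE
    have e : act h (act a E') =
        translateBlock (act a (translateBlock E' 1)) (-(a (a.symm 0 + 1))) := by
      change _ = act (Equiv.addRight (-(a (a.symm 0 + 1)))) (act a (act (Equiv.addRight 1) E'))
      simp only [act_act]
      congr 1
      funext x
      simp [h, τ, Equiv.Perm.inv_def]
    rw [e]
    apply hD.2
    rw [← hBD]
    exact ⟨_, hB.2 _ hE' 1, rfl⟩
  have hsymm : ∀ x, a.symm (x + w') = a.symm x + w := by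
    intro x
    rw [Equiv.symm_apply_eq, ha]; simp
  have hstep : ∀ x, h (x + w') = h x + w' := by
    intro x
    rw [h_apply, h_apply, hsymm, add_right_comm, ha]; ring
  have h0 : h 0 = 0 := by rw [h_apply]; simp
  have hn : ∀ n : ℕ, h (n • w') = n • w' := by
    intro n
    induction n with
    | zero => simpa using h0
    | succ n ih => rw [succ_nsmul, hstep, ih]
  have hfix : ∀ x ∈ AddSubgroup.zmultiples w', h x = x := by
    intro x hx
    obtain ⟨m, rfl⟩ := AddSubgroup.mem_zmultiples_iff.1 hx
    have e : m • w' = (m : ZMod v).val • w' := by simp [nsmul_eq_mul, zsmul_eq_mul]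
    rw [e, hn]
  have h1 := eq_one_of_fix hk hD hw h hh hfix
  have hadd : ∀ y, a (y + 1) = a y + a (a.symm 0 + 1) := by
    intro y
    have := h_apply (a y)
    rw [h1] at this
    simp only [Equiv.Perm.coe_one, id_eq, Equiv.symm_apply_apply] at this
    linear_combination -this
  set c := a (a.symm 0 + 1) with hc
  have hlin : ∀ n : ℕ, a n = c * n + a 0 := by
    intro n
    induction n with
    | zero => simp
    | succ n ih => push_cast; rw [hadd, ih]; ring
  have hlin' : ∀ x, a x = c * x + a 0 := by
    intro x
    have := hlin x.val
    simpa using this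
  have hunit : c * (a.symm (a 0 + 1)) = 1 := by
    have := hlin' (a.symm (a 0 + 1))
    rw [Equiv.apply_symm_apply] at this
    linear_combination -this
  refine ⟨(Units.mkOfMulEqOne _ _ hunit, a 0), ?_⟩
  ext1 x
  rw [hlin']
  simp [affinePerm]

end Tame

section Count

variable {v k : ℕ} [NeZero v]

lemma image_act_mul (f g : Equiv.Perm (ZMod v)) (D : Set (Block v)) :
    act (f * g) '' D = act f '' (act g '' D) := by
  rw [Set.image_image]
  refine Set.image_congr fun E _ => ?_
  rw [act_act]; rfl

lemma image_act_one (D : Set (Block v)) : act (1 : Equiv.Perm (ZMod v)) '' D = D := by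
  have : (act (1 : Equiv.Perm (ZMod v)) : Block v → Block v) = id := by
    funext E; exact act_id E
  rw [this, Set.image_id]

/-- The automorphism group of a set of blocks. -/
def autGroup (D : Set (Block v)) : Subgroup (Equiv.Perm (ZMod v)) where
  carrier := {g | act g '' D = D}
  mul_mem' := fun {a b} ha hb => by
    rw [Set.mem_ofPred_eq] at *
    rw [Equiv.Perm.coe_mul] at *
    have := image_act_mul a b D
    rw [hb, ha] at this
    exact this
  one_mem' := image_act_one D
  inv_mem' := fun {a} ha => by
    rw [Set.mem_ofPred_eq] at *
    have := image_act_mul a⁻¹ a D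
    rw [ha, inv_mul_cancel, image_act_one] at this
    exact this.symm

lemma mem_autGroup {D : Set (Block v)} {g : Equiv.Perm (ZMod v)} :
    g ∈ autGroup D ↔ act g '' D = D := Iff.rfl

lemma addRight_mem_autGroup {D : Set (Block v)} (hD : ∀ E ∈ D, ∀ z, translateBlock E z ∈ D)
    (z : ZMod v) : Equiv.addRight z ∈ autGroup D := by
  rw [mem_autGroup]
  refine Set.Subset.antisymm ?_ fun E hE => ?_
  · rintro _ ⟨E, hE, rfl⟩
    exact hD E hE z
  · refine ⟨translateBlock E (-z), hD E hE _, ?_⟩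
    refine (translateBlock_translateBlock E (-z) z).trans ?_
    simp [translateBlock_zero]

open Classical in
lemma card_fixedPointFree_le (G : Subgroup (Equiv.Perm (ZMod v)))
    (hG : ∀ z, Equiv.addRight z ∈ G) :
    v * (Finset.univ.filter fun g : G => ∀ x, g.1 x ≠ x).card ≤ (v - 1) * Fintype.card G := by
  set G₀ := Finset.univ.filter fun g : G => g.1 0 = 0
  set R := Finset.univ.filter fun g : G => ∀ x, g.1 x ≠ x
  have h1 : G₀.card + R.card ≤ Fintype.card G := by
    rw [← Finset.card_union_of_disjoint]
    · exact Finset.card_le_univ _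
    · rw [Finset.disjoint_left]
      intro g hg hg'
      exact (Finset.mem_filter.1 hg').2 0 (Finset.mem_filter.1 hg).2
  have h2 : Fintype.card G ≤ v * G₀.card := by
    have : Fintype.card G ≤ ((Finset.univ : Finset (ZMod v)) ×ˢ G₀).card := by
      rw [← Finset.card_univ]
      refine Finset.card_le_card_of_injOn
        (fun g => (g.1 0, ⟨Equiv.addRight (-(g.1 0)), hG _⟩ * g)) ?_ ?_
      · intro g _
        simp [G₀]
      · intro g _ g' _ h
        simp only [Prod.mk.injEq] at h
        have h3 := h.2
        rw [← h.1] at h3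
        exact mul_left_cancel h3
    simpa [ZMod.card] using this
  obtain ⟨n, hn⟩ : ∃ n, v = n + 1 := ⟨v - 1, by have := NeZero.pos v; omega⟩
  have h3 : v - 1 = n := by omega
  rw [h3]
  have h4 : v * G₀.card + v * R.card ≤ v * Fintype.card G := by
    rw [← mul_add]; exact Nat.mul_le_mul_left _ h1
  have h5 : v * Fintype.card G = n * Fintype.card G + Fintype.card G := by
    linear_combination Fintype.card G * hn
  omega

open Classical in
lemma class_bound (hk : 3 ≤ k) {D : Set (Block v)} (hD : IsCyclicDesign v k D)
    (W : Finset (ZMod v)) (hW : (0 : ZMod v) ∉ W) (I : Finset (Set (Block v)))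
    (hI : ∀ B ∈ I, IsCyclicDesign v k B ∧ (∀ w ∈ W, Generates B w) ∧
      ∃ f : Equiv.Perm (ZMod v), act f '' D = B) :
    I.card * W.card ≤ v.totient * (v - 1) := by
  set G := autGroup D
  have hG := addRight_mem_autGroup hD.2
  set R := Finset.univ.filter fun g : G => ∀ x, g.1 x ≠ x
  set 𝓕 := Finset.univ.filter fun f : Equiv.Perm (ZMod v) => act f '' D ∈ I
  have h1 : I.card * Fintype.card G ≤ 𝓕.card := by
    choose! φ hφ using fun B hB => (hI B hB).2.2
    rw [← Finset.card_univ, ← Finset.card_product]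
    have key : ∀ B ∈ I, ∀ g : G, act (φ B * g.1) '' D = B := by
      intro B hB g
      rw [image_act_mul, mem_autGroup.1 g.2, hφ B hB]
    refine Finset.card_le_card_of_injOn (fun p => φ p.1 * p.2.1) ?_ ?_
    · rintro ⟨B, g⟩ hp
      have hB := (Finset.mem_product.1 hp).1
      refine Finset.mem_coe.2 (Finset.mem_filter.2 ⟨Finset.mem_univ _, ?_⟩)
      rw [key B hB g]
      exact hB
    · rintro ⟨B, g⟩ hp ⟨B', g'⟩ hp' h
      have hB := (Finset.mem_product.1 hp).1
      have hB' := (Finset.mem_product.1 hp').1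
      simp only at h hB hB'
      obtain rfl : B = B' := by rw [← key B hB g, ← key B' hB' g', h]
      simpa using h
  let ψ : Equiv.Perm (ZMod v) × ZMod v → Equiv.Perm (ZMod v) :=
    fun p => p.1⁻¹ * Equiv.addRight p.2 * p.1
  have hψ : ∀ p ∈ 𝓕 ×ˢ W, ψ p ∈ R.map ⟨Subtype.val, Subtype.val_injective⟩ := by
    rintro ⟨f, w⟩ hp
    obtain ⟨hf, hw⟩ := Finset.mem_product.1 hp
    have hf' := (Finset.mem_filter.1 hf).2
    have hB := hI _ hf'
    have hmem : ψ (f, w) ∈ G := by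
      rw [mem_autGroup]
      simp only [ψ]
      rw [image_act_mul, image_act_mul, mem_autGroup.1 (addRight_mem_autGroup hB.1.2 w),
        ← image_act_mul, inv_mul_cancel, image_act_one]
    simp only [Finset.mem_map, Function.Embedding.coeFn_mk]
    refine ⟨⟨_, hmem⟩, Finset.mem_filter.2 ⟨Finset.mem_univ _, fun x hx => ?_⟩, rfl⟩
    simp only [ψ, Equiv.Perm.mul_apply, Equiv.Perm.inv_eq_iff_eq, Equiv.coe_addRight] at hx
    have : w = 0 := by simpa using hx
    exact hW (this ▸ hw)
  have h2 : (𝓕 ×ˢ W).card ≤ (v.totient * v) * (R.map ⟨Subtype.val, Subtype.val_injective⟩).card := by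
    refine Finset.card_le_mul_card_image_of_maps_to hψ _ fun g _ => ?_
    rcases Finset.eq_empty_or_nonempty {p ∈ 𝓕 ×ˢ W | ψ p = g} with h | ⟨⟨f, w⟩, hp⟩
    · rw [h]; simp
    obtain ⟨hp, hg⟩ := Finset.mem_filter.1 hp
    obtain ⟨hf, hw⟩ := Finset.mem_product.1 hp
    have hB := hI _ (Finset.mem_filter.1 hf).2
    have haff : ∀ p ∈ {p ∈ 𝓕 ×ˢ W | ψ p = g}, (∃ q, p.1 * f⁻¹ = affinePerm q) ∧
        p.1⁻¹ * Equiv.addRight p.2 * p.1 = f⁻¹ * Equiv.addRight w * f := by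
      rintro ⟨f', w'⟩ hp'
      obtain ⟨hp', hg'⟩ := Finset.mem_filter.1 hp'
      obtain ⟨hf', hw'⟩ := Finset.mem_product.1 hp'
      have hB' := hI _ (Finset.mem_filter.1 hf').2
      have heq : f'⁻¹ * Equiv.addRight w' * f' = f⁻¹ * Equiv.addRight w * f := hg'.trans hg.symm
      refine ⟨affine_of_conj hk hB.1 hB'.1 (hB'.2.1 w' hw') (f' * f⁻¹) (w := w) ?_ ?_, heq⟩
      · rw [← image_act_mul]; simp
      · intro x
        have h3 : f' * f⁻¹ * Equiv.addRight w = Equiv.addRight w' * (f' * f⁻¹) := by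
          have : f' * (f⁻¹ * Equiv.addRight w * f) * f⁻¹
            = f' * (f'⁻¹ * Equiv.addRight w' * f') * f⁻¹ := by rw [heq]
          simpa [mul_assoc] using this
        exact congrArg (fun e : Equiv.Perm (ZMod v) => e x) h3
    have hcard : (Finset.univ.image (affinePerm (v := v))).card ≤ v.totient * v := by
      refine Finset.card_image_le.trans ?_
      rw [Finset.card_univ, Fintype.card_prod, ZMod.card_units_eq_totient, ZMod.card]
    refine le_trans (Finset.card_le_card_of_injOn (fun p => p.1 * f⁻¹) ?_ ?_) hcard
    · intro p hp
      obtain ⟨q, hq⟩ := (haff p hp).1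
      exact Finset.mem_coe.2 (Finset.mem_image.2 ⟨q, Finset.mem_univ _, hq.symm⟩)
    · rintro ⟨f₁, w₁⟩ h₁ ⟨f₂, w₂⟩ h₂ h
      obtain rfl : f₁ = f₂ := by simpa using h
      have := ((haff _ h₁).2.trans (haff _ h₂).2.symm)
      have h5 : (Equiv.addRight w₁ : Equiv.Perm (ZMod v)) = Equiv.addRight w₂ := by simpa using this
      have := congrArg (fun e : Equiv.Perm (ZMod v) => e 0) h5
      simpa using this
  rw [Finset.card_map, Finset.card_product] at h2
  have h3 := card_fixedPointFree_le G hG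
  have hpos : 0 < Fintype.card G := Fintype.card_pos
  refine Nat.le_of_mul_le_mul_right ?_ hpos
  calc I.card * W.card * Fintype.card G = (I.card * Fintype.card G) * W.card := by ring
    _ ≤ 𝓕.card * W.card := Nat.mul_le_mul_right _ h1
    _ ≤ v.totient * v * R.card := h2
    _ = v.totient * (v * R.card) := by ring
    _ ≤ v.totient * ((v - 1) * Fintype.card G) := Nat.mul_le_mul_left _ h3
    _ = _ := by ring

lemma isomorphic_iff {B B' : Set (Block v)} :
    Isomorphic B B' ↔ ∃ f : Equiv.Perm (ZMod v), act f '' B = B' :=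
  exists_congr fun _ => eq_comm

lemma isomorphic_equivalence : Equivalence
    (fun B B' : {B : Set (Block v) // IsCyclicDesign v k B} => Isomorphic B.1 B'.1) where
  refl B := isomorphic_iff.2 ⟨1, image_act_one B.1⟩
  symm {B B'} h := by
    obtain ⟨f, hf⟩ := isomorphic_iff.1 h
    refine isomorphic_iff.2 ⟨f⁻¹, ?_⟩
    rw [← hf, ← image_act_mul, inv_mul_cancel, image_act_one]
  trans {A B C} h h' := by
    obtain ⟨f, hf⟩ := isomorphic_iff.1 h
    obtain ⟨g, hg⟩ := isomorphic_iff.1 h'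
    refine isomorphic_iff.2 ⟨g * f, ?_⟩
    rw [image_act_mul, hf, hg]

/-- If every point of `W` generates each of the cyclic designs in `S`, then `S` meets many
isomorphism classes. -/
theorem card_mul_card_le_NC (hk : 3 ≤ k) (W : Finset (ZMod v)) (hW : (0 : ZMod v) ∉ W)
    (S : Finset (Set (Block v)))
    (hS : ∀ B ∈ S, IsCyclicDesign v k B ∧ ∀ w ∈ W, Generates B w) :
    S.card * W.card ≤ NC v k * (v.totient * (v - 1)) := by
  classical
  let r := fun B B' : {B : Set (Block v) // IsCyclicDesign v k B} => Isomorphic B.1 B'.1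
  have : Fintype (Quot r) := Fintype.ofFinite _
  have hNC : NC v k = (Finset.univ : Finset (Quot r)).card := by
    rw [Finset.card_univ, ← Nat.card_eq_fintype_card]; rfl
  let π : {B // B ∈ S} → Quot r := fun B => Quot.mk r ⟨B.1, (hS B.1 B.2).1⟩
  have h := Finset.card_eq_sum_card_fiberwise (f := π) (s := S.attach) (t := Finset.univ)
    (fun _ _ => Finset.mem_coe.2 (Finset.mem_univ _))
  rw [Finset.card_attach] at h
  rw [h, Finset.sum_mul, hNC, ← smul_eq_mul]
  refine Finset.sum_le_card_nsmul _ _ _ fun q _ => ?_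
  obtain ⟨D, rfl⟩ := Quot.exists_rep q
  have := class_bound hk D.2 W hW
    ((S.attach.filter fun B => π B = Quot.mk r D).map ⟨Subtype.val, Subtype.val_injective⟩) ?_
  · rwa [Finset.card_map] at this
  · intro B hB
    simp only [Finset.mem_map, Finset.mem_filter, Finset.mem_attach, true_and,
      Function.Embedding.coeFn_mk] at hB
    obtain ⟨⟨B, hB⟩, hq, rfl⟩ := hB
    refine ⟨(hS B hB).1, (hS B hB).2, ?_⟩
    have := (isomorphic_equivalence (v := v) (k := k)).eqvGen_iff.1 (Quot.eqvGen_exact hq.symm)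
    exact isomorphic_iff.1 this

end Count

section Orbits

variable {v k : ℕ} [NeZero v]

/-- A translation invariant set of `k`-cycles that decomposes the edges whose difference
lies in `A`. -/
structure PartialDesign (v k : ℕ) [NeZero v] (A : Set (ZMod v)) (S : Set (Block v)) : Prop where
  cycle : ∀ E ∈ S, IsCycleBlock v k E
  diffs_subset : ∀ E ∈ S, ∀ x ∈ diffs E, x ∈ A
  translate : ∀ E ∈ S, ∀ z, translateBlock E z ∈ S
  cover : ∀ x ∈ A, x ≠ 0 → ∃ E ∈ S, x ∈ diffs E
  unique : ∀ E ∈ S, ∀ E' ∈ S, ∀ a b, s(a, b) ∈ E → s(a, b) ∈ E' → E = E'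

lemma PartialDesign.isCyclicDesign {S : Set (Block v)}
    (h : PartialDesign v k Set.univ S) : IsCyclicDesign v k S := by
  refine ⟨⟨h.cycle, fun e => ?_⟩, h.translate⟩
  induction e using Sym2.ind with
  | _ a b =>
    intro hab
    obtain ⟨E, hE, hx⟩ := h.cover (a - b) trivial (sub_ne_zero.2 (by simpa using hab))
    obtain ⟨c, hc⟩ := mem_diffs.1 hx
    refine ⟨translateBlock E (b - c), ⟨h.translate E hE _, ?_⟩, fun E' hE' => ?_⟩
    · rw [mem_translateBlock]
      convert hc using 2 <;> ring
    · refine h.unique _ hE'.1 _ (h.translate E hE _) a b hE'.2 ?_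
      rw [mem_translateBlock]
      convert hc using 2 <;> ring

lemma PartialDesign.union {A : Set (ZMod v)} {S S' : Set (Block v)} (h : PartialDesign v k A S)
    (h' : PartialDesign v k Aᶜ S') : IsCyclicDesign v k (S ∪ S') := by
  refine PartialDesign.isCyclicDesign ⟨?_, fun _ _ _ _ => trivial, ?_, ?_, ?_⟩
  · rintro E (hE | hE)
    exacts [h.cycle E hE, h'.cycle E hE]
  · rintro E (hE | hE) z
    exacts [Or.inl (h.translate E hE z), Or.inr (h'.translate E hE z)]
  · intro x _ hx
    by_cases hA : x ∈ A
    · obtain ⟨E, hE, hxE⟩ := h.cover x hA hx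
      exact ⟨E, Or.inl hE, hxE⟩
    · obtain ⟨E, hE, hxE⟩ := h'.cover x hA hx
      exact ⟨E, Or.inr hE, hxE⟩
  · rintro E (hE | hE) E' (hE' | hE') a b hab hab'
    · exact h.unique E hE E' hE' a b hab hab'
    · exact absurd (h.diffs_subset E hE _ (sub_mem_diffs hab))
        (h'.diffs_subset E' hE' _ (sub_mem_diffs hab'))
    · exact absurd (h.diffs_subset E' hE' _ (sub_mem_diffs hab'))
        (h'.diffs_subset E hE _ (sub_mem_diffs hab))
    · exact h'.unique E hE E' hE' a b hab hab'

lemma IsCyclicDesign.restrict (hk : 3 ≤ k) {D : Set (Block v)} (hD : IsCyclicDesign v k D)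
    {A : Set (ZMod v)} (hA : ∀ E ∈ D, ∀ x ∈ diffs E, x ∈ A → ∀ y ∈ diffs E, y ∈ A) :
    PartialDesign v k A {E | E ∈ D ∧ ∀ x ∈ diffs E, x ∈ A} where
  cycle E hE := hD.1.1 E hE.1
  diffs_subset E hE := hE.2
  translate E hE z := ⟨hD.2 E hE.1 z, by rw [diffs_translateBlock]; exact hE.2⟩
  cover x hx hx0 := by
    obtain ⟨E, hE, hxE⟩ := hD.exists_diffs hx0
    exact ⟨E, ⟨hE, hA E hE x hxE hx⟩, hxE⟩
  unique E hE E' hE' a b := hD.1.eq_of_mem hk hE.1 hE'.1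

/-- The set of all translates of the members of a family of blocks. -/
def translates (𝓔 : Set (Block v)) : Set (Block v) := {E | ∃ E' ∈ 𝓔, ∃ z, E = translateBlock E' z}

lemma subset_translates (𝓔 : Set (Block v)) : 𝓔 ⊆ translates 𝓔 :=
  fun E hE => ⟨E, hE, 0, (translateBlock_zero E).symm⟩

lemma partialDesign_translates (hk : 3 ≤ k) {A : Set (ZMod v)} {𝓔 : Set (Block v)}
    (h1 : ∀ E ∈ 𝓔, IsCycleBlock v k E) (h2 : ∀ E ∈ 𝓔, ∀ x ∈ diffs E, x ∈ A)
    (h3 : ∀ x ∈ A, x ≠ 0 → ∃ E ∈ 𝓔, x ∈ diffs E)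
    (h4 : ∀ E ∈ 𝓔, ∀ E' ∈ 𝓔, ∀ x b b', s(b + x, b) ∈ E → s(b' + x, b') ∈ E' →
      translateBlock E (b' - b) = E') :
    PartialDesign v k A (translates 𝓔) where
  cycle := by
    rintro _ ⟨E, hE, z, rfl⟩
    exact (h1 E hE).translateBlock hk z
  diffs_subset := by
    rintro _ ⟨E, hE, z, rfl⟩
    rw [diffs_translateBlock]
    exact h2 E hE
  translate := by
    rintro _ ⟨E, hE, z, rfl⟩ z'
    exact ⟨E, hE, z + z', translateBlock_translateBlock E z z'⟩
  cover x hx hx0 := by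
    obtain ⟨E, hE, hxE⟩ := h3 x hx hx0
    exact ⟨E, subset_translates _ hE, hxE⟩
  unique := by
    rintro _ ⟨E, hE, z, rfl⟩ _ ⟨E', hE', z', rfl⟩ a b hab hab'
    rw [mem_translateBlock] at hab hab'
    have := h4 E hE E' hE' (a - b) (b - z) (b - z') (by convert hab using 2; ring)
      (by convert hab' using 2; ring)
    rw [← this, translateBlock_translateBlock]
    congr 1
    ring

/-- The ordered pairs of adjacent vertices of a block. -/
def arcs (E : Block v) : Finset (ZMod v × ZMod v) :=
  Finset.univ.filter fun p => s(p.1, p.2) ∈ E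

lemma mem_arcs {E : Block v} {a b : ZMod v} : (a, b) ∈ arcs E ↔ s(a, b) ∈ E := by simp [arcs]

lemma card_arcs (hk : 3 ≤ k) {E : Block v} (hE : IsCycleBlock v k E) : (arcs E).card = 2 * k := by
  have : NeZero k := ⟨by omega⟩
  obtain ⟨c, hc, rfl⟩ := isCycleBlock_iff.1 hE
  have e : arcs (cyc c) = (Finset.univ.image fun i : ZMod k => (c i, c (i + 1))) ∪
      (Finset.univ.image fun i : ZMod k => (c (i + 1), c i)) := by
    ext ⟨a, b⟩
    simp only [mem_arcs, mem_cyc, Finset.mem_union, Finset.mem_image, Finset.mem_univ, true_and,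
      Prod.mk.injEq, exists_or, eq_comm]
  rw [e, Finset.card_union_of_disjoint, Finset.card_image_of_injective,
    Finset.card_image_of_injective, Finset.card_univ, ZMod.card, two_mul]
  · intro i j h
    exact hc (Prod.mk.inj h).2
  · intro i j h
    exact hc (Prod.mk.inj h).1
  · rw [Finset.disjoint_left]
    rintro ⟨a, b⟩ h h'
    obtain ⟨i, -, hi⟩ := Finset.mem_image.1 h
    obtain ⟨j, -, hj⟩ := Finset.mem_image.1 h'
    have := hi.trans hj.symm
    have h1 := hc (Prod.mk.inj this).1
    have h2 := hc (Prod.mk.inj this).2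
    exact two_ne_zero_of hk (by linear_combination h2 - h1)

lemma diffs_eq_image (E : Block v) : diffs E = (arcs E).image fun p => p.1 - p.2 := by
  ext x
  simp only [mem_diffs, Finset.mem_image, Prod.exists, mem_arcs]
  constructor
  · rintro ⟨b, h⟩; exact ⟨b + x, b, h, by ring⟩
  · rintro ⟨a, b, h, rfl⟩; exact ⟨b, by convert h using 2; ring⟩

lemma card_diffs_le (hk : 3 ≤ k) {E : Block v} (hE : IsCycleBlock v k E) :
    (diffs E).card ≤ 2 * k := by
  rw [diffs_eq_image, ← card_arcs hk hE]
  exact Finset.card_image_le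

lemma card_diffs_eq_iff (hk : 3 ≤ k) {E : Block v} (hE : IsCycleBlock v k E) :
    (diffs E).card = 2 * k ↔
      ∀ x b b', s(b + x, b) ∈ E → s(b' + x, b') ∈ E → b = b' := by
  rw [diffs_eq_image, ← card_arcs hk hE, Finset.card_image_iff]
  constructor
  · intro h x b b' hb hb'
    have := h (Finset.mem_coe.2 (mem_arcs.2 hb)) (Finset.mem_coe.2 (mem_arcs.2 hb')) (by simp)
    exact (Prod.mk.inj this).2
  · rintro h ⟨a, b⟩ hp ⟨a', b'⟩ hp' hx
    have hp := mem_arcs.1 (Finset.mem_coe.1 hp)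
    have hp' := mem_arcs.1 (Finset.mem_coe.1 hp')
    simp only at hx
    have := h (a - b) b b' (by convert hp using 2; ring) (by rw [hx]; convert hp' using 2; ring)
    subst this
    simpa using hx

/-- The positions of the edges of difference `x`. -/
def positions (E : Block v) (x : ZMod v) : Finset (ZMod v) :=
  Finset.univ.filter fun b => s(b + x, b) ∈ E

lemma mem_positions {E : Block v} {x b : ZMod v} : b ∈ positions E x ↔ s(b + x, b) ∈ E := by
  simp [positions]

lemma count_fullDiffs (hk : 3 ≤ k) {E : Block v} (hE : IsCycleBlock v k E) (x : ZMod v) :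
    (fullDiffs E).count x = (positions E x).card := by
  have h1 : (fullDiffs E).count x = ∑ e ∈ E, (edgeDiffs e).count x := by
    rw [fullDiffs, Multiset.count_bind]; rfl
  have h2 : (positions E x).card = ∑ e ∈ E, (Finset.univ.filter fun b => s(b + x, b) = e).card := by
    rw [Finset.card_eq_sum_card_fiberwise (f := fun b => s(b + x, b)) (t := E)]
    · refine Finset.sum_congr rfl fun e he => congrArg _ ?_
      ext b
      simp only [Finset.mem_filter, mem_positions, Finset.mem_univ, true_and, and_iff_right_iff_imp]
      rintro rfl; exact he
    · intro b hb
      exact mem_positions.1 hb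
  rw [h1, h2]
  refine Finset.sum_congr rfl fun e he => ?_
  induction e using Sym2.ind with
  | _ p q =>
    have hpq := hE.ne hk he
    have e1 : (edgeDiffs s(p, q)).count x
        = (if x = p - q then 1 else 0) + (if x = q - p then 1 else 0) := by
      change Multiset.count x ((p - q) ::ₘ {q - p}) = _
      rw [Multiset.count_cons, Multiset.count_singleton, add_comm]
    have e2 : (Finset.univ.filter fun b => s(b + x, b) = s(p, q))
        = (if x = p - q then {q} else ∅) ∪ (if x = q - p then {p} else ∅) := by
      ext b
      simp only [Finset.mem_filter, Finset.mem_univ, true_and, Sym2.eq_iff, Finset.mem_union,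
        eq_sub_iff_add_eq]
      split_ifs <;> simp only [Finset.mem_singleton, Finset.notMem_empty, or_false, false_or]
      all_goals grind
    rw [e1, e2, Finset.card_union_of_disjoint]
    · split_ifs <;> simp
    · split_ifs <;> simp [hpq.symm]

lemma count_partialDiffs (hk : 3 ≤ k) {E : Block v} (hE : IsCycleBlock v k E) (x : ZMod v) :
    (partialDiffs E).count x = (positions E x).card / cycleType E := by
  rw [partialDiffs, Multiset.count_bind]
  change ∑ y ∈ (fullDiffs E).toFinset, _ = _
  simp only [Multiset.count_replicate]
  rw [Finset.sum_ite_eq']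
  split_ifs with h
  · rw [count_fullDiffs hk hE]
  · rw [Multiset.mem_toFinset, ← Multiset.count_eq_zero, count_fullDiffs hk hE] at h
    simp [h]

/-- The translations that stabilise a block. -/
def stab (E : Block v) : Finset (ZMod v) := Finset.univ.filter fun z => translateBlock E z = E

lemma cycleType_eq (E : Block v) : cycleType E = (stab E).card := by
  rw [cycleType, Nat.card_eq_fintype_card, Fintype.card_subtype]; rfl

lemma mem_stab {E : Block v} {z : ZMod v} : z ∈ stab E ↔ translateBlock E z = E := by simp [stab]

lemma cycleType_pos (E : Block v) : 0 < cycleType E := by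
  rw [cycleType_eq, Finset.card_pos]
  exact ⟨0, mem_stab.2 (translateBlock_zero E)⟩

lemma add_mem_positions {E : Block v} {x b z : ZMod v} (hb : b ∈ positions E x)
    (hz : z ∈ stab E) : b + z ∈ positions E x := by
  rw [mem_positions] at *
  rw [mem_stab] at hz
  rw [← hz, mem_translateBlock]
  convert hb using 2 <;> ring

lemma cycleType_le {E : Block v} {x b : ZMod v} (hb : b ∈ positions E x) :
    cycleType E ≤ (positions E x).card := by
  rw [cycleType_eq]
  exact Finset.card_le_card_of_injOn (b + ·) (fun z hz => add_mem_positions hb hz)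
    (fun _ _ _ _ h => add_left_cancel h)

lemma two_cycleType_le {E : Block v} {x b b' : ZMod v} (hb : b ∈ positions E x)
    (hb' : b' ∈ positions E x) (h : translateBlock E (b' - b) ≠ E) :
    2 * cycleType E ≤ (positions E x).card := by
  have h1 : Disjoint ((stab E).image (b + ·)) ((stab E).image (b' + ·)) := by
    rw [Finset.disjoint_left]
    intro y hy hy'
    obtain ⟨z, hz, rfl⟩ := Finset.mem_image.1 hy
    obtain ⟨z', hz', h'⟩ := Finset.mem_image.1 hy'
    rw [mem_stab] at hz hz'
    apply h
    calc translateBlock E (b' - b) = translateBlock (translateBlock E z') (b' - b) := by rw [hz']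
      _ = translateBlock E z := by
          rw [translateBlock_translateBlock]; congr 1; linear_combination h'
      _ = E := hz
  have h2 : (stab E).image (b + ·) ∪ (stab E).image (b' + ·) ⊆ positions E x := by
    intro y hy
    rcases Finset.mem_union.1 hy with hy | hy <;> obtain ⟨z, hz, rfl⟩ := Finset.mem_image.1 hy
    exacts [add_mem_positions hb hz, add_mem_positions hb' hz]
  have := Finset.card_le_card h2
  rw [Finset.card_union_of_disjoint h1, Finset.card_image_of_injective _ (add_right_injective b),
    Finset.card_image_of_injective _ (add_right_injective b'), ← cycleType_eq] at this
  omega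

open Classical in
/-- The sets of differences of the blocks of `D`. -/
noncomputable def classes (D : Set (Block v)) : Finset (Finset (ZMod v)) :=
  Finset.univ.filter fun X => ∃ E ∈ D, diffs E = X

lemma mem_classes {D : Set (Block v)} {X : Finset (ZMod v)} :
    X ∈ classes D ↔ ∃ E ∈ D, diffs E = X := by simp [classes]

/-- A difference system gives rise to a cyclic design. -/
theorem exists_design_of_differenceSystem (hk : 3 ≤ k) {F : Finset (Block v)}
    (hF : IsDifferenceSystem v k F) :
    ∃ D : Set (Block v), IsCyclicDesign v k D ∧
      (F.filter fun E => cycleType E = 1).card ≤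
        ((classes D).filter fun X => X.card = 2 * k).card := by
  have hsum : ∀ x ≠ 0, ∑ E ∈ F, (positions E x).card / cycleType E = 1 := by
    intro x hx
    have := hF.2 x
    rw [if_neg hx, Multiset.count_bind] at this
    rw [← this]
    exact (Finset.sum_congr rfl fun E hE => count_partialDiffs hk (hF.1 E hE) x).symm
  have hpos : ∀ (E : Block v) (x b : ZMod v), b ∈ positions E x → 1 ≤ (positions E x).card / cycleType E := by
    intro E x b hb
    rw [Nat.le_div_iff_mul_le (cycleType_pos E), one_mul]
    exact cycleType_le hb
  have hx0 : ∀ E ∈ F, ∀ x b, b ∈ positions E x → x ≠ 0 := by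
    rintro E hE x b hb rfl
    exact (hF.1 E hE).ne hk (mem_positions.1 hb) (by simp)
  have huniq : ∀ E ∈ F, ∀ E' ∈ F, ∀ x b b' : ZMod v, b ∈ positions E x → b' ∈ positions E' x → E = E' := by
    intro E hE E' hE' x b b' hb hb'
    by_contra hne
    have h1 : ∑ E ∈ ({E, E'} : Finset (Block v)), (positions E x).card / cycleType E ≤ 1 := by
      rw [← hsum x (hx0 E hE x b hb)]
      refine Finset.sum_le_sum_of_subset ?_
      intro y hy
      rcases Finset.mem_insert.1 hy with rfl | hy
      · exact hE
      · rwa [Finset.mem_singleton.1 hy]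
    rw [Finset.sum_pair hne] at h1
    have := hpos E x b hb
    have := hpos E' x b' hb'
    omega
  have hlt : ∀ E ∈ F, ∀ x b, b ∈ positions E x → (positions E x).card < 2 * cycleType E := by
    intro E hE x b hb
    have h1 := Finset.single_le_sum (f := fun E => (positions E x).card / cycleType E)
      (fun _ _ => Nat.zero_le _) hE
    rw [hsum x (hx0 E hE x b hb)] at h1
    exact (Nat.div_lt_iff_lt_mul (cycleType_pos E)).1 (by omega)
  refine ⟨translates (F : Set (Block v)), PartialDesign.isCyclicDesign
    (partialDesign_translates hk (fun E hE => hF.1 E hE) (fun _ _ _ _ => trivial) ?_ ?_), ?_⟩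
  · intro x _ hx
    have h1 : ∑ E ∈ F, (positions E x).card / cycleType E ≠ 0 := by rw [hsum x hx]; simp
    obtain ⟨E, hE, h⟩ := Finset.exists_ne_zero_of_sum_ne_zero h1
    have : (positions E x).Nonempty := by
      rw [← Finset.card_pos]
      by_contra h'
      simp at h'
      simp [h'] at h
    obtain ⟨b, hb⟩ := this
    exact ⟨E, hE, mem_diffs.2 ⟨b, mem_positions.1 hb⟩⟩
  · intro E hE E' hE' x b b' hb hb'
    rw [← mem_positions] at hb hb'
    obtain rfl := huniq E hE E' hE' x b b' hb hb'
    by_contra h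
    have := two_cycleType_le hb hb' h
    have := hlt E hE x b hb
    omega
  · refine Finset.card_le_card_of_injOn diffs ?_ ?_
    · intro E hE
      obtain ⟨hE, h1⟩ := Finset.mem_filter.1 hE
      refine Finset.mem_coe.2 (Finset.mem_filter.2 ⟨mem_classes.2 ⟨E, subset_translates _ hE, rfl⟩, ?_⟩)
      rw [card_diffs_eq_iff hk (hF.1 E hE)]
      intro x b b' hb hb'
      rw [← mem_positions] at hb hb'
      have := hlt E hE x b hb
      rw [h1] at this
      exact Finset.card_le_one.1 (by omega) b hb b' hb'
    · intro E hE E' hE' h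
      have hE := (Finset.mem_filter.1 hE).1
      have hE' := (Finset.mem_filter.1 hE').1
      obtain ⟨x, hx⟩ := diffs_nonempty hk (hF.1 E hE)
      obtain ⟨b, hb⟩ := mem_diffs.1 hx
      rw [h] at hx
      obtain ⟨b', hb'⟩ := mem_diffs.1 hx
      exact huniq E hE E' hE' x b b' (mem_positions.2 hb) (mem_positions.2 hb')

end Orbits

section Flip

variable {v k : ℕ} [NeZero v]

lemma mem_diffs_cyc [NeZero k] {c : ZMod k → ZMod v} {x : ZMod v} :
    x ∈ diffs (cyc c) ↔ ∃ i, x = c (i + 1) - c i ∨ x = -(c (i + 1) - c i) := by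
  simp only [mem_diffs, mem_cyc]
  constructor
  · rintro ⟨b, i, ⟨h1, h2⟩ | ⟨h1, h2⟩⟩
    · exact ⟨i, Or.inr (by linear_combination h1 - h2)⟩
    · exact ⟨i, Or.inl (by linear_combination h1 - h2)⟩
  · rintro ⟨i, rfl | rfl⟩
    · exact ⟨c i, i, Or.inr ⟨by ring, rfl⟩⟩
    · exact ⟨c (i + 1), i, Or.inl ⟨by ring, rfl⟩⟩

/-- A block with more than four differences is not equivalent to its negative. -/
lemma translate_ne_neg (hk : 3 ≤ k) {D : Set (Block v)} (hD : IsCyclicDesign v k D) {E : Block v}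
    (hE : E ∈ D) (h4 : 4 < (diffs E).card) (z : ZMod v) :
    translateBlock E z ≠ mulBlock (-1) E := by
  intro hz
  have : NeZero k := ⟨by omega⟩
  obtain ⟨c, hc, rfl⟩ := isCycleBlock_iff.1 (hD.1.1 E hE)
  have hneg : mulBlock (-1) (cyc c) ∈ D := hz ▸ hD.2 _ hE z
  have hrefl : ∀ i m, c i + c (i + 1) - c m = c (2 * i + 1 - m) := by
    intro i m
    let f : ZMod v → ZMod v := fun x => c i + c (i + 1) - x
    have hf : act f (cyc c) = translateBlock (mulBlock (-1) (cyc c)) (c i + c (i + 1)) := by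
      refine Eq.trans ?_ (act_act _ _ _).symm
      congr 1
      funext x
      simp [f]; ring
    have hfix : act f (cyc c) = cyc c := by
      refine hD.1.eq_of_mem hk (hf ▸ hD.2 _ hneg _) hE (a := c i) (b := c (i + 1)) ?_
        (mem_cyc.2 ⟨i, Or.inl ⟨rfl, rfl⟩⟩)
      rw [act_cyc, mem_cyc]
      exact ⟨i, Or.inr ⟨by simp [f], by simp [f]⟩⟩
    rw [act_cyc] at hfix
    have hsub : cyc (fun j => (f ∘ c) (j + i)) ⊆ cyc c := by rw [cyc_shift, hfix]
    have hinj : Function.Injective (fun j => (f ∘ c) (j + i)) := by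
      intro a b hab
      have : c (a + i) = c (b + i) := by simpa [f] using hab
      exact add_right_cancel (hc this)
    have := param_unique hk hc hinj hsub (a := i + 1) (ε := -1) (Or.inr rfl) (by simp [f])
      (by simp [f, add_comm]) (m - i)
    simp only [Function.comp_apply, sub_add_cancel, f] at this
    rw [this]; congr 1; ring
  let d : ZMod k → ZMod v := fun i => c (i + 1) - c i
  have hd2 : ∀ m, d (m + 2) = d m := by
    intro m
    have h1 := hrefl 0 (-m)
    have h3 := hrefl 1 (-m)
    simp only [d]
    rw [show (2 * 0 + 1 - -m : ZMod k) = m + 1 by ring] at h1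
    rw [show (2 * 1 + 1 - -m : ZMod k) = m + 2 + 1 by ring] at h3
    have h5 := hrefl 0 (-m + 1)
    rw [show (2 * 0 + 1 - (-m + 1) : ZMod k) = m by ring] at h5
    have h6 := hrefl 1 (-m + 1)
    rw [show (2 * 1 + 1 - (-m + 1) : ZMod k) = m + 2 by ring] at h6
    linear_combination h1 - h5 - h3 + h6
  have hdn : ∀ n : ℕ, d n = d 0 ∨ d n = d 1 := by
    intro n
    induction n using Nat.strong_induction_on with
    | _ n ih =>
      match n with
      | 0 => simp
      | 1 => simp
      | n + 2 =>
        push_cast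
        rw [hd2]
        exact ih n (by omega)
  have hsub : diffs (cyc c) ⊆ {d 0, -d 0, d 1, -d 1} := by
    intro x hx
    obtain ⟨i, hi⟩ := mem_diffs_cyc.1 hx
    have h1 := hdn i.val
    rw [ZMod.natCast_zmod_val] at h1
    have h2 : x = d i ∨ x = -d i := hi
    simp only [Finset.mem_insert, Finset.mem_singleton]
    rcases h1 with h1 | h1 <;> rw [h1] at h2 <;> tauto
  have := (Finset.card_le_card hsub).trans Finset.card_le_four
  omega

lemma neg_notMem (hk : 3 ≤ k) {D : Set (Block v)} (hD : IsCyclicDesign v k D) {E : Block v}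
    (hE : E ∈ D) (h4 : 4 < (diffs E).card) : mulBlock (-1) E ∉ D := by
  intro h
  obtain ⟨x, hx⟩ := diffs_nonempty hk (hD.1.1 E hE)
  obtain ⟨z, hz⟩ := hD.exists_translate hk hE h hx (by rwa [diffs_neg])
  exact translate_ne_neg hk hD hE h4 z hz

lemma neg_neg_block (E : Block v) : mulBlock (-1) (mulBlock (-1) E) = E := by
  rw [mulBlock_mulBlock]; simp [mulBlock_one]

/-- The blocks that agree with the design selected by each of their differences. -/
def mix (sel : ZMod v → Set (Block v)) : Set (Block v) := {E | ∃ x ∈ diffs E, E ∈ sel x}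

/-- The selection `sel` of a design for each difference is constant on differences of a block. -/
def Coherent (sel : ZMod v → Set (Block v)) : Prop :=
  ∀ x, ∀ E ∈ sel x, x ∈ diffs E → ∀ y ∈ diffs E, sel y = sel x

lemma Coherent.mem {sel : ZMod v → Set (Block v)} (h : Coherent sel) {E : Block v}
    (hE : E ∈ mix sel) {y : ZMod v} (hy : y ∈ diffs E) : E ∈ sel y := by
  obtain ⟨x, hx, hEx⟩ := hE
  rwa [h x E hEx hx y hy]

lemma Coherent.isCyclicDesign (hk : 3 ≤ k) {sel : ZMod v → Set (Block v)} (h : Coherent sel)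
    (hsel : ∀ x, IsCyclicDesign v k (sel x)) : IsCyclicDesign v k (mix sel) := by
  refine PartialDesign.isCyclicDesign ⟨?_, fun _ _ _ _ => trivial, ?_, ?_, ?_⟩
  · rintro E ⟨x, -, hE⟩
    exact (hsel x).1.1 E hE
  · rintro E ⟨x, hx, hE⟩ z
    exact ⟨x, by rwa [diffs_translateBlock], (hsel x).2 E hE z⟩
  · intro x _ hx
    obtain ⟨E, hE, hxE⟩ := (hsel x).exists_diffs hx
    exact ⟨E, ⟨x, hxE, hE⟩, hxE⟩
  · intro E hE E' hE' a b hab hab'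
    exact (hsel (a - b)).1.eq_of_mem hk (h.mem hE (sub_mem_diffs hab))
      (h.mem hE' (sub_mem_diffs hab')) hab hab'

open Classical in
/-- Replace by their negatives the blocks of `B` whose set of differences belongs to `S`. -/
noncomputable def flip (B : Set (Block v)) (S : Finset (Finset (ZMod v))) : Set (Block v) :=
  mix fun x => if ∃ X ∈ S, x ∈ X then mulBlock (-1) '' B else B

lemma mem_neg_image {B : Set (Block v)} {E : Block v} :
    E ∈ mulBlock (-1) '' B ↔ mulBlock (-1) E ∈ B := by
  constructor
  · rintro ⟨E', hE', rfl⟩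
    rwa [neg_neg_block]
  · intro h
    exact ⟨_, h, neg_neg_block E⟩

variable {B : Set (Block v)} {S : Finset (Finset (ZMod v))}

lemma mem_class_iff (hk : 3 ≤ k) (hB : IsCyclicDesign v k B) (hS : S ⊆ classes B) {E : Block v}
    (hE : E ∈ B ∨ mulBlock (-1) E ∈ B) {x : ZMod v} (hx : x ∈ diffs E) :
    (∃ X ∈ S, x ∈ X) ↔ diffs E ∈ S := by
  constructor
  · rintro ⟨X, hX, hxX⟩
    obtain ⟨E', hE', rfl⟩ := mem_classes.1 (hS hX)
    rcases hE with hE | hE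
    · rwa [hB.diffs_eq hk hE hE' hx hxX]
    · rw [← diffs_neg] at hx ⊢
      rwa [hB.diffs_eq hk hE hE' hx hxX]
  · intro h
    exact ⟨_, h, hx⟩

lemma mem_flip (hk : 3 ≤ k) (hB : IsCyclicDesign v k B) (hS : S ⊆ classes B) {E : Block v} :
    E ∈ flip B S ↔ (E ∈ B ∧ diffs E ∉ S) ∨ (mulBlock (-1) E ∈ B ∧ diffs E ∈ S) := by
  constructor
  · rintro ⟨x, hx, hE⟩
    beta_reduce at hE
    split_ifs at hE with h
    · rw [mem_neg_image] at hE
      exact Or.inr ⟨hE, (mem_class_iff hk hB hS (Or.inr hE) hx).1 h⟩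
    · exact Or.inl ⟨hE, fun h' => h ((mem_class_iff hk hB hS (Or.inl hE) hx).2 h')⟩
  · rintro (⟨hE, h⟩ | ⟨hE, h⟩)
    · obtain ⟨x, hx⟩ := diffs_nonempty hk (hB.1.1 E hE)
      refine ⟨x, hx, ?_⟩
      beta_reduce
      rw [if_neg fun h' => h ((mem_class_iff hk hB hS (Or.inl hE) hx).1 h')]
      exact hE
    · obtain ⟨x, hx⟩ := diffs_nonempty hk (hB.1.1 _ hE)
      rw [diffs_neg] at hx
      refine ⟨x, hx, ?_⟩
      beta_reduce
      rw [if_pos (⟨_, h, hx⟩ : ∃ X ∈ S, x ∈ X)]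
      exact mem_neg_image.2 hE

lemma flip_isCyclicDesign (hk : 3 ≤ k) (hB : IsCyclicDesign v k B) (hS : S ⊆ classes B) :
    IsCyclicDesign v k (flip B S) := by
  refine Coherent.isCyclicDesign hk ?_ fun x => ?_
  · intro x E hE hx y hy
    have hE' : E ∈ B ∨ mulBlock (-1) E ∈ B := by
      beta_reduce at hE
      split_ifs at hE
      exacts [Or.inr (mem_neg_image.1 hE), Or.inl hE]
    simp only [mem_class_iff hk hB hS hE' hx, mem_class_iff hk hB hS hE' hy]
  · split_ifs
    exacts [hB.mulBlock hk _, hB]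

lemma closed_of_closed_flip (hk : 3 ≤ k) (hB : IsCyclicDesign v k B) (hS : S ⊆ classes B)
    {J : AddSubgroup (ZMod v)} (hJ : Closed (flip B S) J) : Closed B J := by
  intro E hE x hx
  by_cases h : diffs E ∈ S
  · have := hJ (mulBlock (-1) E) ((mem_flip hk hB hS).2
      (Or.inr ⟨by rwa [neg_neg_block], by rwa [diffs_neg]⟩)) x (by rwa [diffs_neg])
    rwa [diffs_neg] at this
  · exact hJ E ((mem_flip hk hB hS).2 (Or.inl ⟨hE, h⟩)) x hx

lemma mem_or_neg_mem_of_mem_flip (hk : 3 ≤ k) (hB : IsCyclicDesign v k B) (hS : S ⊆ classes B)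
    {E : Block v} (hE : E ∈ flip B S) : E ∈ B ∨ mulBlock (-1) E ∈ B := by
  rcases (mem_flip hk hB hS).1 hE with h | h
  exacts [Or.inl h.1, Or.inr h.1]

lemma mem_or_neg_mem_flip (hk : 3 ≤ k) (hB : IsCyclicDesign v k B) (hS : S ⊆ classes B)
    {E : Block v} (hE : E ∈ B) : E ∈ flip B S ∨ mulBlock (-1) E ∈ flip B S := by
  by_cases h : diffs E ∈ S
  · exact Or.inr ((mem_flip hk hB hS).2 (Or.inr ⟨by rwa [neg_neg_block], by rwa [diffs_neg]⟩))
  · exact Or.inl ((mem_flip hk hB hS).2 (Or.inl ⟨hE, h⟩))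

lemma flip_subset (hk : 3 ≤ k) (hB : IsCyclicDesign v k B) (hS : S ⊆ classes B)
    {S' : Finset (Finset (ZMod v))} (hS' : S' ⊆ classes B) (h4 : ∀ X ∈ S, 4 < X.card)
    (h : flip B S = flip B S') : S ⊆ S' := by
  intro X hX
  by_contra hX'
  obtain ⟨E, hE, rfl⟩ := mem_classes.1 (hS hX)
  have : E ∈ flip B S := h ▸ (mem_flip hk hB hS').2 (Or.inl ⟨hE, hX'⟩)
  rcases (mem_flip hk hB hS).1 this with h' | h'
  · exact h'.2 hX
  · exact neg_notMem hk hB hE (h4 _ hX) h'.1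

end Flip

section Count

variable {v k : ℕ} [NeZero v]

open Classical in
/-- The classes of `B` with more than four elements, all of them generating the subgroup `J`. -/
noncomputable def bigOn (D B : Set (Block v)) (J : AddSubgroup (ZMod v)) :
    Finset (Finset (ZMod v)) :=
  (classes B).filter fun X => 4 < X.card ∧ ∀ x ∈ X, cl D x = J

/-- The classes of `B` with more than four elements. -/
noncomputable def big (B : Set (Block v)) : Finset (Finset (ZMod v)) :=
  (classes B).filter fun X => 4 < X.card

/-- A cyclic design that can replace `D` on the differences that generate `J`. -/
structure Replacement (k : ℕ) (D : Set (Block v)) (J : AddSubgroup (ZMod v))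
    (D' : Set (Block v)) : Prop where
  design : IsCyclicDesign v k D'
  saturated : ∀ E ∈ D', ∀ x ∈ diffs E, cl D x = J → ∀ y ∈ diffs E, cl D y = J
  closed : ∀ J' : AddSubgroup (ZMod v), (∀ E ∈ D', ∀ x ∈ diffs E, cl D x = J → x ∈ J' → ∀ y ∈ diffs E, y ∈ J') →
    ∀ E ∈ D, ∀ x ∈ diffs E, cl D x = J → x ∈ J' → ∀ y ∈ diffs E, y ∈ J'
  card_le : (bigOn D D J).card ≤ (bigOn D D' J).card
  ne : ∃ E ∈ D', (∃ x ∈ diffs E, cl D x = J) ∧ E ∉ D ∧ mulBlock (-1) E ∉ D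

/-- There is a choice to be made on the differences that generate `J`. -/
def FreeAt (k : ℕ) (D : Set (Block v)) (J : AddSubgroup (ZMod v)) : Prop :=
  (∃ E ∈ D, (∀ x ∈ diffs E, cl D x = J) ∧ 4 < (diffs E).card ∧ (diffs E).card < 2 * k) ∨
    ∃ D', Replacement k D J D'

variable {D : Set (Block v)} {alt : AddSubgroup (ZMod v) → Set (Block v)}
  {b : Finset (AddSubgroup (ZMod v))}

open Classical in
/-- Replace `D` by `alt J` on the differences that generate `J`, for each `J ∈ b`. -/
noncomputable def patchSel (D : Set (Block v)) (alt : AddSubgroup (ZMod v) → Set (Block v))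
    (b : Finset (AddSubgroup (ZMod v))) (x : ZMod v) : Set (Block v) :=
  if cl D x ∈ b then alt (cl D x) else D

lemma patchSel_of_mem {x : ZMod v} (h : cl D x ∈ b) : patchSel D alt b x = alt (cl D x) := if_pos h

lemma patchSel_of_notMem {x : ZMod v} (h : cl D x ∉ b) : patchSel D alt b x = D := if_neg h

lemma coherent_patchSel (halt : ∀ J ∈ b, Replacement k D J (alt J)) :
    Coherent (patchSel D alt b) := by
  intro x E hE hx y hy
  have : cl D y = cl D x := by
    by_cases h : cl D x ∈ b
    · rw [patchSel_of_mem h] at hE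
      exact (halt _ h).saturated E hE x hx rfl y hy
    · rw [patchSel_of_notMem h] at hE
      exact cl_eq_of_mem_diffs hE hy hx
  rw [patchSel, patchSel, this]

lemma patch_isCyclicDesign (hk : 3 ≤ k) (hD : IsCyclicDesign v k D)
    (halt : ∀ J ∈ b, Replacement k D J (alt J)) :
    IsCyclicDesign v k (mix (patchSel D alt b)) := by
  refine (coherent_patchSel halt).isCyclicDesign hk fun x => ?_
  by_cases h : cl D x ∈ b
  · rw [patchSel_of_mem h]; exact (halt _ h).design
  · rwa [patchSel_of_notMem h]

lemma closed_of_closed_patch (halt : ∀ J ∈ b, Replacement k D J (alt J))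
    {J : AddSubgroup (ZMod v)} (hJ : Closed (mix (patchSel D alt b)) J) : Closed D J := by
  intro E hE x hx hxJ
  by_cases h : cl D x ∈ b
  · refine (halt _ h).closed J (fun E' hE' z hz hzx hzJ => hJ E' ⟨z, hz, ?_⟩ z hz hzJ) E hE x hx rfl
      hxJ
    rwa [patchSel_of_mem (hzx ▸ h), hzx]
  · exact hJ E ⟨x, hx, by rwa [patchSel_of_notMem h]⟩ x hx hxJ

open Classical in
lemma card_big_patch (halt : ∀ J ∈ b, Replacement k D J (alt J)) :
    (big D).card ≤ (big (mix (patchSel D alt b))).card := by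
  have : Fintype (AddSubgroup (ZMod v)) := Fintype.ofFinite _
  let lab : Finset (ZMod v) → AddSubgroup (ZMod v) := fun X =>
    if h : X.Nonempty then cl D h.choose else ⊥
  have hlab : ∀ X : Finset (ZMod v), X.Nonempty → ∃ x ∈ X, lab X = cl D x := by
    intro X h
    exact ⟨h.choose, h.choose_spec, dif_pos h⟩
  rw [Finset.card_eq_sum_card_fiberwise (f := lab) (t := Finset.univ) (fun _ _ => Finset.mem_univ _),
    Finset.card_eq_sum_card_fiberwise (s := big (mix _)) (f := lab) (t := Finset.univ)
      (fun _ _ => Finset.mem_univ _)]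
  refine Finset.sum_le_sum fun J _ => ?_
  have h1 : (big D).filter (fun X => lab X = J) ⊆ bigOn D D J := by
    intro X hX
    obtain ⟨hX, hJ⟩ := Finset.mem_filter.1 hX
    obtain ⟨hX, h4⟩ := Finset.mem_filter.1 hX
    refine Finset.mem_filter.2 ⟨hX, h4, fun x hx => ?_⟩
    obtain ⟨y, hy, hy'⟩ := hlab X ⟨x, hx⟩
    obtain ⟨E, hE, rfl⟩ := mem_classes.1 hX
    rw [← hJ, hy', cl_eq_of_mem_diffs hE hx hy]
  have h2 : ∀ B, (∀ x, cl D x = J → patchSel D alt b x = B) →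
      bigOn D B J ⊆ (big (mix (patchSel D alt b))).filter (fun X => lab X = J) := by
    intro B hB X hX
    obtain ⟨hX, h4, hJ⟩ := Finset.mem_filter.1 hX
    have hne : X.Nonempty := Finset.card_pos.1 (by omega)
    obtain ⟨y, hy, hy'⟩ := hlab X hne
    obtain ⟨E, hE, rfl⟩ := mem_classes.1 hX
    refine Finset.mem_filter.2 ⟨Finset.mem_filter.2 ⟨mem_classes.2 ⟨E, ⟨y, hy, ?_⟩, rfl⟩, h4⟩, ?_⟩
    · rw [hB y (hJ y hy)]; exact hE
    · rw [hy', hJ y hy]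
  refine (Finset.card_le_card h1).trans ?_
  by_cases hJ : J ∈ b
  · exact (halt J hJ).card_le.trans (Finset.card_le_card (h2 _ (by
      rintro x rfl; exact patchSel_of_mem hJ)))
  · exact Finset.card_le_card (h2 _ (by rintro x rfl; exact patchSel_of_notMem hJ))

open Classical in
/-- Independent choices: the flips of the large classes and the alternatives on the free labels. -/
theorem exists_many_designs (hk : 3 ≤ k) (hD : IsCyclicDesign v k D)
    (𝓛 : Finset (AddSubgroup (ZMod v))) (hfree : ∀ J ∈ 𝓛, FreeAt k D J) :
    ∃ S : Finset (Set (Block v)),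
      2 ^ (((classes D).filter fun X => X.card = 2 * k).card + 𝓛.card) ≤ S.card ∧
      ∀ B ∈ S, IsCyclicDesign v k B ∧ ∀ J, Closed B J → Closed D J := by
  let 𝒢 := 𝓛.filter fun J => ∃ D', Replacement k D J D'
  have hch : ∀ J, ∃ D', J ∈ 𝒢 → Replacement k D J D' := by
    intro J
    by_cases h : J ∈ 𝒢
    · obtain ⟨D', h'⟩ := (Finset.mem_filter.1 h).2
      exact ⟨D', fun _ => h'⟩
    · exact ⟨∅, fun h' => absurd h' h⟩
  choose alt halt using hch
  have halt' : ∀ b ∈ 𝒢.powerset, ∀ J ∈ b, Replacement k D J (alt J) :=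
    fun b hb J hJ => halt J (Finset.mem_powerset.1 hb hJ)
  have hexp : ((classes D).filter fun X => X.card = 2 * k).card + 𝓛.card
      ≤ 𝒢.card + (big D).card := by
    have h1 : (𝓛.filter fun J => ¬ ∃ D', Replacement k D J D').card
        ≤ ((big D).filter fun X => ¬ X.card = 2 * k).card := by
      have : ∀ J, ∃ X, J ∈ 𝓛.filter (fun J => ¬ ∃ D', Replacement k D J D') →
          X ∈ (big D).filter (fun X => ¬ X.card = 2 * k) ∧ ∀ x ∈ X, cl D x = J := by
        intro J
        by_cases hJ : J ∈ 𝓛.filter (fun J => ¬ ∃ D', Replacement k D J D')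
        · obtain ⟨hJ1, hJ2⟩ := Finset.mem_filter.1 hJ
          rcases hfree J hJ1 with ⟨E, hE, hl, h4, h2k⟩ | h
          · exact ⟨diffs E, fun _ => ⟨Finset.mem_filter.2 ⟨Finset.mem_filter.2
              ⟨mem_classes.2 ⟨E, hE, rfl⟩, h4⟩, by omega⟩, hl⟩⟩
          · exact absurd h hJ2
        · exact ⟨∅, fun h => absurd h hJ⟩
      choose X hX using this
      refine Finset.card_le_card_of_injOn X (fun J hJ => (hX J hJ).1) ?_
      intro J hJ J' hJ' h
      have hmem := (hX J hJ).1
      have : (X J).Nonempty := by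
        have := (Finset.mem_filter.1 (Finset.mem_filter.1 hmem).1).2
        exact Finset.card_pos.1 (by omega)
      obtain ⟨x, hx⟩ := this
      rw [← (hX J hJ).2 x hx, ← (hX J' hJ').2 x (h ▸ hx)]
    have h2 := Finset.card_filter_add_card_filter_not (s := 𝓛) (fun J => ∃ D', Replacement k D J D')
    have h3 := Finset.card_filter_add_card_filter_not (s := big D) (fun X => X.card = 2 * k)
    have h4 : ((classes D).filter fun X => X.card = 2 * k)
        = (big D).filter fun X => X.card = 2 * k := by
      rw [big, Finset.filter_filter]
      refine Finset.filter_congr fun X _ => ⟨fun h => ⟨by omega, h⟩, fun h => h.2⟩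
    rw [h4]
    change _ ≤ (𝓛.filter fun J => ∃ D', Replacement k D J D').card + _
    omega
  let P := fun b => mix (patchSel D alt b)
  have hP : ∀ b ∈ 𝒢.powerset, IsCyclicDesign v k (P b) := fun b hb =>
    patch_isCyclicDesign hk hD (halt' b hb)
  have hbig : ∀ B : Set (Block v), ∀ S ∈ (big B).powerset, S ⊆ classes B := fun B S hS =>
    (Finset.mem_powerset.1 hS).trans (Finset.filter_subset _ _)
  let I := 𝒢.powerset.sigma fun b => (big (P b)).powerset
  have hinj : Set.InjOn (fun p : (_ : Finset (AddSubgroup (ZMod v))) × Finset (Finset (ZMod v)) =>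
      flip (P p.1) p.2) I := by
    have key : ∀ p ∈ I, ∀ q ∈ I, flip (P p.1) p.2 = flip (P q.1) q.2 → p.1 ⊆ q.1 := by
      rintro ⟨b, S⟩ hp ⟨b', S'⟩ hq h J hJ
      obtain ⟨hb, hS⟩ := Finset.mem_sigma.1 hp
      obtain ⟨hb', hS'⟩ := Finset.mem_sigma.1 hq
      simp only at h hJ hb hb' hS hS' ⊢
      by_contra hJ'
      obtain ⟨E, hE, ⟨x, hx, rfl⟩, h1, h2⟩ := (halt' b hb J hJ).ne
      have hEP : E ∈ P b := ⟨x, hx, by rwa [patchSel_of_mem hJ]⟩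
      have hcase : ∀ E', E' ∈ P b' → x ∈ diffs E' → E' ∈ D := by
        intro E' hE' hx'
        have := (coherent_patchSel (halt' b' hb')).mem hE' hx'
        rwa [patchSel_of_notMem hJ'] at this
      rcases mem_or_neg_mem_flip hk (hP b hb) (hbig _ _ hS) hEP with h3 | h3 <;> rw [h] at h3 <;>
        rcases mem_or_neg_mem_of_mem_flip hk (hP b' hb') (hbig _ _ hS') h3 with h4 | h4
      · exact h1 (hcase _ h4 hx)
      · exact h2 (hcase _ h4 (by rwa [diffs_neg]))
      · exact h2 (hcase _ h4 (by rwa [diffs_neg]))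
      · rw [neg_neg_block] at h4
        exact h1 (hcase _ h4 hx)
    intro p hp q hq h
    have e := (key p hp q hq h).antisymm (key q hq p hp h.symm)
    obtain ⟨b, S⟩ := p
    obtain ⟨b', S'⟩ := q
    simp only at e
    subst e
    obtain ⟨hb, hS⟩ := Finset.mem_sigma.1 hp
    obtain ⟨-, hS'⟩ := Finset.mem_sigma.1 hq
    simp only at h hb hS hS'
    have h4 : ∀ S ∈ (big (P b)).powerset, ∀ X ∈ S, 4 < X.card := fun S hS X hX =>
      (Finset.mem_filter.1 (Finset.mem_powerset.1 hS hX)).2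
    rw [(flip_subset hk (hP b hb) (hbig _ _ hS) (hbig _ _ hS') (h4 S hS) h).antisymm
      (flip_subset hk (hP b hb) (hbig _ _ hS') (hbig _ _ hS) (h4 S' hS') h.symm)]
  refine ⟨I.image fun p => flip (P p.1) p.2, ?_, ?_⟩
  · rw [Finset.card_image_of_injOn hinj, Finset.card_sigma]
    calc 2 ^ (((classes D).filter fun X => X.card = 2 * k).card + 𝓛.card)
        ≤ 2 ^ (𝒢.card + (big D).card) := Nat.pow_le_pow_right (by norm_num) hexp
      _ = ∑ b ∈ 𝒢.powerset, 2 ^ (big D).card := by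
          rw [Finset.sum_const, Finset.card_powerset, smul_eq_mul, pow_add]
      _ ≤ _ := Finset.sum_le_sum fun b hb => by
          rw [Finset.card_powerset]
          exact Nat.pow_le_pow_right (by norm_num) (card_big_patch (halt' b hb))
  · intro B hB
    obtain ⟨⟨b, S⟩, hp, rfl⟩ := Finset.mem_image.1 hB
    obtain ⟨hb, hS⟩ := Finset.mem_sigma.1 hp
    exact ⟨flip_isCyclicDesign hk (hP b hb) (hbig _ _ hS), fun J hJ => closed_of_closed_patch
      (halt' b hb) (closed_of_closed_flip hk (hP b hb) (hbig _ _ hS) hJ)⟩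

end Count

section Units

variable {v : ℕ} [NeZero v]

lemma exists_unit {n a : ℕ} (hn : n ∣ v) (ha : a.Coprime n) :
    ∃ u : (ZMod v)ˣ, ∀ y : ZMod v, n • y = 0 → u * y = a * y := by
  obtain ⟨u, hu⟩ := ZMod.unitsMap_surjective hn (ZMod.unitOfCoprime a ha)
  refine ⟨u, fun y hy => ?_⟩
  have h1 : ((u : ZMod v).cast : ZMod n) = (a : ZMod n) := by
    have := congrArg Units.val hu
    simpa [ZMod.unitsMap_def] using this
  obtain ⟨m, hm⟩ : ∃ m : ℕ, (m : ZMod v) = u := ⟨(u : ZMod v).val, ZMod.natCast_zmod_val _⟩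
  rw [← hm] at h1 ⊢
  rw [ZMod.cast_natCast hn, ZMod.natCast_eq_natCast_iff] at h1
  have h2 : ((m : ℤ) - a) • y = 0 := by
    obtain ⟨c, hc⟩ := h1.symm.dvd
    rw [hc, mul_comm, mul_zsmul, natCast_zsmul, hy, smul_zero]
  rw [sub_zsmul, ← sub_eq_add_neg, sub_eq_zero, natCast_zsmul, natCast_zsmul, nsmul_eq_mul, nsmul_eq_mul] at h2
  exact h2

lemma addOrderOf_dvd (x : ZMod v) : addOrderOf x ∣ v := by
  rw [addOrderOf_dvd_iff_nsmul_eq_zero, nsmul_eq_mul, ZMod.natCast_self, zero_mul]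

lemma mem_zmultiples_of_dvd {x y : ZMod v} (h : addOrderOf x ∣ addOrderOf y) :
    x ∈ AddSubgroup.zmultiples y := by
  have h1 := IsAddCyclic.card_nsmul_eq_zero_le (α := ZMod v) (addOrderOf_pos y)
  have h2 : Finset.univ.filter (· ∈ AddSubgroup.zmultiples y)
      ⊆ Finset.univ.filter (fun z : ZMod v => addOrderOf y • z = 0) := by
    intro z hz
    obtain ⟨m, rfl⟩ := AddSubgroup.mem_zmultiples_iff.1 (Finset.mem_filter.1 hz).2
    refine Finset.mem_filter.2 ⟨Finset.mem_univ _, ?_⟩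
    rw [smul_comm, addOrderOf_nsmul_eq_zero, smul_zero]
  have h3 : (Finset.univ.filter (· ∈ AddSubgroup.zmultiples y)).card = addOrderOf y := by
    rw [← Nat.card_zmultiples, Nat.card_eq_fintype_card, Fintype.card_subtype]
  have h4 := Finset.eq_of_subset_of_card_le h2 (h1.trans h3.ge)
  have h5 : x ∈ Finset.univ.filter (fun z : ZMod v => addOrderOf y • z = 0) :=
    Finset.mem_filter.2 ⟨Finset.mem_univ _, addOrderOf_dvd_iff_nsmul_eq_zero.1 h⟩
  rw [← h4] at h5
  exact (Finset.mem_filter.1 h5).2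

lemma exists_unit_mul_eq {x y : ZMod v} (h : addOrderOf x = addOrderOf y) :
    ∃ u : (ZMod v)ˣ, u * x = y := by
  obtain ⟨a, ha⟩ := (mem_zmultiples_iff_mem_range_addOrderOf (x := x)).1
    (mem_zmultiples_of_dvd h.symm.dvd) |> Finset.mem_image.1
  have hn := addOrderOf_pos x
  have hcop : a.Coprime (addOrderOf x) := by
    have h1 := addOrderOf_nsmul (n := a) x
    rw [ha.2, ← h] at h1
    have h2 : (addOrderOf x).gcd a = 1 := by
      have h3 := Nat.div_mul_cancel ((addOrderOf x).gcd_dvd_left a)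
      rw [← h1] at h3
      exact Nat.eq_of_mul_eq_mul_left hn (by rw [h3, mul_one])
    rwa [Nat.coprime_comm]
  obtain ⟨u, hu⟩ := exists_unit (addOrderOf_dvd x) hcop
  refine ⟨u, ?_⟩
  rw [hu x (addOrderOf_nsmul_eq_zero x), ← nsmul_eq_mul, ha.2]

lemma addOrderOf_unit_mul (u : (ZMod v)ˣ) (x : ZMod v) : addOrderOf (u * x) = addOrderOf x := by
  refine addOrderOf_eq_addOrderOf_iff.2 fun n => ?_
  simp only [nsmul_eq_mul]
  rw [mul_left_comm, Units.mul_right_eq_zero]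

lemma card_stabilizer_mul (x : ZMod v) :
    Nat.card (MulAction.stabilizer (ZMod v)ˣ x) * (addOrderOf x).totient = v.totient := by
  classical
  have h := MulAction.card_orbit_mul_card_stabilizer_eq_card_group (ZMod v)ˣ x
  rw [ZMod.card_units_eq_totient] at h
  have h1 : Fintype.card (MulAction.orbit (ZMod v)ˣ x) = (addOrderOf x).totient := by
    rw [← IsAddCyclic.card_addOrderOf_eq_totient (α := ZMod v) (d := addOrderOf x)
      (by rw [ZMod.card]; exact addOrderOf_dvd x), ← Fintype.card_subtype]
    refine Fintype.card_congr (Equiv.subtypeEquivRight fun y => ?_)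
    rw [MulAction.mem_orbit_iff]
    constructor
    · rintro ⟨u, rfl⟩
      exact addOrderOf_unit_mul u x
    · intro hy
      exact exists_unit_mul_eq hy.symm
  rw [← h, h1, Nat.card_eq_fintype_card, mul_comm]

lemma odd_eq_one_of_totient_le_one {m : ℕ} (hm : Odd m) (h : m.totient ≤ 1) : m = 1 := by
  have h0 := Nat.totient_pos.2 hm.pos
  rcases Nat.totient_eq_one_iff.1 (le_antisymm h h0) with h | h
  · exact h
  · subst h; revert hm; decide

lemma odd_le_three_of_totient_le_two {m : ℕ} (hm : Odd m) (h : m.totient ≤ 2) :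
    m = 1 ∨ m = 3 := by
  have h2 : Nat.Coprime 2 m := Nat.coprime_two_left.2 hm
  by_contra! hne
  have h5 : 5 ≤ m := by
    obtain ⟨r, rfl⟩ := hm
    omega
  have : ({1, 2, 4} : Finset ℕ) ⊆ (Finset.range m).filter m.Coprime := by
    intro a ha
    simp only [Finset.mem_insert, Finset.mem_singleton] at ha
    refine Finset.mem_filter.2 ⟨Finset.mem_range.2 (by omega), ?_⟩
    rcases ha with rfl | rfl | rfl
    · simp
    · exact h2.symm
    · exact (Nat.Coprime.pow_left 2 h2).symm
  have := Finset.card_le_card this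
  rw [← Nat.totient_eq_card_coprime] at this
  simp at this
  omega

lemma odd_addOrderOf (hv : Odd v) (x : ZMod v) : Odd (addOrderOf x) :=
  Odd.of_dvd_nat hv (addOrderOf_dvd x)

/-- If the units fixing `x` also fix `y` then `y` is a multiple of `x`. -/
lemma addOrderOf_dvd_of_fix (hv : Odd v) {x y : ZMod v}
    (h : ∀ u : (ZMod v)ˣ, u * x = x → u * y = y) : addOrderOf y ∣ addOrderOf x := by
  obtain ⟨w, hw⟩ := exists_zmultiples (AddSubgroup.zmultiples x ⊔ AddSubgroup.zmultiples y)
  have hxw : x ∈ AddSubgroup.zmultiples w := hw ▸ (le_sup_left :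
    AddSubgroup.zmultiples x ≤ _) (AddSubgroup.mem_zmultiples x)
  have hyw : y ∈ AddSubgroup.zmultiples w := hw ▸ (le_sup_right :
    AddSubgroup.zmultiples y ≤ _) (AddSubgroup.mem_zmultiples y)
  have hfix : ∀ (u : (ZMod v)ˣ) (a : ZMod v), u * a = a →
      ∀ b ∈ AddSubgroup.zmultiples a, u * b = b := by
    rintro u a ha b hb
    obtain ⟨m, rfl⟩ := AddSubgroup.mem_zmultiples_iff.1 hb
    rw [mul_smul_comm, ha]
  have hst : MulAction.stabilizer (ZMod v)ˣ w = MulAction.stabilizer (ZMod v)ˣ x := by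
    ext u
    change u * w = w ↔ u * x = x
    constructor
    · exact fun hu => hfix u w hu x hxw
    · intro hu
      have : w ∈ AddSubgroup.zmultiples x ⊔ AddSubgroup.zmultiples y :=
        hw ▸ AddSubgroup.mem_zmultiples w
      obtain ⟨a, ha, b, hb, rfl⟩ := AddSubgroup.mem_sup.1 this
      rw [mul_add, hfix u x hu a ha, hfix u y (h u hu) b hb]
  have hdvd : ∀ z ∈ AddSubgroup.zmultiples w, addOrderOf z ∣ addOrderOf w := by
    intro z hz
    obtain ⟨m, rfl⟩ := AddSubgroup.mem_zmultiples_iff.1 hz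
    rw [addOrderOf_dvd_iff_nsmul_eq_zero, smul_comm, addOrderOf_nsmul_eq_zero, smul_zero]
  have h1 := card_stabilizer_mul w
  have h2 := card_stabilizer_mul x
  rw [hst] at h1
  have h3 : (addOrderOf w).totient = (addOrderOf x).totient :=
    Nat.eq_of_mul_eq_mul_left Nat.card_pos (h1.trans h2.symm)
  obtain ⟨r, hr⟩ := hdvd x hxw
  have hrodd : Odd r := by
    have := odd_addOrderOf hv w
    rw [hr] at this
    exact (Nat.odd_mul.1 this).2
  have h4 := Nat.totient_super_multiplicative (addOrderOf x) r
  rw [← hr, h3] at h4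
  have h5 := Nat.totient_pos.2 (addOrderOf_pos x)
  have hr1 : r = 1 := odd_eq_one_of_totient_le_one hrodd (by nlinarith)
  rw [hr1, mul_one] at hr
  exact hr ▸ hdvd y hyw

end Units

section Rigid

variable {v k : ℕ} [NeZero v] [NeZero k]

/-- The sequence of steps of a closed tuple. -/
def step (c : ZMod k → ZMod v) (i : ZMod k) : ZMod v := c (i + 1) - c i

variable {D : Set (Block v)} {c c' : ZMod k → ZMod v}

lemma step_mem_diffs (c : ZMod k → ZMod v) (i : ZMod k) : step c i ∈ diffs (cyc c) :=
  mem_diffs_cyc.2 ⟨i, Or.inl rfl⟩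

lemma mem_diffs_cyc' {x : ZMod v} : x ∈ diffs (cyc c) ↔ ∃ i, x = step c i ∨ x = -step c i :=
  mem_diffs_cyc

lemma translateBlock_cyc (c : ZMod k → ZMod v) (z : ZMod v) :
    translateBlock (cyc c) z = cyc fun i => c i + z := act_cyc _ c

lemma mulBlock_cyc (u : (ZMod v)ˣ) (c : ZMod k → ZMod v) :
    mulBlock u (cyc c) = cyc fun i => (u : ZMod v) * c i := act_cyc _ c

lemma mul_injective (u : (ZMod v)ˣ) (hc : Function.Injective c) :
    Function.Injective fun i => (u : ZMod v) * c i := fun _ _ h => hc ((Units.mul_right_inj u).1 h)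

lemma step_mul (u : ZMod v) (c : ZMod k → ZMod v) (i : ZMod k) :
    step (fun i => u * c i) i = u * step c i := by simp only [step]; ring

lemma rigid (hk : 3 ≤ k) (hD : IsCyclicDesign v k D) (hc : Function.Injective c)
    (hc' : Function.Injective c') (hE : cyc c ∈ D) (hE' : cyc c' ∈ D) {a b : ZMod k}
    (h : step c' a = step c b) (m : ZMod k) : c' (a + m) - c' a = c (b + m) - c b := by
  let z := c b - c' a
  have h1 : translateBlock (cyc c') z = cyc c := by
    refine hD.1.eq_of_mem hk (hD.2 _ hE' z) hE (a := c b) (b := c (b + 1)) ?_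
      (mem_cyc.2 ⟨b, Or.inl ⟨rfl, rfl⟩⟩)
    rw [translateBlock_cyc, mem_cyc]
    refine ⟨a, Or.inl ⟨by simp only [z]; ring, ?_⟩⟩
    simp only [step] at h
    simp only [z]
    linear_combination -h
  rw [translateBlock_cyc] at h1
  have h2 := param_unique hk hc (c' := fun i => c' (i + a) + z) ?_ ?_ (a := b) (ε := 1)
    (Or.inl rfl) ?_ ?_ m
  · simp only [z, one_mul] at h2
    rw [add_comm a m]
    linear_combination h2
  · intro i j hij
    exact add_right_cancel (hc' (add_right_cancel hij))
  · rw [← h1]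
    exact (cyc_shift (fun i => c' i + z) a).subset
  · simp [z]
  · simp only [step] at h
    simp only [z]
    rw [add_comm 1 a]
    linear_combination h

lemma rigid_step (hk : 3 ≤ k) (hD : IsCyclicDesign v k D) (hc : Function.Injective c)
    (hc' : Function.Injective c') (hE : cyc c ∈ D) (hE' : cyc c' ∈ D) {a b : ZMod k}
    (h : step c' a = step c b) (m : ZMod k) : step c' (a + m) = step c (b + m) := by
  have h1 := rigid hk hD hc hc' hE hE' h (m + 1)
  have h2 := rigid hk hD hc hc' hE hE' h m
  simp only [step, add_assoc]
  linear_combination h1 - h2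

lemma step_reverse (c : ZMod k → ZMod v) (i : ZMod k) :
    step (fun i => c (-i)) i = -step c (-i - 1) := by
  simp only [step]
  rw [show -(i + 1) = -i - 1 by ring]
  ring_nf

lemma rigid_step_neg (hk : 3 ≤ k) (hD : IsCyclicDesign v k D) (hc : Function.Injective c)
    (hc' : Function.Injective c') (hE : cyc c ∈ D) (hE' : cyc c' ∈ D) {a b : ZMod k}
    (h : step c' a = -step c b) (m : ZMod k) : step c' (a + m) = -step c (b - m) := by
  rw [rigid_step hk hD (c := fun i => c (-i)) (fun _ _ h => neg_injective (hc h)) hc'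
    (by rwa [cyc_neg]) hE' (b := -b - 1) ?_ m]
  · rw [step_reverse]; ring_nf
  · rw [step_reverse, h]; ring_nf

/-- A tuple that is equivalent to a given one up to sign. -/
lemma rigid_step_or (hk : 3 ≤ k) (hD : IsCyclicDesign v k D) (hc : Function.Injective c)
    (hc' : Function.Injective c') (hE : cyc c ∈ D)
    (hE' : cyc c' ∈ D ∨ mulBlock (-1) (cyc c') ∈ D) {a b : ZMod k}
    (h : step c' a = step c b) :
    (∀ m, step c' (a + m) = step c (b + m)) ∨ ∀ m, step c' (a + m) = step c (b - m) := by
  rcases hE' with hE' | hE'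
  · exact Or.inl (rigid_step hk hD hc hc' hE hE' h)
  · right
    intro m
    rw [mulBlock_cyc] at hE'
    have := rigid_step_neg hk hD hc (mul_injective (-1) hc') hE hE' (a := a) (b := b)
      (by rw [step_mul, h]; simp) m
    rw [step_mul] at this
    simpa using this

lemma two_mul_eq_zero (hv : Odd v) {x : ZMod v} (h : 2 * x = 0) : x = 0 := by
  have h2 : IsUnit ((2 : ℕ) : ZMod v) := (ZMod.isUnit_iff_coprime 2 v).2
    (Nat.coprime_two_left.2 hv)
  exact (IsUnit.mul_right_eq_zero (by simpa using h2)).1 h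

lemma step_ne_neg (hk : 3 ≤ k) (hv : Odd v) (hD : IsCyclicDesign v k D)
    (hc : Function.Injective c) (hE : cyc c ∈ D) (a b : ZMod k) : step c a ≠ -step c b := by
  intro h
  have hb : step (fun i => c (-i)) (-b - 1) = -step c b := by rw [step_reverse]; ring_nf
  have key := rigid hk hD (c := fun i => c (-i)) (fun _ _ h => neg_injective (hc h)) hc
    (by rwa [cyc_neg]) hE (a := a) (b := -b - 1) (by rw [hb, h])
  have h1 := key (b + 1 - a)
  rw [show a + (b + 1 - a) = b + 1 by ring, show -(-b - 1 + (b + 1 - a)) = a by ring,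
    show -(-b - 1) = b + 1 by ring] at h1
  have h2 := hc (sub_eq_zero.1 (two_mul_eq_zero hv (x := c (b + 1) - c a)
    (by linear_combination h1)))
  subst h2
  rw [step, step] at h
  have := hc (show c (b + 1 + 1) = c b by linear_combination h)
  exact two_ne_zero_of hk (by linear_combination this)

lemma diffs_cyc_eq (c : ZMod k → ZMod v) :
    diffs (cyc c) = Finset.univ.image (step c) ∪ (Finset.univ.image (step c)).image Neg.neg := by
  ext x
  simp only [mem_diffs_cyc', Finset.mem_union, Finset.mem_image, Finset.mem_univ, true_and,
    exists_or, exists_exists_eq_and]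
  simp only [eq_comm]

lemma step_injective (hcard : (diffs (cyc c)).card = 2 * k) : Function.Injective (step c) := by
  rw [diffs_cyc_eq] at hcard
  have h1 := Finset.card_union_le (Finset.univ.image (step c))
    ((Finset.univ.image (step c)).image Neg.neg)
  rw [Finset.card_image_of_injective _ neg_injective] at h1
  have h2 : (Finset.univ.image (step c)).card ≤ k :=
    Finset.card_image_le.trans (by rw [Finset.card_univ, ZMod.card])
  have h3 : (Finset.univ.image (step c)).card = (Finset.univ : Finset (ZMod k)).card := by
    rw [Finset.card_univ, ZMod.card]; omega
  have := Finset.card_image_iff.1 h3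
  rwa [Finset.coe_univ, Set.injOn_univ] at this

lemma sum_step (c : ZMod k → ZMod v) : ∑ i, step c i = 0 := by
  simp only [step, Finset.sum_sub_distrib]
  rw [sub_eq_zero]
  exact Equiv.sum_comp (Equiv.addRight (1 : ZMod k)) c

end Rigid

section Rotation

variable {v k : ℕ} [NeZero v] [NeZero k]

lemma natCast_ne_zero_of_lt {n : ℕ} (h0 : n ≠ 0) (hn : n < k) : (n : ZMod k) ≠ 0 := by
  rw [Ne, ZMod.natCast_eq_zero_iff]
  exact fun h => absurd (Nat.le_of_dvd (Nat.pos_of_ne_zero h0) h) (by omega)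

/-- The units act on the values of `d` through rotations and reflections of the indices. -/
def Dihedral (d : ZMod k → ZMod v) : Prop :=
  ∀ (t : (ZMod v)ˣ) (i b : ZMod k), t * d i = d b →
    (∀ m, t * d m = d (m + (b - i))) ∨ ∀ m, t * d m = d (b + i - m)

variable {d : ZMod k → ZMod v}

lemma unit_mul_eq_of_dvd {u : (ZMod v)ˣ} {x y : ZMod v} (h : addOrderOf y ∣ addOrderOf x)
    (hu : u * x = x) : u * y = y := by
  obtain ⟨m, rfl⟩ := AddSubgroup.mem_zmultiples_iff.1 (mem_zmultiples_of_dvd h)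
  rw [mul_smul_comm, hu]

lemma addOrderOf_eq_three_mul (hv : Odd v) (hd : Dihedral d) {i j : ZMod k} {r : (ZMod v)ˣ}
    (hr : ∀ m, r * d m = d (2 * i - m)) (hj : ∀ u : (ZMod v)ˣ, u * d j = d j → ∀ m, u * d m = d m)
    (hne : r * d j ≠ d j) : addOrderOf (d j) = 3 * addOrderOf (d i) := by
  have hdvd : addOrderOf (d i) ∣ addOrderOf (d j) :=
    addOrderOf_dvd_of_fix hv fun u hu => hj u hu i
  have hri : r * d i = d i := by rw [hr]; ring_nf
  have hcard : Nat.card (MulAction.stabilizer (ZMod v)ˣ (d i))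
      ≤ 2 * Nat.card (MulAction.stabilizer (ZMod v)ˣ (d j)) := by
    classical
    let F := fun x : ZMod v => Finset.univ.filter fun u : (ZMod v)ˣ => u * x = x
    have hF : ∀ x, Nat.card (MulAction.stabilizer (ZMod v)ˣ x) = (F x).card := by
      intro x
      rw [Nat.card_eq_fintype_card, ← Fintype.card_subtype]
      rfl
    have hsub : F (d i) ⊆ F (d j) ∪ (F (d j)).image (r * ·) := by
      intro u hu
      have hu := (Finset.mem_filter.1 hu).2
      rw [Finset.mem_union]
      rcases hd u i i hu with h | h
      · exact Or.inl (Finset.mem_filter.2 ⟨Finset.mem_univ _, by simpa using h j⟩)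
      · refine Or.inr (Finset.mem_image.2 ⟨r⁻¹ * u, Finset.mem_filter.2 ⟨Finset.mem_univ _, ?_⟩,
          by simp⟩)
        rw [Units.val_mul, mul_assoc, h, ← two_mul, ← hr, Units.inv_mul_cancel_left]
    rw [hF, hF]
    refine (Finset.card_le_card hsub).trans ((Finset.card_union_le _ _).trans ?_)
    rw [two_mul]
    exact Nat.add_le_add_left Finset.card_image_le _
  have h1 := card_stabilizer_mul (d i)
  have h2 := card_stabilizer_mul (d j)
  obtain ⟨q, hq⟩ := hdvd
  have hqodd : Odd q := by
    have := odd_addOrderOf hv (d j)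
    rw [hq] at this
    exact (Nat.odd_mul.1 this).2
  have h3 := Nat.totient_super_multiplicative (addOrderOf (d i)) q
  rw [← hq] at h3
  have h4 := Nat.totient_pos.2 (addOrderOf_pos (d i))
  have h5 : 0 < Nat.card (MulAction.stabilizer (ZMod v)ˣ (d j)) := Nat.card_pos
  have h6 : q.totient ≤ 2 := by
    by_contra! h
    have h7 : 3 * (addOrderOf (d i)).totient ≤ (addOrderOf (d j)).totient := by nlinarith
    have h8 : Nat.card (MulAction.stabilizer (ZMod v)ˣ (d j)) * (addOrderOf (d j)).totient
        ≤ 2 * Nat.card (MulAction.stabilizer (ZMod v)ˣ (d j)) * (addOrderOf (d i)).totient := by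
      rw [h2, ← h1]; exact Nat.mul_le_mul_right _ hcard
    nlinarith [Nat.mul_le_mul_left (Nat.card (MulAction.stabilizer (ZMod v)ˣ (d j))) h7,
      Nat.mul_pos h5 h4]
  rcases odd_le_three_of_totient_le_two hqodd h6 with rfl | rfl
  · exact absurd (unit_mul_eq_of_dvd (by rw [hq, mul_one]) hri) hne
  · rw [hq, mul_comm]

lemma unit_mul_comm (r t : (ZMod v)ˣ) (x : ZMod v) : (r : ZMod v) * (t * x) = t * (r * x) :=
  mul_left_comm _ _ _

lemma no_reflection_zero (hk : 7 ≤ k) (hv : Odd v) (hinj : Function.Injective d)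
    (hd : Dihedral d) {r : (ZMod v)ˣ} (hr : ∀ m, r * d m = d (-m)) : False := by
  have hn : ∀ n : ℕ, n ≠ 0 → n < 7 → (n : ZMod k) ≠ 0 := fun n h0 hn =>
    natCast_ne_zero_of_lt h0 (by omega)
  have h2 := hn 2 (by norm_num) (by norm_num)
  have h4 := hn 4 (by norm_num) (by norm_num)
  have h6 := hn 6 (by norm_num) (by norm_num)
  push_cast at h2 h4 h6
  have hr' : ∀ m, r * d m = d (2 * 0 - m) := fun m => by rw [hr]; ring_nf
  have hfix1 : ∀ u : (ZMod v)ˣ, u * d 1 = d 1 → ∀ m, u * d m = d m := by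
    intro u hu
    rcases hd u 1 1 hu with h | h
    · simpa using h
    · exfalso
      have e := unit_mul_comm r u (d 0)
      rw [h, hr, hr, h] at e
      exact h4 (by linear_combination -hinj e)
  have hne1 : r * d 1 ≠ d 1 := by
    intro e
    rw [hr] at e
    exact h2 (by linear_combination -hinj e)
  have ho0 := addOrderOf_eq_three_mul hv hd hr' hfix1 hne1
  have hfix2 : ∀ u : (ZMod v)ˣ, u * d 2 = d 2 → ∀ m, u * d m = d m := by
    intro u hu
    rcases hd u 2 2 hu with h | h
    · simpa using h
    · exfalso
      have ho2 := addOrderOf_eq_three_mul hv hd (i := 2) (r := u)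
        (fun m => by rw [h]; ring_nf) hfix1 (by
          intro e
          rw [h] at e
          exact h2 (by linear_combination hinj e))
      have e := unit_mul_eq_of_dvd (u := r) (x := d 0) (y := d 2) (by
        have : addOrderOf (d 2) = addOrderOf (d 0) := by omega
        rw [this]) (by rw [hr, neg_zero])
      rw [hr] at e
      exact h4 (by linear_combination -hinj e)
  obtain ⟨t, ht⟩ := exists_unit_mul_eq (Nat.dvd_antisymm
    (addOrderOf_dvd_of_fix hv fun u hu => hfix2 u hu 1)
    (addOrderOf_dvd_of_fix hv fun u hu => hfix1 u hu 2))
  have e := unit_mul_comm r t (d 0)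
  rcases hd t 1 2 ht with h | h
  · rw [h, hr, hr, h] at e
    exact h2 (by linear_combination -hinj e)
  · rw [h, hr, hr, h] at e
    exact h6 (by linear_combination -hinj e)

lemma no_reflection (hk : 7 ≤ k) (hv : Odd v) (hinj : Function.Injective d) (hd : Dihedral d)
    (i : ZMod k) {r : (ZMod v)ˣ} (hr : ∀ m, r * d m = d (2 * i - m)) : False := by
  refine no_reflection_zero hk hv (d := fun m => d (m + i)) (r := r)
    (fun a b h => add_right_cancel (hinj h)) ?_ fun m => by simp only [hr]; ring_nf
  intro t a b h
  rcases hd t _ _ h with h | h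
  · exact Or.inl fun m => by simp only [h]; ring_nf
  · exact Or.inr fun m => by simp only [h]; ring_nf

/-- The units act on the values of `d` transitively, through rotations of the indices. -/
theorem exists_rotation (hk : 7 ≤ k) (hv : Odd v) (hinj : Function.Injective d)
    (hd : Dihedral d) : ∃ t : (ZMod v)ˣ, ∀ m, t * d m = d (m + 1) := by
  have h2 : ((2 : ℕ) : ZMod k) ≠ 0 := natCast_ne_zero_of_lt (by norm_num) (by omega)
  have h4 : ((4 : ℕ) : ZMod k) ≠ 0 := natCast_ne_zero_of_lt (by norm_num) (by omega)
  push_cast at h2 h4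
  have hfix : ∀ i (u : (ZMod v)ˣ), u * d i = d i → ∀ m, u * d m = d m := by
    intro i u hu
    rcases hd u i i hu with h | h
    · simpa using h
    · exact (no_reflection hk hv hinj hd i fun m => by rw [h]; ring_nf).elim
  have hex : ∀ i j, ∃ t : (ZMod v)ˣ, t * d i = d j := fun i j =>
    exists_unit_mul_eq (Nat.dvd_antisymm
      (addOrderOf_dvd_of_fix hv fun u hu => hfix j u hu i)
      (addOrderOf_dvd_of_fix hv fun u hu => hfix i u hu j))
  obtain ⟨t, ht⟩ := hex 0 1
  rcases hd t 0 1 ht with h | h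
  · exact ⟨t, by simpa using h⟩
  · exfalso
    obtain ⟨t', ht'⟩ := hex 0 2
    have e := unit_mul_comm t t' (d 0)
    rcases hd t' 0 2 ht' with h' | h'
    · rw [h', h, h, h'] at e
      exact h4 (by linear_combination -hinj e)
    · rw [h', h, h, h'] at e
      exact h2 (by linear_combination -hinj e)

end Rotation

section Exchange

variable {v k : ℕ} [NeZero v] [NeZero k] {D : Set (Block v)} {J : AddSubgroup (ZMod v)}

/-- The blocks of `D` with differences in `A` may be exchanged for the blocks of `S`. -/
lemma freeAt_of_exchange (hk : 3 ≤ k) (hD : IsCyclicDesign v k D) {A : Finset (ZMod v)}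
    {S : Set (Block v)} (h0 : 0 ∉ A)
    (hA : ∀ E ∈ D, ∀ x ∈ diffs E, x ∈ A → ∀ y ∈ diffs E, y ∈ A) (hJ : ∀ x ∈ A, cl D x = J)
    (hS : PartialDesign v k (A : Set (ZMod v)) S)
    (hDc : ∀ E ∈ D, ∀ x ∈ diffs E, x ∈ A → (diffs E).card = 2 * k)
    (hSc : ∀ E ∈ S, (diffs E).card = 2 * k)
    (hclosed : ∀ J' : AddSubgroup (ZMod v), (∀ E ∈ S, ∀ x ∈ diffs E, x ∈ J' → ∀ y ∈ diffs E, y ∈ J') →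
      (∀ E ∈ D, ∀ x ∈ diffs E, x ∉ A → cl D x = J → x ∈ J' → ∀ y ∈ diffs E, y ∈ J') →
      ∀ E ∈ D, ∀ x ∈ diffs E, x ∈ A → x ∈ J' → ∀ y ∈ diffs E, y ∈ J')
    (hne : ∃ E ∈ S, E ∉ D ∧ mulBlock (-1) E ∉ D) : FreeAt k D J := by
  classical
  have hAc : ∀ E ∈ D, ∀ x ∈ diffs E, x ∈ (A : Set (ZMod v))ᶜ → ∀ y ∈ diffs E,
      y ∈ (A : Set (ZMod v))ᶜ := fun E hE x hx hxA y hy hyA => hxA (hA E hE y hy hyA x hx)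
  have hDA := hD.restrict hk hAc
  set D' := S ∪ {E | E ∈ D ∧ ∀ x ∈ diffs E, x ∈ (A : Set (ZMod v))ᶜ} with hD'
  have hdes : IsCyclicDesign v k D' := hS.union hDA
  refine Or.inr ⟨D', hdes, ?_, ?_, ?_, ?_⟩
  · rintro E (hE | hE) x hx hxJ y hy
    · exact hJ y (hS.diffs_subset E hE y hy)
    · exact (cl_eq_of_mem_diffs hE.1 hy hx).trans hxJ
  · intro J' h' E hE x hx hxJ hxJ'
    by_cases hxA : x ∈ A
    · refine hclosed J' ?_ ?_ E hE x hx hxA hxJ'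
      · exact fun E hE x hx => h' E (Or.inl hE) x hx (hJ x (hS.diffs_subset E hE x hx))
      · exact fun E hE x hx hxA => h' E (Or.inr ⟨hE, hAc E hE x hx hxA⟩) x hx
    · exact h' E (Or.inr ⟨hE, hAc E hE x hx hxA⟩) x hx hxJ hxJ'
  · have hsplit := Finset.card_filter_add_card_filter_not (s := bigOn D D J) (fun X => X ⊆ A)
    have hX : ∀ X ∈ bigOn D D J, ∃ E ∈ D, diffs E = X := fun X hX =>
      mem_classes.1 (Finset.mem_filter.1 hX).1
    have hdisj : ∀ E ∈ D, ¬ diffs E ⊆ A → ∀ x ∈ diffs E, x ∈ (A : Set (ZMod v))ᶜ :=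
      fun E hE h x hx hxA => h fun y hy => hA E hE x hx hxA y hy
    have h1 : ((bigOn D D J).filter fun X => X ⊆ A).card * (2 * k) ≤ A.card := by
      rw [← smul_eq_mul, ← Finset.sum_const, Finset.sum_congr rfl (g := fun X => (id X).card),
        ← Finset.card_biUnion]
      · exact Finset.card_le_card (Finset.biUnion_subset.2 fun X hX => (Finset.mem_filter.1 hX).2)
      · intro X hX' Y hY hXY
        obtain ⟨E, hE, rfl⟩ := hX X (Finset.mem_filter.1 hX').1
        obtain ⟨E', hE', rfl⟩ := hX Y (Finset.mem_filter.1 hY).1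
        exact Finset.disjoint_left.2 fun x hx hx' => hXY (hD.diffs_eq hk hE hE' hx hx')
      · intro X hX'
        obtain ⟨E, hE, rfl⟩ := hX X (Finset.mem_filter.1 hX').1
        obtain ⟨x, hx⟩ := diffs_nonempty hk (hD.1.1 E hE)
        exact (hDc E hE x hx ((Finset.mem_filter.1 hX').2 hx)).symm
    have h2 : A.card ≤ (classes S).card * (2 * k) := by
      have : A ⊆ (classes S).biUnion id := by
        intro x hx
        obtain ⟨E, hE, hxE⟩ := hS.cover x hx fun h => h0 (h ▸ hx)
        exact Finset.mem_biUnion.2 ⟨_, mem_classes.2 ⟨E, hE, rfl⟩, hxE⟩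
      refine (Finset.card_le_card this).trans (Finset.card_biUnion_le_card_mul _ _ _ ?_)
      intro X hX
      obtain ⟨E, hE, rfl⟩ := mem_classes.1 hX
      exact (hSc E hE).le
    have h3 := Nat.le_of_mul_le_mul_right (h1.trans h2) (by omega)
    rw [← hsplit]
    refine (Nat.add_le_add_right h3 _).trans ?_
    rw [← Finset.card_union_of_disjoint]
    · refine Finset.card_le_card fun X hX' => ?_
      rcases Finset.mem_union.1 hX' with h | h
      · obtain ⟨E, hE, rfl⟩ := mem_classes.1 h
        refine Finset.mem_filter.2 ⟨mem_classes.2 ⟨E, Or.inl hE, rfl⟩, ?_, fun x hx =>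
          hJ x (hS.diffs_subset E hE x hx)⟩
        rw [hSc E hE]
        omega
      · obtain ⟨h, hXA⟩ := Finset.mem_filter.1 h
        obtain ⟨E, hE, rfl⟩ := hX X h
        exact Finset.mem_filter.2 ⟨mem_classes.2 ⟨E, Or.inr ⟨hE, hdisj E hE hXA⟩, rfl⟩,
          (Finset.mem_filter.1 h).2⟩
    · refine Finset.disjoint_left.2 fun X hX' h => (Finset.mem_filter.1 h).2 ?_
      obtain ⟨E, hE, rfl⟩ := mem_classes.1 hX'
      exact hS.diffs_subset E hE
  · obtain ⟨E, hE, hne⟩ := hne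
    obtain ⟨x, hx⟩ := diffs_nonempty hk (hS.cycle E hE)
    exact ⟨E, Or.inl hE, ⟨x, hx, hJ x (hS.diffs_subset E hE x hx)⟩, hne⟩

/-- A block without repeated differences may be exchanged for another one with the same
differences. -/
lemma freeAt_of_diffs_eq (hk : 3 ≤ k) (hD : IsCyclicDesign v k D) {E E' : Block v} (hE : E ∈ D)
    (hcard : (diffs E).card = 2 * k) (hJ : ∀ x ∈ diffs E, cl D x = J) (hE' : IsCycleBlock v k E')
    (hdiffs : diffs E' = diffs E) (h1 : E' ∉ D) (h2 : mulBlock (-1) E' ∉ D) : FreeAt k D J := by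
  have hA : ∀ F ∈ D, ∀ x ∈ diffs F, x ∈ diffs E → diffs F = diffs E :=
    fun F hF x hx hxE => hD.diffs_eq hk hF hE hx hxE
  have hS : PartialDesign v k (diffs E : Set (ZMod v)) (translates {E'}) := by
    refine partialDesign_translates hk ?_ ?_ ?_ ?_
    · rintro _ rfl; exact hE'
    · rintro _ rfl x hx; rw [hdiffs] at hx; exact hx
    · intro x hx _; exact ⟨E', rfl, hdiffs ▸ hx⟩
    · rintro _ rfl _ rfl x b b' hb hb'
      rw [(card_diffs_eq_iff hk hE').1 (hdiffs ▸ hcard) x b b' hb hb', sub_self,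
        translateBlock_zero]
  have hSd : ∀ F ∈ translates {E'}, diffs F = diffs E := by
    rintro _ ⟨_, rfl, z, rfl⟩; rw [diffs_translateBlock, hdiffs]
  refine freeAt_of_exchange hk hD (fun h => hD.ne_zero hk hE h rfl)
    (fun F hF x hx hxE => by rw [hA F hF x hx hxE]; exact fun y hy => hy) hJ hS
    (fun F hF x hx hxE => by rw [hA F hF x hx hxE]; exact hcard)
    (fun F hF => by rw [hSd F hF]; exact hcard) ?_
    ⟨E', subset_translates _ rfl, h1, h2⟩
  intro J' h _ F hF x hx hxE hxJ'
  have := h E' (subset_translates _ rfl) x (hdiffs ▸ hxE) hxJ'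
  rwa [hdiffs, ← hA F hF x hx hxE] at this

/-- Unless there is a choice to be made for `J`, the units permute the blocks generating `J`,
up to sign. -/
lemma mulBlock_mem_or_of_not_freeAt (hk : 3 ≤ k) (hD : IsCyclicDesign v k D)
    (hfree : ¬ FreeAt k D J) {E : Block v} (hE : E ∈ D) {x : ZMod v} (hx : x ∈ diffs E)
    (hxJ : cl D x = J) (u : (ZMod v)ˣ) :
    mulBlock u E ∈ D ∨ mulBlock (-1) (mulBlock u E) ∈ D := by
  by_contra! hne
  refine hfree (Or.inr ⟨mulBlock u '' D, hD.mulBlock hk u, ?_, ?_, ?_, ?_⟩)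
  · rintro _ ⟨F, hF, rfl⟩ x hx hxJ y hy
    rw [mem_diffs_mulBlock] at hx hy
    rw [← hxJ, ← cl_mul u⁻¹ (x := x), ← cl_mul u⁻¹ (x := y)]
    exact cl_eq_of_mem_diffs hF hy hx
  · intro J' h F hF x hx hxJ hxJ' y hy
    have := h _ ⟨F, hF, rfl⟩ _ (mul_mem_diffs_mulBlock.2 hx) (by rw [cl_mul, hxJ])
      (mul_mem_addSubgroup _ _ hxJ') _ (mul_mem_diffs_mulBlock.2 hy)
    simpa using mul_mem_addSubgroup J' (↑u⁻¹ : ZMod v) this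
  · classical
    refine Finset.card_le_card_of_injOn (fun X => X.image fun x => (u : ZMod v) * x) ?_ ?_
    · intro X hX
      obtain ⟨hX, hX4, hXJ⟩ := Finset.mem_filter.1 hX
      obtain ⟨F, hF, rfl⟩ := mem_classes.1 hX
      refine Finset.mem_filter.2 ⟨mem_classes.2 ⟨_, ⟨F, hF, rfl⟩, diffs_mulBlock u F⟩, ?_, ?_⟩
      · rwa [Finset.card_image_of_injective _ u.isUnit.mul_right_injective]
      · intro y hy
        obtain ⟨x, hx, rfl⟩ := Finset.mem_image.1 hy
        rw [cl_mul, hXJ x hx]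
    · exact (Finset.image_injective u.isUnit.mul_right_injective).injOn
  · exact ⟨_, ⟨E, hE, rfl⟩, ⟨u * x, mul_mem_diffs_mulBlock.2 hx, by rw [cl_mul, hxJ]⟩, hne⟩

end Exchange

section FullBlocks

variable {v k : ℕ} [NeZero v] [NeZero k] {D : Set (Block v)} {J : AddSubgroup (ZMod v)}
  {c c' : ZMod k → ZMod v}

lemma mem_or_of_step_eq (hk : 3 ≤ k) (hD : IsCyclicDesign v k D) (hfree : ¬ FreeAt k D J)
    (hE : cyc c ∈ D) (hcard : (diffs (cyc c)).card = 2 * k) (hJ : ∀ x ∈ diffs (cyc c), cl D x = J)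
    (hc' : Function.Injective c') (σ : ZMod k → ZMod k) (hσ : Function.Surjective σ)
    (h : ∀ i, step c' i = step c (σ i)) : cyc c' ∈ D ∨ mulBlock (-1) (cyc c') ∈ D := by
  by_contra! hne
  refine hfree (freeAt_of_diffs_eq hk hD hE hcard hJ (isCycleBlock_iff.2 ⟨c', hc', rfl⟩) ?_
    hne.1 hne.2)
  ext x
  simp only [mem_diffs_cyc', h]
  exact (hσ.exists (p := fun i => x = step c i ∨ x = -step c i)).symm

lemma exists_add_sub_eq (hk : 4 ≤ k) (hD : IsCyclicDesign v k D)
    (hfree : ¬ FreeAt k D J) (hc : Function.Injective c) (hE : cyc c ∈ D)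
    (hcard : (diffs (cyc c)).card = 2 * k) (hJ : ∀ x ∈ diffs (cyc c), cl D x = J) :
    ∃ j ≠ 1, c 0 + c 2 - c 1 = c j := by
  by_contra! hne
  have h2 : ((2 : ℕ) : ZMod k) ≠ 0 := natCast_ne_zero_of_lt (by norm_num) (by omega)
  have h3 : ((3 : ℕ) : ZMod k) ≠ 0 := natCast_ne_zero_of_lt (by norm_num) (by omega)
  have h1 : ((1 : ℕ) : ZMod k) ≠ 0 := natCast_ne_zero_of_lt (by norm_num) (by omega)
  push_cast at h1 h2 h3
  have hd := step_injective hcard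
  set c' : ZMod k → ZMod v := Function.update c 1 (c 0 + c 2 - c 1) with hc'def
  have hc'1 : c' 1 = c 0 + c 2 - c 1 := Function.update_self ..
  have hc'o : ∀ i ≠ 1, c' i = c i := fun i hi => Function.update_of_ne hi ..
  have hs0 : step c' 0 = step c 1 := by
    rw [step, step, zero_add, hc'1, hc'o 0 (Ne.symm h1), one_add_one_eq_two]; ring
  have hs1 : step c' 1 = step c 0 := by
    rw [step, step, zero_add, one_add_one_eq_two, hc'1, hc'o 2 fun h => h1 (by linear_combination h)]
    ring
  have hso : ∀ i, i ≠ 0 → i ≠ 1 → step c' i = step c i := by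
    intro i h0 h1'
    rw [step, step, hc'o i h1', hc'o (i + 1) fun h => h0 (by linear_combination h)]
  have hc' : Function.Injective c' := by
    intro i j hij
    by_cases hi : i = 1
    · by_contra hj
      rw [hi, hc'1, hc'o j fun h => hj (hi.trans h.symm)] at hij
      exact hne j (fun h => hj (hi.trans h.symm)) hij
    · by_cases hj : j = 1
      · rw [hj, hc'1, hc'o i hi] at hij
        exact absurd hij.symm (hne i hi)
      · rw [hc'o i hi, hc'o j hj] at hij
        exact hc hij
  have hE' := mem_or_of_step_eq (by omega) hD hfree hE hcard hJ hc' (Equiv.swap 0 1)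
    (Equiv.surjective _) (by
      intro i
      by_cases hi0 : i = 0
      · rw [hi0, Equiv.swap_apply_left, hs0]
      · by_cases hi1 : i = 1
        · rw [hi1, Equiv.swap_apply_right, hs1]
        · rw [Equiv.swap_apply_of_ne_of_ne hi0 hi1, hso i hi0 hi1])
  rcases rigid_step_or (by omega) hD hc hc' hE hE' (hso 2 h2 fun h => h1 (by linear_combination h))
    with h | h
  · have := h (-1)
    rw [show (2 : ZMod k) + -1 = 1 by ring, hs1] at this
    exact h1 (hd this).symm
  · have := h 1
    rw [show (2 : ZMod k) + 1 = 3 by ring, show (2 : ZMod k) - 1 = 1 by ring,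
      hso 3 h3 fun h => h2 (by linear_combination h)] at this
    exact h2 (by linear_combination hd this)

lemma step_shift (c : ZMod k → ZMod v) (p i : ZMod k) :
    step (fun i => c (i + p)) i = step c (i + p) := by
  simp only [step]; rw [show i + 1 + p = i + p + 1 by ring]

/-- The previous lemma at an arbitrary position, with the trivial solutions excluded. -/
lemma exists_step_relation (hk : 4 ≤ k) (hv : Odd v) (hD : IsCyclicDesign v k D)
    (hfree : ¬ FreeAt k D J) (hc : Function.Injective c) (hE : cyc c ∈ D)
    (hcard : (diffs (cyc c)).card = 2 * k) (hJ : ∀ x ∈ diffs (cyc c), cl D x = J) (p : ZMod k) :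
    ∃ j, c p + c (p + 2) - c (p + 1) = c (p + j) ∧ j ≠ 0 ∧ j ≠ 1 ∧ j ≠ 2 ∧ j ≠ 3 ∧ j ≠ -1 := by
  have hcp : Function.Injective fun i => c (i + p) := fun i j h => add_right_cancel (hc h)
  obtain ⟨j, hj1, hj⟩ := exists_add_sub_eq (c := fun i => c (i + p)) hk hD hfree hcp
    (by rwa [cyc_shift]) (by rwa [cyc_shift]) (by rwa [cyc_shift])
  have h1 : ((1 : ℕ) : ZMod k) ≠ 0 := natCast_ne_zero_of_lt (by norm_num) (by omega)
  push_cast at h1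
  rw [zero_add, add_comm 2, add_comm 1, add_comm j] at hj
  refine ⟨j, hj, ?_, hj1, ?_, ?_, ?_⟩
  · rintro rfl
    rw [add_zero] at hj
    exact h1 (by linear_combination hc (show c (p + 2) = c (p + 1) by linear_combination hj))
  · rintro rfl
    exact h1 (by linear_combination -hc (show c p = c (p + 1) by linear_combination hj))
  · rintro rfl
    refine step_ne_neg (by omega) hv hD hc hE (p + 2) p ?_
    rw [step, step, show p + 2 + 1 = p + 3 by ring]
    linear_combination -hj
  · rintro rfl
    refine step_ne_neg (by omega) hv hD hc hE (p + -1) (p + 1) ?_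
    rw [step, step, show p + -1 + 1 = p by ring, show p + 1 + 1 = p + 2 by ring]
    linear_combination hj

lemma freeAt_of_card_eq_of_le_six (hk : 4 ≤ k) (hk6 : k ≤ 6) (hv : Odd v)
    (hD : IsCyclicDesign v k D) (hc : Function.Injective c) (hE : cyc c ∈ D)
    (hcard : (diffs (cyc c)).card = 2 * k) (hJ : ∀ x ∈ diffs (cyc c), cl D x = J) :
    FreeAt k D J := by
  by_contra hfree
  have key := exists_step_relation hk hv hD hfree hc hE hcard hJ
  interval_cases k
  · obtain ⟨j, -, h⟩ := key 0
    revert j; decide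
  · obtain ⟨j, -, h⟩ := key 0
    revert j; decide
  · have h4 : ∀ j : ZMod 6, j ≠ 0 ∧ j ≠ 1 ∧ j ≠ 2 ∧ j ≠ 3 ∧ j ≠ -1 → j = 4 := by decide
    obtain ⟨j, hj, h⟩ := key 0
    obtain ⟨j', hj', h'⟩ := key 1
    rw [h4 j h] at hj
    rw [h4 j' h'] at hj'
    have hsum := sum_step c
    have e3 : (0 : ZMod 6) + 2 = 2 := by decide
    have e4 : (0 : ZMod 6) + 1 = 1 := by decide
    have e5 : (0 : ZMod 6) + 4 = 4 := by decide
    have e6 : (1 : ZMod 6) + 2 = 3 := by decide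
    have e7 : (1 : ZMod 6) + 1 = 2 := by decide
    have e8 : (1 : ZMod 6) + 4 = 5 := by decide
    rw [e3, e4, e5] at hj
    rw [e6, e7, e8] at hj'
    have : step c 3 = step c 5 := by
      rw [step, step, show (3 : ZMod 6) + 1 = 4 by decide, show (5 : ZMod 6) + 1 = 0 by decide]
      linear_combination -hj - hj'
    exact absurd (step_injective hcard this) (by decide)

lemma dihedral_step (hk : 3 ≤ k) (hD : IsCyclicDesign v k D)
    (hfree : ¬ FreeAt k D J) (hc : Function.Injective c) (hE : cyc c ∈ D)
    (hJ : ∀ x ∈ diffs (cyc c), cl D x = J) : Dihedral (step c) := by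
  intro t i b h
  have hE' := mulBlock_mem_or_of_not_freeAt hk hD hfree hE (step_mem_diffs c 0)
    (hJ _ (step_mem_diffs c 0)) t
  rw [mulBlock_cyc] at hE'
  rcases rigid_step_or hk hD hc (mul_injective t hc) hE hE' (a := i) (b := b)
    (by rw [step_mul, h]) with h | h
  · refine Or.inl fun m => ?_
    have := h (m - i)
    rw [step_mul] at this
    rw [show m + (b - i) = b + (m - i) by ring, ← this]
    ring_nf
  · refine Or.inr fun m => ?_
    have := h (m - i)
    rw [step_mul] at this
    rw [show b + i - m = b - (m - i) by ring, ← this]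
    ring_nf

lemma exists_multiplier (hk : 7 ≤ k) : ∃ j : ZMod k, IsUnit j ∧ j ≠ 1 ∧ j ≠ -1 := by
  have key : ∀ j : ℕ, j.Coprime k → j ≠ 1 → j ≠ 0 → j + 1 < k →
      ∃ j : ZMod k, IsUnit j ∧ j ≠ 1 ∧ j ≠ -1 := by
    intro j hj h1 h0 hjk
    refine ⟨j, (ZMod.isUnit_iff_coprime _ _).2 hj, fun h => ?_, fun h => ?_⟩
    · refine natCast_ne_zero_of_lt (k := k) (n := j - 1) (by omega) (by omega) ?_
      rw [Nat.cast_sub (by omega), h]; simp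
    · refine natCast_ne_zero_of_lt (k := k) (n := j + 1) (by omega) (by omega) ?_
      push_cast; rw [h]; ring
  rcases Nat.even_or_odd k with ⟨m, hm⟩ | hodd
  · rcases Nat.even_or_odd m with ⟨r, hr⟩ | ⟨r, hr⟩
    · refine key (2 * r + 1) ?_ (by omega) (by omega) (by omega)
      rw [show k = 2 * (2 * r) by omega]
      exact Nat.Coprime.mul_right (by simp) (by simp)
    · refine key (2 * r + 3) ?_ (by omega) (by omega) (by omega)
      rw [show k = 2 * (2 * r + 1) by omega]
      refine Nat.Coprime.mul_right (by rw [show 2 * r + 3 = 2 * (r + 1) + 1 by ring]; simp) ?_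
      rw [show 2 * r + 3 = 2 + (2 * r + 1) by ring, Nat.coprime_add_self_left]
      simp
  · exact key 2 (Nat.coprime_two_left.2 hodd) (by omega) (by omega) (by omega)

lemma exists_step_eq {e : ZMod k → ZMod v} (he : ∑ i, e i = 0) : ∃ c, ∀ i, step c i = e i := by
  refine ⟨fun i => ∑ j ∈ Finset.range i.val, e j, fun i => ?_⟩
  have hsum : ∑ j ∈ Finset.range k, e (j : ZMod k) = 0 := by
    rw [← he]
    refine Finset.sum_bij' (fun j _ => (j : ZMod k)) (fun i _ => i.val) ?_ ?_ ?_ ?_ ?_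
    · simp
    · intro i _; exact Finset.mem_range.2 (ZMod.val_lt i)
    · intro j hj; exact ZMod.val_cast_of_lt (Finset.mem_range.1 hj)
    · intro i _; simp
    · simp
  have hlt := ZMod.val_lt i
  rw [step]
  by_cases h : i.val + 1 < k
  · have : (i + 1).val = i.val + 1 := by
      rw [← ZMod.val_cast_of_lt h]; simp
    rw [this, Finset.sum_range_succ]; simp
  · have h1 : i.val + 1 = k := by omega
    have h2 : i + 1 = 0 := by
      have := congrArg (Nat.cast : ℕ → ZMod k) h1
      simpa using this
    rw [h2, ZMod.val_zero, Finset.sum_range_zero]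
    rw [show Finset.range k = Finset.range (i.val + 1) by rw [h1], Finset.sum_range_succ] at hsum
    simp only [ZMod.natCast_val, ZMod.cast_id', id_eq] at hsum
    linear_combination -hsum

lemma freeAt_of_card_eq_of_seven_le (hk : 7 ≤ k) (hv : Odd v)
    (hD : IsCyclicDesign v k D) (hc : Function.Injective c) (hE : cyc c ∈ D)
    (hcard : (diffs (cyc c)).card = 2 * k) (hJ : ∀ x ∈ diffs (cyc c), cl D x = J) :
    FreeAt k D J := by
  by_contra hfree
  have hd := step_injective hcard
  obtain ⟨t, ht⟩ := exists_rotation hk hv hd (dihedral_step (by omega) hD hfree hc hE hJ)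
  obtain ⟨j, hj, hj1, hjn⟩ := exists_multiplier hk
  have hpow : ∀ n : ℕ, ∀ m, (t ^ n : (ZMod v)ˣ) * step c m = step c (m + n) := by
    intro n
    induction n with
    | zero => simp
    | succ n ih =>
      intro m
      rw [pow_succ, Units.val_mul, mul_assoc, ht, ih]
      push_cast; ring_nf
  obtain ⟨y, hy⟩ : ∃ y : ZMod v, ∀ m, y * step c m = step c (m + j) :=
    ⟨_, fun m => by rw [hpow j.val]; simp⟩
  obtain ⟨c', hc'⟩ := exists_step_eq (e := fun m => step c (j * m)) (by
    rw [← sum_step c]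
    exact (Function.Bijective.sum_comp (e := fun m => j * m)
      ⟨hj.mul_right_injective, fun b => ⟨↑hj.unit⁻¹ * b, by
        beta_reduce; rw [← mul_assoc, IsUnit.mul_val_inv, one_mul]⟩⟩ (step c)))
  have hconst : ∀ n : ℕ, (y - 1) * c' n - step c (j * n)
      = (y - 1) * c' 0 - step c 0 := by
    intro n
    induction n with
    | zero => simp
    | succ n ih =>
      rw [← ih]
      have h1 := hc' n
      rw [step] at h1
      have h2 := hy (j * n)
      push_cast
      rw [show j * ((n : ZMod k) + 1) = j * n + j by ring, ← h2]
      linear_combination (y - 1) * h1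
  have hinj : Function.Injective c' := by
    intro a b hab
    have ha := hconst a.val
    have hb := hconst b.val
    simp only [ZMod.natCast_val, ZMod.cast_id', id_eq] at ha hb
    rw [← hb, hab] at ha
    exact hj.mul_right_injective (hd (by linear_combination -ha))
  have hE' := mem_or_of_step_eq (by omega) hD hfree hE hcard hJ hinj (fun m => j * m)
    (fun b => ⟨↑hj.unit⁻¹ * b, by beta_reduce; rw [← mul_assoc, IsUnit.mul_val_inv, one_mul]⟩) hc'
  rcases rigid_step_or (by omega) hD hc hinj hE hE' (a := 0) (b := 0) (by rw [hc', mul_zero])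
    with h | h
  · have := h 1
    rw [hc', zero_add, mul_one] at this
    exact hj1 (hd this)
  · have := h 1
    rw [hc', zero_add, mul_one, zero_sub] at this
    exact hjn (hd this)

lemma freeAt_of_card_eq (hk : 4 ≤ k) (hv : Odd v) (hD : IsCyclicDesign v k D) {E : Block v}
    (hE : E ∈ D) (hcard : (diffs E).card = 2 * k) (hJ : ∀ x ∈ diffs E, cl D x = J) :
    FreeAt k D J := by
  obtain ⟨c, hc, rfl⟩ := isCycleBlock_iff.1 (hD.1.1 E hE)
  rcases le_or_gt k 6 with h | h
  · exact freeAt_of_card_eq_of_le_six hk h hv hD hc hE hcard hJ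
  · exact freeAt_of_card_eq_of_seven_le h hv hD hc hE hcard hJ

end FullBlocks

section Rigidity

variable {v k : ℕ} [NeZero v] [NeZero k] {D : Set (Block v)} {J : AddSubgroup (ZMod v)}
  {c : ZMod k → ZMod v}

lemma step_add_two_of_card_le (hk : 3 ≤ k) (hv : Odd v) (hD : IsCyclicDesign v k D)
    (hc : Function.Injective c) (hE : cyc c ∈ D) (hcard : (diffs (cyc c)).card ≤ 4) (m : ZMod k) :
    step c (m + 2) = step c m := by
  have himg : (Finset.univ.image (step c)).card ≤ 2 := by
    rw [diffs_cyc_eq, Finset.card_union_of_disjoint,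
      Finset.card_image_of_injective _ neg_injective] at hcard
    · omega
    · refine Finset.disjoint_left.2 fun x hx hx' => ?_
      obtain ⟨a, -, rfl⟩ := Finset.mem_image.1 hx
      obtain ⟨y, hy, hxy⟩ := Finset.mem_image.1 hx'
      obtain ⟨b, -, rfl⟩ := Finset.mem_image.1 hy
      exact step_ne_neg hk hv hD hc hE a b hxy.symm
  have hmem : ∀ i, step c i ∈ Finset.univ.image (step c) := fun i =>
    Finset.mem_image_of_mem _ (Finset.mem_univ i)
  have hrot : ∀ a b : ZMod k, step c a = step c b → ∀ m, step c (a + m) = step c (b + m) :=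
    fun a b h m => rigid_step hk hD hc hc hE hE h m
  by_cases h01 : step c 0 = step c 1
  · have h := hrot 0 1 h01
    simp only [zero_add] at h
    rw [h m, h (1 + m)]; ring_nf
  · by_cases h12 : step c 1 = step c 2
    · have h := fun m => hrot 1 2 h12 (m - 1)
      have h' : ∀ m, step c m = step c (m + 1) := fun m => by
        have := h m; ring_nf at this ⊢; exact this
      rw [h' m, h' (m + 1)]; ring_nf
    · by_cases h02 : step c 0 = step c 2
      · have := hrot 0 2 h02 m
        rw [zero_add] at this
        rw [this]; ring_nf
      · have : ({step c 0, step c 1, step c 2} : Finset (ZMod v)).card = 3 :=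
          Finset.card_eq_three.2 ⟨_, _, _, h01, h02, h12, rfl⟩
        have h3 : ({step c 0, step c 1, step c 2} : Finset (ZMod v)) ⊆
            Finset.univ.image (step c) := by
          intro x hx
          simp only [Finset.mem_insert, Finset.mem_singleton] at hx
          rcases hx with rfl | rfl | rfl <;> exact hmem _
        have := Finset.card_le_card h3
        omega

lemma addOrderOf_eq_of_steps (hc : Function.Injective c) {a δ : ℕ} (ha : a * δ = k) {z : ZMod v}
    (h : ∀ n : ℕ, c (a * n : ℕ) = c 0 + n • z) : addOrderOf z = δ := by
  have ha0 : 0 < a := Nat.pos_of_ne_zero fun h => NeZero.ne k (by rw [← ha, h, zero_mul])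
  refine Nat.dvd_antisymm (addOrderOf_dvd_iff_nsmul_eq_zero.2 ?_) ?_
  · have := h δ
    rw [ha, ZMod.natCast_self] at this
    exact (left_eq_add.1 this)
  · have := h (addOrderOf z)
    rw [addOrderOf_nsmul_eq_zero, add_zero] at this
    have := hc this
    rw [ZMod.natCast_eq_zero_iff] at this
    exact Nat.dvd_of_mul_dvd_mul_left ha0 (ha ▸ this)

lemma addOrderOf_of_step_const (hc : Function.Injective c) {z : ZMod v}
    (h : ∀ i, step c i = z) : addOrderOf z = k := by
  refine addOrderOf_eq_of_steps hc (one_mul k) fun n => ?_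
  induction n with
  | zero => simp
  | succ n ih =>
    have := h (1 * n : ℕ)
    rw [step, ih] at this
    push_cast at this ⊢
    rw [one_mul] at this ⊢
    rw [succ_nsmul]
    linear_combination this

lemma addOrderOf_of_step_add_two (hc : Function.Injective c) {δ : ℕ} (hδ : k = 2 * δ)
    (h : ∀ i, step c (i + 2) = step c i) : addOrderOf (step c 0 + step c 1) = δ := by
  have h' : ∀ n : ℕ, step c (2 * n : ℕ) = step c 0 ∧ step c ((2 * n : ℕ) + 1) = step c 1 := by
    intro n
    induction n with
    | zero => simp
    | succ n ih =>
      rw [← ih.1, ← ih.2, ← h (2 * n : ℕ), ← h ((2 * n : ℕ) + 1)]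
      constructor <;> congr 1 <;> push_cast <;> ring
  refine addOrderOf_eq_of_steps hc hδ.symm fun n => ?_
  induction n with
  | zero => simp
  | succ n ih =>
    obtain ⟨h1, h2⟩ := h' n
    rw [step] at h1 h2
    rw [succ_nsmul, ← add_assoc, ← ih, ← h1, ← h2]
    rw [show ((2 * (n + 1) : ℕ) : ZMod k) = (2 * n : ℕ) + 1 + 1 by push_cast; ring]
    ring

lemma order_of_not_freeAt (hk : 4 ≤ k) (hv : Odd v) (hD : IsCyclicDesign v k D)
    (hfree : ¬ FreeAt k D J) {x : ZMod v} (hx : x ≠ 0) (hxJ : cl D x = J) :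
    addOrderOf x = k ∨ ∃ δ, k = 2 * δ ∧ δ ∣ addOrderOf x ∧ addOrderOf x ≠ δ ∧
      δ.Coprime (addOrderOf x / δ) := by
  have hk3 : 3 ≤ k := by omega
  obtain ⟨E, hE, hxE⟩ := hD.exists_diffs hx
  have hJ : ∀ y ∈ diffs E, cl D y = J := fun y hy => (cl_eq_of_mem_diffs hE hy hxE).trans hxJ
  have hcard : (diffs E).card ≤ 4 := by
    by_contra! h4
    rcases (card_diffs_le hk3 (hD.1.1 E hE)).lt_or_eq with h | h
    · exact hfree (Or.inl ⟨E, hE, hJ, h4, h⟩)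
    · exact hfree (freeAt_of_card_eq hk hv hD hE h hJ)
  obtain ⟨c, hc, rfl⟩ := isCycleBlock_iff.1 (hD.1.1 E hE)
  have hper := step_add_two_of_card_le hk3 hv hD hc hE hcard
  have hd := dihedral_step hk3 hD hfree hc hE hJ
  have hev : ∀ n : ℕ, step c (2 * n) = step c 0 := by
    intro n
    induction n with
    | zero => simp
    | succ n ih => rw [← ih, ← hper (2 * n)]; push_cast; ring_nf
  have hodd : ∀ n : ℕ, step c (2 * n + 1) = step c 1 := by
    intro n
    induction n with
    | zero => simp
    | succ n ih => rw [← ih, ← hper (2 * n + 1)]; push_cast; ring_nf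
  have hall : ∀ i, step c i = step c 0 ∨ step c i = step c 1 := by
    intro i
    rw [← ZMod.natCast_zmod_val i]
    rcases Nat.even_or_odd' i.val with ⟨m, hm | hm⟩
    · rw [hm]; push_cast; exact Or.inl (hev m)
    · rw [hm]; push_cast; exact Or.inr (hodd m)
  have hxord : addOrderOf x = addOrderOf (step c 0) ∨ addOrderOf x = addOrderOf (step c 1) := by
    obtain ⟨i, hi⟩ := mem_diffs_cyc'.1 hxE
    have : addOrderOf x = addOrderOf (step c i) := by
      rcases hi with rfl | rfl
      · rfl
      · exact addOrderOf_neg _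
    rw [this]
    exact (hall i).imp (congrArg _) (congrArg _)
  by_cases h01 : step c 0 = step c 1
  · left
    have := addOrderOf_of_step_const hc (z := step c 0) fun i => (hall i).elim id (h01 ▸ ·)
    rcases hxord with h | h
    · rw [h, this]
    · rw [h, ← h01, this]
  right
  obtain ⟨δ, hδ | hδ⟩ := Nat.even_or_odd' k
  swap
  · refine absurd ?_ h01
    rw [← hev (δ + 1), show (2 * ((δ + 1 : ℕ) : ZMod k)) = (2 * δ + 1 : ℕ) + 1 by push_cast; ring,
      ← hδ, ZMod.natCast_self, zero_add]
  have hz := addOrderOf_of_step_add_two hc hδ hper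
  have hfix01 : ∀ u : (ZMod v)ˣ, u * step c 0 = step c 0 → u * step c 1 = step c 1 := by
    intro u hu
    rcases hd u 0 0 hu with h | h
    · rw [h]; ring_nf
    · rw [h, ← hper]; ring_nf
  have hfix10 : ∀ u : (ZMod v)ˣ, u * step c 1 = step c 1 → u * step c 0 = step c 0 := by
    intro u hu
    rcases hd u 1 1 hu with h | h
    · rw [h]; ring_nf
    · rw [h, ← hper 0]; ring_nf
  have hord : addOrderOf (step c 0) = addOrderOf (step c 1) := Nat.dvd_antisymm
    (addOrderOf_dvd_of_fix hv hfix10) (addOrderOf_dvd_of_fix hv hfix01)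
  have hxn : addOrderOf x = addOrderOf (step c 0) := by rcases hxord with h | h <;> simp [h, hord]
  rw [hxn]
  set n := addOrderOf (step c 0) with hn
  obtain ⟨t, ht⟩ := exists_unit_mul_eq hord
  have ht1 : t * step c 1 = step c 0 := by
    rcases hd t 0 1 ht with h | h
    · rw [h, ← hper 0]; ring_nf
    · rw [h]; ring_nf
  set z := step c 0 + step c 1 with hzdef
  have htz : t * z = z := by rw [hzdef, mul_add, ht, ht1, add_comm]
  have hδn : δ ∣ n := by
    rw [← hz]
    refine addOrderOf_dvd_iff_nsmul_eq_zero.2 ?_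
    rw [hzdef, nsmul_add]
    nth_rw 2 [hord]
    rw [addOrderOf_nsmul_eq_zero, addOrderOf_nsmul_eq_zero, add_zero]
  refine ⟨δ, hδ, hδn, fun h => h01 ?_, ?_⟩
  · rw [← ht, unit_mul_eq_of_dvd (by rw [← hn, h, hz]) htz]
  · by_contra hcop
    obtain ⟨p, hp, hp1, hp2⟩ := Nat.Prime.not_coprime_iff_dvd.1 hcop
    have hpn : p ∣ n := hp1.trans hδn
    have hδp : δ ∣ n / p := by
      obtain ⟨q, hq⟩ := hp2
      have : n = δ * (p * q) := by rw [← hq, Nat.mul_div_cancel' hδn]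
      rw [this, show δ * (p * q) = p * (δ * q) by ring, Nat.mul_div_cancel_left _ hp.pos]
      exact dvd_mul_right _ _
    have hte : t * ((n / p) • step c 0) = (n / p) • step c 0 := by
      refine unit_mul_eq_of_dvd (x := z) ?_ htz
      refine (addOrderOf_dvd_iff_nsmul_eq_zero.2 ?_).trans (hz ▸ hp1)
      rw [← mul_nsmul', Nat.mul_div_cancel' hpn, hn, addOrderOf_nsmul_eq_zero]
    rw [mul_smul_comm, ht] at hte
    have hzz : (n / p) • z = 0 := addOrderOf_dvd_iff_nsmul_eq_zero.1 (hz ▸ hδp)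
    rw [hzdef, nsmul_add, hte, ← two_mul] at hzz
    have h0 := addOrderOf_dvd_iff_nsmul_eq_zero.2 (two_mul_eq_zero hv hzz)
    have hnpos : 0 < n := addOrderOf_pos _
    have := Nat.le_of_dvd (Nat.div_pos (Nat.le_of_dvd hnpos hpn) hp.pos) h0
    exact absurd (Nat.div_lt_self hnpos hp.one_lt) (by omega)

end Rigidity

section Weights

/-- The ratio of `p` and `q` is far from being a root of unity of order at most six
modulo `n`. -/
def Unrelated (n : ℕ) (p q : ℤ) : Prop :=
  ¬ (n : ℤ) ∣ q ^ 2 - p ^ 2 ∧ ¬ (n : ℤ) ∣ q ^ 2 + q * p + p ^ 2 ∧ ¬ (n : ℤ) ∣ q ^ 2 - q * p + p ^ 2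

lemma Unrelated.symm {n : ℕ} {p q : ℤ} (h : Unrelated n p q) : Unrelated n q p := by
  refine ⟨fun h' => h.1 ?_, fun h' => h.2.1 ?_, fun h' => h.2.2 ?_⟩
  · rw [← neg_sub]; exact h'.neg_right
  · convert h' using 1; ring
  · convert h' using 1; ring

lemma Unrelated.neg {n : ℕ} {p q : ℤ} (h : Unrelated n p q) : Unrelated n p (-q) := by
  refine ⟨fun h' => h.1 ?_, fun h' => h.2.2 ?_, fun h' => h.2.1 ?_⟩ <;>
    · convert h' using 1; ring

lemma not_dvd_of_not_dvd {n q : ℕ} {z : ℤ} (hq : q ∣ n) (h : ¬ (q : ℤ) ∣ z) : ¬ (n : ℤ) ∣ z :=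
  fun h' => h ((Int.natCast_dvd_natCast.2 hq).trans h')

lemma eq_one_or_self_of_dvd {n : ℕ} (hn : ¬ n.Prime) (hn1 : n ≠ 1) {p : ℕ} (hp : p.Prime) :
    ¬ (n : ℤ) ∣ p := by
  intro h
  rcases (Nat.dvd_prime hp).1 (Int.natCast_dvd_natCast.1 h) with h | h
  · exact hn1 h
  · exact hn (h ▸ hp)

lemma exists_unrelated {n : ℕ} (hodd : Odd n) (hp : ¬ n.Prime) (h1 : n ≠ 1) (h9 : n ≠ 9)
    (h15 : n ≠ 15) (h21 : n ≠ 21) :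
    ∃ a : ℕ, a.Coprime n ∧ (a + 1).Coprime n ∧ Unrelated n 1 a ∧ Unrelated n 1 (a + 1) ∧
      Unrelated n a (a + 1) := by
  have hprime : ∀ p : ℕ, p.Prime → ¬ (n : ℤ) ∣ p := fun p => eq_one_or_self_of_dvd hp h1
  have hn0 : n ≠ 0 := fun h => by simp [h] at hodd
  have h2n : ¬ 2 ∣ n := fun h => (Nat.not_even_iff_odd.2 hodd) (even_iff_two_dvd.2 h)
  by_cases h3 : 3 ∣ n
  · by_cases h5 : 5 ∣ n
    · obtain ⟨e, m, hm, hnem⟩ := Nat.exists_eq_pow_mul_and_not_dvd hn0 5 (by norm_num)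
      have he : e ≠ 0 := by rintro rfl; rw [hnem] at h5; simp at h5; exact hm h5
      have hcop : (5 ^ e).Coprime m := Nat.Coprime.pow_left _ ((Nat.Prime.coprime_iff_not_dvd
        (by norm_num)).2 hm)
      obtain ⟨a, ha5, ham⟩ := Nat.chineseRemainder hcop 2 1
      have ha5' : a ≡ 2 [MOD 5] := ha5.of_dvd (dvd_pow_self 5 he)
      have hmod : (a : ℤ) % 5 = 2 := by have : a % 5 = 2 := ha5'; omega
      have hmo : ¬ 2 ∣ m := fun h => h2n (hnem ▸ h.mul_left _)
      have hc : ∀ b c d : ℕ, b ≡ c [MOD 5] → b ≡ d [MOD m] → Nat.Coprime c 5 → Nat.Coprime d m →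
          b.Coprime n := by
        intro b c d hbc hbd h h'
        rw [hnem]
        refine Nat.Coprime.mul_right (Nat.Coprime.pow_right _ ?_) ?_
        · rw [Nat.Coprime, hbc.gcd_eq]; exact h
        · rw [Nat.Coprime, hbd.gcd_eq]; exact h'
      have hnd : ∀ z : ℤ, z % 5 ≠ 0 → ¬ (n : ℤ) ∣ z := fun z hz =>
        not_dvd_of_not_dvd h5 fun h => hz (Int.emod_eq_zero_of_dvd h)
      have h2a : ¬ (n : ℤ) ∣ 2 * a + 1 := by
        intro h
        have h' : n ∣ 2 * a + 1 := by exact_mod_cast h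
        have h5e : 5 ^ e ∣ 5 := by
          have : 2 * a + 1 ≡ 2 * 2 + 1 [MOD 5 ^ e] := (ha5.mul_left 2).add_right 1
          exact (Nat.ModEq.dvd_iff this dvd_rfl).1 ((hnem ▸ dvd_mul_right _ _ : 5 ^ e ∣ n).trans h')
        have hm3 : m ∣ 3 := by
          have : 2 * a + 1 ≡ 2 * 1 + 1 [MOD m] := (ham.mul_left 2).add_right 1
          exact (Nat.ModEq.dvd_iff this dvd_rfl).1 ((hnem ▸ dvd_mul_left _ _ : m ∣ n).trans h')
        have h5e' : n ∣ 15 := by rw [hnem]; exact mul_dvd_mul h5e hm3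
        have : n ≤ 15 := Nat.le_of_dvd (by norm_num) h5e'
        omega
      have hsq : ∀ p q r : ℤ, (p * (a : ℤ) ^ 2 + q * a + r) % 5 = (4 * p + 2 * q + r) % 5 := by
        intro p q r
        obtain ⟨w, hw⟩ : ∃ w, (a : ℤ) = 5 * w + 2 := ⟨a / 5, by omega⟩
        rw [hw, show p * (5 * w + 2) ^ 2 + q * (5 * w + 2) + r =
          4 * p + 2 * q + r + 5 * (p * (5 * w ^ 2 + 4 * w) + q * w) by ring]
        exact Int.add_mul_emod_self_left _ _ _
      have hnd' : ∀ z p q r : ℤ, z = p * (a : ℤ) ^ 2 + q * a + r → (4 * p + 2 * q + r) % 5 ≠ 0 →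
          ¬ (n : ℤ) ∣ z := fun z p q r hz h => hnd z (by rw [hz, hsq]; exact h)
      refine ⟨a, hc a 2 1 ha5' ham (by norm_num) (by simp), hc (a + 1) 3 2 (ha5'.add_right 1)
        (ham.add_right 1) (by norm_num) ((Nat.Prime.coprime_iff_not_dvd Nat.prime_two).2 hmo),
        ⟨?_, ?_, ?_⟩, ⟨?_, ?_, ?_⟩, ⟨?_, ?_, ?_⟩⟩
      · exact hnd' _ 1 0 (-1) (by ring) (by norm_num)
      · exact hnd' _ 1 1 1 (by ring) (by norm_num)
      · exact hnd' _ 1 (-1) 1 (by ring) (by norm_num)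
      · exact hnd' _ 1 2 0 (by ring) (by norm_num)
      · exact hnd' _ 1 3 3 (by ring) (by norm_num)
      · exact hnd' _ 1 1 1 (by ring) (by norm_num)
      · convert h2a using 2; ring
      · exact hnd' _ 3 3 1 (by ring) (by norm_num)
      · exact hnd' _ 1 1 1 (by ring) (by norm_num)
    · have h15' : ¬ (n : ℤ) ∣ (15 : ℕ) := by
        intro h
        have h : n ∣ 3 * 5 := by exact_mod_cast h
        exact hprime 3 (by norm_num) (Int.natCast_dvd_natCast.2
          ((((Nat.Prime.coprime_iff_not_dvd (by norm_num)).2 h5).symm).dvd_of_dvd_mul_right h))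
      have h21' : ¬ (n : ℤ) ∣ (21 : ℕ) := by
        intro h
        have h : n ∣ 21 := by exact_mod_cast h
        have := Nat.le_of_dvd (by norm_num) h
        interval_cases n <;> omega
      have h24' : ¬ (n : ℤ) ∣ (24 : ℕ) := by
        intro h
        have h : n ∣ 2 ^ 3 * 3 := by exact_mod_cast h
        exact hprime 3 (by norm_num) (Int.natCast_dvd_natCast.2
          (((((Nat.Prime.coprime_iff_not_dvd (by norm_num)).2 h2n).pow_left 3).symm).dvd_of_dvd_mul_left h))
      have h9' : ¬ (n : ℤ) ∣ (9 : ℕ) := by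
        intro h
        have h : n ∣ 9 := by exact_mod_cast h
        have := Nat.le_of_dvd (by norm_num) h
        interval_cases n <;> omega
      refine ⟨4, (((Nat.Prime.coprime_iff_not_dvd (by norm_num)).2 h2n).pow_left 2),
        (Nat.Prime.coprime_iff_not_dvd (by norm_num)).2 h5, ⟨?_, ?_, ?_⟩, ⟨?_, ?_, ?_⟩,
        ⟨?_, ?_, ?_⟩⟩
      · simpa using h15'
      · simpa using h21'
      · simpa using hprime 13 (by norm_num)
      · simpa using h24'
      · simpa using hprime 31 (by norm_num)
      · simpa using h21'
      · simpa using h9'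
      · simpa using hprime 61 (by norm_num)
      · simpa using h21'
  · have h8 : ¬ (n : ℤ) ∣ (8 : ℕ) := by
      intro h
      have h : n ∣ 2 ^ 3 * 1 := by exact_mod_cast h
      exact h1 (Nat.dvd_one.1
        (((((Nat.Prime.coprime_iff_not_dvd (by norm_num)).2 h2n).pow_left 3).symm).dvd_of_dvd_mul_left h))
    refine ⟨2, (Nat.Prime.coprime_iff_not_dvd (by norm_num)).2 h2n,
      (Nat.Prime.coprime_iff_not_dvd (by norm_num)).2 h3, ⟨?_, ?_, ?_⟩, ⟨?_, ?_, ?_⟩, ⟨?_, ?_, ?_⟩⟩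
    · simpa using hprime 3 (by norm_num)
    · simpa using hprime 7 (by norm_num)
    · simpa using hprime 3 (by norm_num)
    · simpa using h8
    · simpa using hprime 13 (by norm_num)
    · simpa using hprime 7 (by norm_num)
    · simpa using hprime 5 (by norm_num)
    · simpa using hprime 19 (by norm_num)
    · simpa using hprime 7 (by norm_num)

lemma four_le_totient {m : ℕ} (hodd : Odd m) (hm : 5 ≤ m) : 4 ≤ m.totient := by
  have h1 := Nat.totient_even (n := m) (by omega)
  have h2 : ¬ m.totient ≤ 2 := fun h => by
    have := odd_le_three_of_totient_le_two hodd h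
    omega
  obtain ⟨r, hr⟩ := h1
  omega

lemma twelve_lt_totient {n : ℕ} (hodd : Odd n) (hp : ¬ n.Prime) (h1 : n ≠ 1) (h9 : n ≠ 9)
    (h15 : n ≠ 15) (h21 : n ≠ 21) : 12 < n.totient := by
  have hn0 : n ≠ 0 := fun h => by simp [h] at hodd
  by_cases h : ∃ p, p.Prime ∧ p ∣ n ∧ p ≠ 3
  · obtain ⟨p, hpp, ⟨m, rfl⟩, hp3⟩ := h
    have hpo := (Nat.odd_mul.1 hodd).1
    have hmo := (Nat.odd_mul.1 hodd).2
    have hp2 := hpp.two_le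
    have hm1 : m ≠ 1 := by rintro rfl; exact hp (by simpa using hpp)
    have hp4 : p ≠ 4 := by rintro rfl; exact absurd hpo (by decide)
    have hp2' : p ≠ 2 := by rintro rfl; exact absurd hpo (by decide)
    have h2 := Nat.totient_super_multiplicative p m
    rw [Nat.totient_prime hpp] at h2
    by_cases hm3 : m = 3
    · subst hm3
      have : (3 : ℕ).totient = 2 := by decide
      rw [this] at h2
      have : p ≠ 6 := by rintro rfl; exact absurd hpo (by decide)
      have : p ≠ 8 := by rintro rfl; exact absurd hpo (by decide)
      have : p ≠ 9 := by rintro rfl; norm_num at hpp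
      have : 10 ≤ p := by omega
      omega
    · obtain ⟨r, hr⟩ := hmo
      have h4 := four_le_totient (m := m) ⟨r, hr⟩ (by omega)
      have : 4 * 4 ≤ (p - 1) * m.totient := Nat.mul_le_mul (by omega) h4
      omega
  · push Not at h
    have hpow : n = 3 ^ n.primeFactorsList.length :=
      Nat.eq_prime_pow_of_unique_prime_dvd hn0 fun {d} hd hdn => h d hd hdn
    set e := n.primeFactorsList.length
    have he : 3 ≤ e := by
      by_contra! he
      interval_cases e
      · exact h1 hpow
      · exact hp (by rw [hpow]; norm_num)
      · exact h9 hpow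
    have hdvd : (3 ^ 3).totient ∣ n.totient := Nat.totient_dvd_of_dvd (hpow ▸ pow_dvd_pow 3 he)
    have : (3 ^ 3).totient = 18 := by rw [Nat.totient_prime_pow (by norm_num) (by norm_num)]; norm_num
    rw [this] at hdvd
    have := Nat.le_of_dvd (Nat.totient_pos.2 (by omega)) hdvd
    omega

end Weights

section Triangles

variable {v : ℕ} [NeZero v] {D : Set (Block v)} {J : AddSubgroup (ZMod v)}

lemma card_diffs_cyc {k : ℕ} [NeZero k] {c : ZMod k → ZMod v} (hinj : Function.Injective (step c))
    (hne : ∀ a b, step c a ≠ -step c b) : (diffs (cyc c)).card = 2 * k := by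
  rw [diffs_cyc_eq, Finset.card_union_of_disjoint, Finset.card_image_of_injective _ neg_injective,
    Finset.card_image_of_injective _ hinj, Finset.card_univ, ZMod.card]
  · omega
  · refine Finset.disjoint_left.2 fun x hx hx' => ?_
    obtain ⟨a, -, rfl⟩ := Finset.mem_image.1 hx
    obtain ⟨y, hy, hxy⟩ := Finset.mem_image.1 hx'
    obtain ⟨b, -, rfl⟩ := Finset.mem_image.1 hy
    exact hne a b hxy.symm

lemma zmod_three_cases : ∀ i j : ZMod 3, i = j ∨ i = j + 1 ∨ j = i + 1 := by decide

lemma injective_of_step_ne_zero {c : ZMod 3 → ZMod v} (h : ∀ i, step c i ≠ 0) :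
    Function.Injective c := by
  intro i j hij
  rcases zmod_three_cases i j with rfl | rfl | rfl
  · rfl
  · exact absurd (by rw [step, hij, sub_self]) (h j)
  · exact absurd (by rw [step, hij, sub_self]) (h i)

/-- A family of triangles whose differences are the entries of a `3 × 3` array. -/
lemma exists_partialDesign_of_array {f : ZMod 3 → ZMod 3 → ZMod v} (hsum : ∀ j, ∑ i, f i j = 0)
    (hf : ∀ i j i' j', f i j = f i' j' ∨ f i j = -f i' j' → i = i' ∧ j = j')
    (hf0 : ∀ i j, f i j ≠ -f i j) {A : Finset (ZMod v)}
    (hA : ∀ x, x ∈ A ↔ ∃ i j, x = f i j ∨ x = -f i j) :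
    ∃ S : Set (Block v), PartialDesign v 3 (A : Set (ZMod v)) S ∧
      (∀ E ∈ S, (diffs E).card = 2 * 3) ∧
      ∃ E ∈ S, ∀ x, x ∈ diffs E ↔ ∃ i, x = f i 0 ∨ x = -f i 0 := by
  choose c hc using fun j => exists_step_eq (hsum j)
  have hstep : ∀ i j, f i j ≠ 0 := fun i j h => hf0 i j (by rw [h, neg_zero])
  have hinj : ∀ j, Function.Injective (c j) := fun j => injective_of_step_ne_zero fun i => by
    rw [hc]; exact hstep i j
  have hd : ∀ j x, x ∈ diffs (cyc (c j)) ↔ ∃ i, x = f i j ∨ x = -f i j := by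
    intro j x; simp only [mem_diffs_cyc', hc]
  have hcard : ∀ j, (diffs (cyc (c j))).card = 2 * 3 := by
    intro j
    refine card_diffs_cyc (fun a b h => ?_) fun a b h => ?_
    · rw [hc, hc] at h; exact (hf _ _ _ _ (Or.inl h)).1
    · rw [hc, hc] at h
      obtain rfl := (hf _ _ _ _ (Or.inr h)).1
      exact hf0 _ _ h
  have hcyc : ∀ j, IsCycleBlock v 3 (cyc (c j)) := fun j => isCycleBlock_iff.2 ⟨_, hinj j, rfl⟩
  refine ⟨translates (Set.range fun j => cyc (c j)), ?_, ?_, cyc (c 0),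
    subset_translates _ ⟨0, rfl⟩, hd 0⟩
  · refine partialDesign_translates le_rfl ?_ ?_ ?_ ?_
    · rintro _ ⟨j, rfl⟩; exact hcyc j
    · rintro _ ⟨j, rfl⟩ x hx
      obtain ⟨i, hi⟩ := (hd j x).1 hx
      exact (hA x).2 ⟨i, j, hi⟩
    · intro x hx _
      obtain ⟨i, j, hij⟩ := (hA x).1 hx
      exact ⟨_, ⟨j, rfl⟩, (hd j x).2 ⟨i, hij⟩⟩
    · rintro _ ⟨j, rfl⟩ _ ⟨j', rfl⟩ x b b' hb hb'
      obtain ⟨i, hi⟩ := (hd j x).1 (mem_diffs.2 ⟨b, hb⟩)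
      obtain ⟨i', hi'⟩ := (hd j' x).1 (mem_diffs.2 ⟨b', hb'⟩)
      have : j = j' := by
        rcases hi with rfl | rfl <;> rcases hi' with h | h
        · exact (hf _ _ _ _ (Or.inl h)).2
        · exact (hf _ _ _ _ (Or.inr h)).2
        · exact (hf _ _ _ _ (Or.inr (neg_eq_iff_eq_neg.1 h))).2
        · exact (hf _ _ _ _ (Or.inl (neg_injective h))).2
      subst this
      rw [(card_diffs_eq_iff le_rfl (hcyc j)).1 (hcard j) x b b' hb hb', sub_self,
        translateBlock_zero]
  · rintro _ ⟨_, ⟨j, rfl⟩, z, rfl⟩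
    rw [diffs_translateBlock, hcard]

lemma dihedral_relation {d : ZMod 3 → ZMod v} (hd : Dihedral d) (hsum : ∑ i, d i = 0)
    {t : (ZMod v)ˣ} {i j : ZMod 3} (h : t * d i = d j ∨ t * d i = -d j) :
    t * (t * d 0) = d 0 ∨ t * (t * d 0) + t * d 0 + d 0 = 0 ∨ t * (t * d 0) - t * d 0 + d 0 = 0 := by
  have hsum : d 0 + d 1 + d 2 = 0 := by rw [← hsum]; exact (Fin.sum_univ_three d).symm
  have key : ∀ t : (ZMod v)ˣ, t * d i = d j →
      t * (t * d 0) = d 0 ∨ t * (t * d 0) + t * d 0 + d 0 = 0 := by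
    intro t h
    rcases hd t i j h with h | h
    · generalize j - i = s at h
      have h3 : ∀ s : ZMod 3, s = 0 ∨ s = 1 ∨ s = 2 := by decide
      rw [h 0, h (0 + s)]
      rcases h3 s with rfl | rfl | rfl
      · left; simp
      · right
        rw [show (0 : ZMod 3) + 1 + 1 = 2 by decide, show (0 : ZMod 3) + 1 = 1 by decide]
        linear_combination hsum
      · right
        rw [show (0 : ZMod 3) + 2 + 2 = 1 by decide, show (0 : ZMod 3) + 2 = 2 by decide]
        linear_combination hsum
    · left
      rw [h, h]; ring_nf
  rcases h with h | h
  · exact (key t h).imp_right Or.inl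
  · rcases key (-t) (by rw [Units.val_neg, neg_mul, h, neg_neg]) with h | h <;>
      rw [Units.val_neg] at h
    · left; linear_combination h
    · right; right; linear_combination h

lemma exists_weight_units {n : ℕ} (hnv : n ∣ v) (hodd : Odd n) (hp : ¬ n.Prime) (h1 : n ≠ 1)
    (h9 : n ≠ 9) (h15 : n ≠ 15) (h21 : n ≠ 21) :
    ∃ (u : ZMod 3 → (ZMod v)ˣ) (w : ZMod 3 → ℤ), (∀ i y, n • y = 0 → (u i : ZMod v) * y = w i * y) ∧
      ∑ i, w i = 0 ∧ ∀ i i', i ≠ i' → Unrelated n (w i) (w i') := by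
  obtain ⟨a, ha, ha1, hu1, hu2, hu3⟩ := exists_unrelated hodd hp h1 h9 h15 h21
  obtain ⟨ua, hua⟩ := exists_unit hnv ha
  obtain ⟨ub, hub⟩ := exists_unit hnv ha1
  have h3 : ∀ i : ZMod 3, i = 0 ∨ i = 1 ∨ i = 2 := by decide
  let w : ZMod 3 → ℤ := ![1, a, -(a + 1)]
  have w0 : w 0 = 1 := rfl
  have w1 : w 1 = a := rfl
  have w2 : w 2 = -(a + 1) := rfl
  let u : ZMod 3 → (ZMod v)ˣ := ![1, ua, -ub]
  have u0 : u 0 = 1 := rfl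
  have u1 : u 1 = ua := rfl
  have u2 : u 2 = -ub := rfl
  refine ⟨u, w, ?_, ?_, ?_⟩
  · intro i y hy
    rcases h3 i with rfl | rfl | rfl
    · simp [u0, w0]
    · rw [u1, w1, hua y hy]; simp
    · rw [u2, w2, Units.val_neg, neg_mul, hub y hy]; push_cast; ring
  · refine (Fin.sum_univ_three w).trans ?_
    change w 0 + w 1 + w 2 = 0
    rw [w0, w1, w2]; ring
  · have h01 : Unrelated n (w 0) (w 1) := hu1
    have h02 : Unrelated n (w 0) (w 2) := hu2.neg
    have h12 : Unrelated n (w 1) (w 2) := hu3.neg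
    intro i i' hii'
    rcases h3 i with rfl | rfl | rfl <;> rcases h3 i' with rfl | rfl | rfl
    · exact absurd rfl hii'
    · exact h01
    · exact h02
    · exact h01.symm
    · exact absurd rfl hii'
    · exact h12
    · exact h02.symm
    · exact h12.symm
    · exact absurd rfl hii'

end Triangles

section FreeTriangles

variable {v : ℕ} [NeZero v] {D : Set (Block v)} {J : AddSubgroup (ZMod v)}

lemma array_injective {d : ZMod 3 → ZMod v} (hd : Dihedral d) (hsum : ∑ i, d i = 0)
    (hinj : Function.Injective d) (hneg : ∀ i j, d i ≠ -d j) {u : ZMod 3 → (ZMod v)ˣ}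
    {w : ZMod 3 → ℤ} (hu : ∀ i, (u i : ZMod v) * d 0 = w i * d 0)
    (hw : ∀ i i', i ≠ i' → Unrelated (addOrderOf (d 0)) (w i) (w i')) {i j i' j' : ZMod 3}
    (h : u i * d j = u i' * d j' ∨ u i * d j = -(u i' * d j')) : i = i' ∧ j = j' := by
  by_cases hii' : i = i'
  · subst hii'
    refine ⟨rfl, ?_⟩
    rw [← mul_neg, Units.mul_right_inj, Units.mul_right_inj] at h
    exact h.elim (fun h => hinj h) fun h => absurd h (hneg _ _)
  exfalso
  have hzero : ∀ z : ℤ, (z : ZMod v) * d 0 = 0 → (addOrderOf (d 0) : ℤ) ∣ z := by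
    intro z hz
    rw [addOrderOf_dvd_iff_zsmul_eq_zero, zsmul_eq_mul, hz]
  have hB : (u i' : ZMod v) * ((u i')⁻¹ * u i : (ZMod v)ˣ) = u i := by
    rw [← Units.val_mul, mul_inv_cancel_left]
  have ht : ((u i')⁻¹ * u i : (ZMod v)ˣ) * d j = d j' ∨
      ((u i')⁻¹ * u i : (ZMod v)ˣ) * d j = -d j' := by
    rw [Units.val_mul, mul_assoc]
    rcases h with h | h
    · left; rw [h, Units.inv_mul_cancel_left]
    · right; rw [h, mul_neg, Units.inv_mul_cancel_left]
  obtain ⟨h1, h2, h3⟩ := hw i' i (Ne.symm hii')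
  generalize ((u i')⁻¹ * u i : (ZMod v)ˣ) = t at hB ht
  have hA := hu i
  have hB' := hu i'
  have hAA : (u i : ZMod v) * (u i * d 0) = w i * (w i * d 0) := by
    rw [hA, mul_left_comm, hA]
  have hAB : (u i : ZMod v) * (u i' * d 0) = w i * (w i' * d 0) := by
    rw [hB', mul_left_comm, hA]; ring
  have hBB : (u i' : ZMod v) * (u i' * d 0) = w i' * (w i' * d 0) := by
    rw [hB', mul_left_comm, hB']
  rcases dihedral_relation hd hsum ht with h | h | h
  · refine h1 (hzero _ ?_)
    push_cast
    rw [← hB] at hAA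
    linear_combination -hAA + hBB + (u i' : ZMod v) ^ 2 * h
  · refine h2 (hzero _ ?_)
    push_cast
    rw [← hB] at hAA hAB
    linear_combination -hAA - hAB - hBB + (u i' : ZMod v) ^ 2 * h
  · refine h3 (hzero _ ?_)
    push_cast
    rw [← hB] at hAA hAB
    linear_combination -hAA + hAB - hBB + (u i' : ZMod v) ^ 2 * h

lemma totient_le_card (x : ZMod v) {A : Finset (ZMod v)} (h : ∀ u : (ZMod v)ˣ, u * x ∈ A) :
    (addOrderOf x).totient ≤ A.card := by
  classical
  have h1 := card_stabilizer_mul x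
  have h2 : (Finset.univ : Finset (ZMod v)ˣ).card ≤
      (A.card) * Nat.card (MulAction.stabilizer (ZMod v)ˣ x) := by
    rw [mul_comm]
    refine Finset.card_le_mul_card_image_of_maps_to (f := fun u : (ZMod v)ˣ => (u : ZMod v) * x)
      (fun u _ => h u) _ fun y hy => ?_
    rcases (Finset.univ.filter fun u : (ZMod v)ˣ => (u : ZMod v) * x = y).eq_empty_or_nonempty
      with h0 | ⟨w, hw⟩
    · rw [h0]; simp
    · have hw := (Finset.mem_filter.1 hw).2
      rw [Nat.card_eq_fintype_card, ← Finset.card_univ]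
      refine Finset.card_le_card_of_injOn (t := Finset.univ)
        (fun u => if hu : w⁻¹ * u ∈ MulAction.stabilizer (ZMod v)ˣ x then ⟨w⁻¹ * u, hu⟩ else 1)
        (fun _ _ => Finset.mem_coe.2 (Finset.mem_univ _)) ?_
      have hstab : ∀ u : (ZMod v)ˣ, (u : ZMod v) * x = y →
          w⁻¹ * u ∈ MulAction.stabilizer (ZMod v)ˣ x := by
        intro u hu
        rw [MulAction.mem_stabilizer_iff, Units.smul_def, smul_eq_mul, Units.val_mul, mul_assoc, hu,
          ← hw, Units.inv_mul_cancel_left]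
      intro u hu u' hu' huu'
      have hu := (Finset.mem_filter.1 hu).2
      have hu' := (Finset.mem_filter.1 hu').2
      simp only [dif_pos (hstab u hu), dif_pos (hstab u' hu')] at huu'
      simpa using huu'
  rw [Finset.card_univ, ZMod.card_units_eq_totient, ← h1, mul_comm] at h2
  exact Nat.le_of_mul_le_mul_right h2 Nat.card_pos

theorem freeAt_three (hv : Odd v) (hD : IsCyclicDesign v 3 D) (hJ : Closed D J) {x₀ : ZMod v}
    (hx₀ : AddSubgroup.zmultiples x₀ = J) (hp : ¬ (addOrderOf x₀).Prime) (h1 : addOrderOf x₀ ≠ 1)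
    (h9 : addOrderOf x₀ ≠ 9) (h15 : addOrderOf x₀ ≠ 15) (h21 : addOrderOf x₀ ≠ 21) :
    FreeAt 3 D J := by
  by_contra hfree
  have hx0 : x₀ ≠ 0 := fun h => h1 (by rw [h, addOrderOf_zero])
  obtain ⟨E, hE, hxE⟩ := hD.exists_diffs hx0
  obtain ⟨c₀, hc₀, rfl⟩ := isCycleBlock_iff.1 (hD.1.1 E hE)
  obtain ⟨p, hp0⟩ := mem_diffs_cyc'.1 hxE
  obtain ⟨c, hc, hcE, hc0⟩ : ∃ c : ZMod 3 → ZMod v, Function.Injective c ∧ cyc c = cyc c₀ ∧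
      step c 0 = step c₀ p :=
    ⟨fun i => c₀ (i + p), fun i j h => add_right_cancel (hc₀ h), cyc_shift c₀ p, by
      rw [step_shift, zero_add]⟩
  rw [← hcE] at hE hxE
  have hord : addOrderOf (step c 0) = addOrderOf x₀ := by
    rw [hc0]; rcases hp0 with h | h <;> simp [h]
  have hgen : AddSubgroup.zmultiples (step c 0) = J := by
    rw [← hx₀, hc0]; rcases hp0 with h | h <;> simp [h]
  rw [← hord] at hp h1 h9 h15 h21
  clear hp0 hc0 hcE hc₀ hxE hx0 hord hx₀
  set d := step c with hddef
  have hdJ : ∀ y ∈ diffs (cyc c), cl D y = J := fun y hy =>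
    (cl_eq_of_mem_diffs hE hy (step_mem_diffs c 0)).trans (cl_eq_of_zmultiples hJ hgen)
  have hlab : ∀ i, cl D (d i) = J := fun i => hdJ _ (step_mem_diffs c i)
  have hd : Dihedral d := dihedral_step le_rfl hD hfree hc hE hdJ
  have hneg : ∀ i j, d i ≠ -d j := step_ne_neg le_rfl hv hD hc hE
  have hsum : ∑ i, d i = 0 := sum_step c
  have hinj : Function.Injective d := by
    have hrot : ∀ j, d j ≠ d (j + 1) := by
      intro j h
      refine hp ?_
      have hconst : ∀ m, d m = d (m + 1) := fun m => by
        have := rigid_step le_rfl hD hc hc hE hE h (m - j)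
        rw [show j + (m - j) = m by ring, show j + 1 + (m - j) = m + 1 by ring] at this
        exact this
      have h3 : ∀ i : ZMod 3, i = 0 ∨ i = 0 + 1 ∨ i = 0 + 1 + 1 := by decide
      rw [addOrderOf_of_step_const hc (z := d 0) fun i => by
        rcases h3 i with rfl | rfl | rfl
        · rfl
        · exact (hconst 0).symm
        · rw [← hddef, ← hconst, ← hconst]]
      norm_num
    intro i j hij
    rcases zmod_three_cases i j with rfl | rfl | rfl
    · rfl
    · exact absurd hij.symm (hrot j)
    · exact absurd hij (hrot i)
  have hodd : Odd (addOrderOf (d 0)) := odd_addOrderOf hv _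
  obtain ⟨u, w, huw, hwsum, hwne⟩ := exists_weight_units (addOrderOf_dvd (d 0)) hodd hp h1 h9 h15 h21
  have hmult : ∀ j, addOrderOf (d 0) • d j = 0 := by
    intro j
    have : d j ∈ AddSubgroup.zmultiples (d 0) := by rw [hgen]; exact mem_of_cl_eq (hlab j)
    obtain ⟨m, hm⟩ := AddSubgroup.mem_zmultiples_iff.1 this
    rw [← hm, smul_comm, addOrderOf_nsmul_eq_zero, smul_zero]
  let f : ZMod 3 → ZMod 3 → ZMod v := fun i j => u i * d j
  have hf : ∀ i j i' j', f i j = f i' j' ∨ f i j = -f i' j' → i = i' ∧ j = j' := fun i j i' j' h =>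
    array_injective hd hsum hinj hneg (fun i => huw i _ (hmult 0)) hwne h
  have hf0 : ∀ i j, f i j ≠ -f i j := by
    intro i j h
    exact hneg j j ((Units.mul_right_inj (u i)).1 (by rw [mul_neg]; exact h))
  have hcol : ∀ j, ∑ i, f i j = 0 := by
    intro j
    have : ∀ i, f i j = (w i : ZMod v) * d j := fun i => huw i _ (hmult j)
    simp only [this, ← Finset.sum_mul, ← Int.cast_sum, hwsum, Int.cast_zero, zero_mul]
  classical
  let A : Finset (ZMod v) := Finset.univ.biUnion fun i => Finset.univ.biUnion fun j => {f i j, -f i j}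
  have hA : ∀ x, x ∈ A ↔ ∃ i j, x = f i j ∨ x = -f i j := by
    intro x; simp [A]
  obtain ⟨S, hS, hSc, E₀, hE₀, hdE₀⟩ := exists_partialDesign_of_array hcol hf hf0 hA
  have hrow : ∀ t : (ZMod v)ˣ, ∃ R ∈ D, ∀ x, x ∈ diffs R ↔ ∃ j, x = t * d j ∨ x = -(t * d j) := by
    intro t
    have hx : ∀ x, x ∈ diffs (mulBlock t (cyc c)) ↔ ∃ j, x = t * d j ∨ x = -(t * d j) := by
      intro x
      rw [mulBlock_cyc, mem_diffs_cyc']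
      simp only [step_mul, hddef]
    rcases mulBlock_mem_or_of_not_freeAt le_rfl hD hfree hE (step_mem_diffs c 0) (hlab 0) t
      with h | h
    · exact ⟨_, h, hx⟩
    · exact ⟨_, h, by rw [diffs_neg]; exact hx⟩
  have hlabf : ∀ t : (ZMod v)ˣ, ∀ j, cl D (t * d j) = J := fun t j => by rw [cl_mul, hlab]
  have hAD : ∀ F ∈ D, ∀ x ∈ diffs F, x ∈ A →
      ∃ i, ∀ y, y ∈ diffs F ↔ ∃ j, y = f i j ∨ y = -f i j := by
    intro F hF x hx hxA
    obtain ⟨i, j, hij⟩ := (hA x).1 hxA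
    obtain ⟨R, hR, hdR⟩ := hrow (u i)
    exact ⟨i, by rw [hD.diffs_eq le_rfl hF hR hx ((hdR x).2 ⟨j, hij⟩)]; exact hdR⟩
  have hsat : ∀ F ∈ D, ∀ x ∈ diffs F, x ∈ A → ∀ y ∈ diffs F, y ∈ A := by
    intro F hF x hx hxA y hy
    obtain ⟨i, hi⟩ := hAD F hF x hx hxA
    obtain ⟨j, hj⟩ := (hi y).1 hy
    exact (hA y).2 ⟨i, j, hj⟩
  refine hfree (freeAt_of_exchange le_rfl hD ?_ hsat ?_ hS ?_ hSc ?_ ⟨E₀, hE₀, ?_⟩)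
  · intro h
    obtain ⟨i, j, h | h⟩ := (hA 0).1 h
    · exact hf0 i j (by rw [← h, neg_zero])
    · exact hf0 i j (by rw [← h, ← neg_neg (f i j), ← h, neg_zero])
  · intro x hx
    obtain ⟨i, j, h⟩ := (hA x).1 hx
    rcases h with rfl | rfl
    · exact hlabf _ _
    · have := hlabf (-u i) j
      rwa [Units.val_neg, neg_mul] at this
  · intro F hF x hx hxA
    obtain ⟨i, hi⟩ := hAD F hF x hx hxA
    have : diffs F = diffs (mulBlock (u i) (cyc c)) := by
      ext y
      rw [hi, mulBlock_cyc, mem_diffs_cyc']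
      simp only [step_mul, f, hddef]
    rw [this, mulBlock_cyc]
    refine card_diffs_cyc (fun a b h => ?_) fun a b h => ?_
    · rw [step_mul, step_mul] at h
      exact (hf i a i b (Or.inl h)).2
    · rw [step_mul, step_mul, ← mul_neg, Units.mul_right_inj] at h
      exact hneg a b h
  · intro J' _ hun F hF x hx hxA hxJ'
    have hunit : ∀ (t : (ZMod v)ˣ) (y : ZMod v), (t : ZMod v) * y ∈ J' → y ∈ J' := by
      intro t y hy
      have := mul_mem_addSubgroup J' (↑t⁻¹ : ZMod v) hy
      simpa using this
    obtain ⟨i, hi⟩ := hAD F hF x hx hxA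
    obtain ⟨j, hj⟩ := (hi x).1 hx
    have hdj : d j ∈ J' := by
      rcases hj with rfl | rfl
      · exact hunit _ _ hxJ'
      · exact hunit _ _ (neg_mem_iff.1 hxJ')
    suffices h : ∀ j', d j' ∈ J' by
      intro y hy
      obtain ⟨j', h' | h'⟩ := (hi y).1 hy
      · rw [h']; exact mul_mem_addSubgroup _ _ (h j')
      · rw [h']; exact neg_mem (mul_mem_addSubgroup _ _ (h j'))
    by_cases hjn : addOrderOf (d 0) ∣ addOrderOf (d j)
    · have : d 0 ∈ J' := AddSubgroup.zmultiples_le_of_mem hdj (mem_zmultiples_of_dvd hjn)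
      have hle : J ≤ J' := hgen ▸ AddSubgroup.zmultiples_le_of_mem this
      exact fun j' => hle (mem_of_cl_eq (hlab j'))
    · obtain ⟨t, ht⟩ : ∃ t : (ZMod v)ˣ, t * d 0 ∉ A := by
        by_contra! hall
        let A' : Finset (ZMod v) := Finset.univ.biUnion fun i =>
          (Finset.univ.erase j).biUnion fun j => {f i j, -f i j}
        have hle : A'.card ≤ 12 := by
          refine (Finset.card_biUnion_le_card_mul _ _ 4 fun i _ => ?_).trans (by simp)
          refine (Finset.card_biUnion_le_card_mul _ _ 2 fun j _ => Finset.card_le_two).trans ?_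
          rw [Finset.card_erase_of_mem (Finset.mem_univ _)]; simp
        have := twelve_lt_totient hodd hp h1 h9 h15 h21
        have h2 : (addOrderOf (d 0)).totient ≤ A'.card := by
          refine totient_le_card _ fun t => ?_
          obtain ⟨i', j', h'⟩ := (hA _).1 (hall t)
          have hjj' : j' ≠ j := by
            rintro rfl
            refine hjn (dvd_of_eq ?_)
            rw [← addOrderOf_unit_mul t (d 0), ← addOrderOf_unit_mul (u i') (d j')]
            rcases h' with h' | h' <;> rw [h']
            exact addOrderOf_neg _
          simp only [A', Finset.mem_biUnion, Finset.mem_univ, true_and, Finset.mem_erase,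
            Finset.mem_insert, Finset.mem_singleton, and_true]
          exact ⟨i', j', hjj', h'⟩
        omega
      obtain ⟨R, hR, hdR⟩ := hrow t
      have hmemR : ∀ j', t * d j' ∈ diffs R := fun j' => (hdR _).2 ⟨j', Or.inl rfl⟩
      have := hun R hR _ (hmemR j) (fun h => ht (hsat R hR _ (hmemR j) h _ (hmemR 0))) (hlabf t j)
        (mul_mem_addSubgroup _ _ hdj)
      exact fun j' => hunit t _ (this _ (hmemR j'))
  · have hnot : ∀ F ∈ D, ¬ ∀ x, x ∈ diffs F ↔ ∃ i, x = f i 0 ∨ x = -f i 0 := by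
      intro F hF h
      have h0 : f 0 0 ∈ diffs F := (h _).2 ⟨0, Or.inl rfl⟩
      obtain ⟨i, hi⟩ := hAD F hF _ h0 ((hA _).2 ⟨0, 0, Or.inl rfl⟩)
      obtain ⟨i', hi'⟩ := (h (f i 1)).1 ((hi _).2 ⟨1, Or.inl rfl⟩)
      exact absurd (hf _ _ _ _ hi').2 (by decide)
    exact ⟨fun h => hnot E₀ h hdE₀, fun h => hnot _ h (by rw [diffs_neg]; exact hdE₀)⟩

end FreeTriangles

section HittingPrimes

variable {v : ℕ} [NeZero v]

lemma addOrderOf_natCast_of_dvd {q : ℕ} (hq : q ∣ v) : addOrderOf (q : ZMod v) = v / q := by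
  rw [ZMod.addOrderOf_coe _ (NeZero.ne v), Nat.gcd_eq_right hq]

lemma dvd_val_of_mem_zmultiples {q : ℕ} (hq : q ∣ v) {w : ZMod v}
    (hw : w ∈ AddSubgroup.zmultiples (q : ZMod v)) : q ∣ w.val := by
  obtain ⟨m, rfl⟩ := AddSubgroup.mem_zmultiples_iff.1 hw
  have : ((m • (q : ZMod v) : ZMod v).cast : ZMod q) = 0 := by
    have := map_zsmul (ZMod.castHom hq (ZMod q)) m (q : ZMod v)
    simpa using this
  rwa [ZMod.cast_eq_val, ZMod.natCast_eq_zero_iff] at this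

lemma exists_prime_le {J : AddSubgroup (ZMod v)} (hJ : J ≠ ⊤) :
    ∃ q ∈ v.primeFactors, J ≤ AddSubgroup.zmultiples (q : ZMod v) := by
  obtain ⟨x, rfl⟩ := exists_zmultiples J
  obtain ⟨m, hm⟩ := addOrderOf_dvd x
  have hv := NeZero.ne v
  have hm1 : m ≠ 1 := by
    rintro rfl
    refine hJ (AddSubgroup.eq_top_of_card_eq _ ?_)
    rw [Nat.card_zmultiples, Nat.card_zmod]
    omega
  obtain ⟨q, hq, hqm⟩ := Nat.exists_prime_and_dvd hm1
  have hqv : q ∣ v := hm ▸ hqm.mul_left _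
  refine ⟨q, Nat.mem_primeFactors.2 ⟨hq, hqv, hv⟩, AddSubgroup.zmultiples_le_of_mem
    (mem_zmultiples_of_dvd ?_)⟩
  rw [addOrderOf_natCast_of_dvd hqv]
  obtain ⟨l, rfl⟩ := hqm
  refine ⟨l, Nat.div_eq_of_eq_mul_right hq.pos ?_⟩
  exact hm.trans (by ring)

lemma dvd_addOrderOf_of_not_mem {q : ℕ} (hq : q.Prime) (hqv : q ∣ v) {x : ZMod v}
    (hx : x ∉ AddSubgroup.zmultiples (q : ZMod v)) : q ∣ addOrderOf x := by
  by_contra h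
  refine hx (mem_zmultiples_of_dvd ?_)
  rw [addOrderOf_natCast_of_dvd hqv]
  refine (Nat.Coprime.symm ((Nat.Prime.coprime_iff_not_dvd hq).2 h)).dvd_of_dvd_mul_left
    (k := addOrderOf x) ?_
  rw [Nat.mul_div_cancel' hqv]
  exact addOrderOf_dvd x

/-- A minimal set of primes `q` such that every nontrivial proper closed subgroup lies in some
`q ℤ / v ℤ`, together with closed subgroups witnessing minimality. -/
lemma exists_hitting_primes (D : Set (Block v)) :
    ∃ Q ⊆ v.primeFactors,
      (∀ J, Closed D J → J ≠ ⊤ → J ≠ ⊥ →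
        ∃ q : ℕ, q ∈ Q ∧ J ≤ AddSubgroup.zmultiples (q : ZMod v)) ∧
      ∃ g : ℕ → ZMod v, ∀ q ∈ Q, Closed D (AddSubgroup.zmultiples (g q)) ∧
        AddSubgroup.zmultiples (g q) ≠ ⊤ ∧ g q ≠ 0 ∧
        g q ∈ AddSubgroup.zmultiples (q : ZMod v) ∧
        ∀ q' ∈ Q, q' ≠ q → g q ∉ AddSubgroup.zmultiples (q' : ZMod v) := by
  classical
  let 𝓠 := v.primeFactors.powerset.filter fun Q =>
    ∀ J, Closed D J → J ≠ ⊤ → J ≠ ⊥ → ∃ q : ℕ, q ∈ Q ∧ J ≤ AddSubgroup.zmultiples (q : ZMod v)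
  have hne : 𝓠.Nonempty :=
    ⟨v.primeFactors, by simpa [𝓠] using fun J _ hJ _ => by simpa using exists_prime_le hJ⟩
  obtain ⟨Q, hQ, hmin⟩ := Finset.exists_min_image 𝓠 Finset.card hne
  obtain ⟨hQv, hhit⟩ := Finset.mem_filter.1 hQ
  have hQv := Finset.mem_powerset.1 hQv
  refine ⟨Q, hQv, hhit, ?_⟩
  have key : ∀ q, ∃ g : ZMod v, q ∈ Q → Closed D (AddSubgroup.zmultiples g) ∧
        AddSubgroup.zmultiples g ≠ ⊤ ∧ g ≠ 0 ∧
        g ∈ AddSubgroup.zmultiples (q : ZMod v) ∧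
        ∀ q' ∈ Q, q' ≠ q → g ∉ AddSubgroup.zmultiples (q' : ZMod v) := by
    intro q
    by_cases hq : q ∈ Q
    swap
    · exact ⟨0, fun h => absurd h hq⟩
    have hlt : Q.erase q ∉ 𝓠 := fun h =>
      absurd (hmin _ h) (not_le.2 (Finset.card_erase_lt_of_mem hq))
    have : ¬ ∀ J, Closed D J → J ≠ ⊤ → J ≠ ⊥ →
        ∃ q' : ℕ, q' ∈ Q.erase q ∧ J ≤ AddSubgroup.zmultiples (q' : ZMod v) := fun h =>
      hlt (Finset.mem_filter.2 ⟨Finset.mem_powerset.2 ((Finset.erase_subset _ _).trans hQv), h⟩)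
    push Not at this
    obtain ⟨J, hJ, hJt, hJb, hJq⟩ := this
    obtain ⟨g, rfl⟩ := exists_zmultiples J
    obtain ⟨q₀, hq₀, hle⟩ := hhit _ hJ hJt hJb
    have hqq : q₀ = q := by
      by_contra hne
      exact hJq q₀ (Finset.mem_erase.2 ⟨hne, hq₀⟩) hle
    subst hqq
    refine ⟨g, fun _ => ⟨hJ, hJt, fun h => hJb (by rw [h, AddSubgroup.zmultiples_zero_eq_bot]),
      hle (AddSubgroup.mem_zmultiples g), fun q' hq' hne hg => ?_⟩⟩
    exact hJq q' (Finset.mem_erase.2 ⟨hne, hq'⟩) (AddSubgroup.zmultiples_le_of_mem hg)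
  choose g hg using key
  exact ⟨g, hg⟩

lemma card_coprime_range_mul (m j : ℕ) :
    ((Finset.range (m * j)).filter fun a => m.Coprime a).card = j * m.totient := by
  induction j with
  | zero => simp
  | succ j ih =>
    have h : Finset.range (m * (j + 1)) =
        Finset.range (m * j) ∪ Finset.Ico (m * j) (m * j + m) := by
      ext a; simp only [Finset.mem_range, Finset.mem_union, Finset.mem_Ico, Nat.mul_add, mul_one]
      omega
    have hd : Disjoint (Finset.range (m * j)) (Finset.Ico (m * j) (m * j + m)) := by
      rw [Finset.disjoint_left]; intro a; simp only [Finset.mem_range, Finset.mem_Ico]; omega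
    rw [h, Finset.filter_union, Finset.card_union_of_disjoint (Finset.disjoint_filter_filter hd), ih,
      Nat.filter_coprime_Ico_eq_totient]
    ring

lemma card_coprime_val_mul {Q : Finset ℕ} (hQ : Q ⊆ v.primeFactors) :
    ((Finset.univ.filter fun w : ZMod v => (∏ q ∈ Q, q).Coprime w.val).card) * ∏ q ∈ Q, q =
      v * ∏ q ∈ Q, (q - 1) := by
  have hprime : ∀ q ∈ Q, q.Prime := fun q hq => Nat.prime_of_mem_primeFactors (hQ hq)
  obtain ⟨j, hj⟩ : (∏ q ∈ Q, q) ∣ v :=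
    (Finset.prod_dvd_prod_of_subset _ _ _ hQ).trans (Nat.prod_primeFactors_dvd v)
  have hcard : (Finset.univ.filter fun w : ZMod v => (∏ q ∈ Q, q).Coprime w.val).card =
      ((Finset.range ((∏ q ∈ Q, q) * j)).filter fun a => (∏ q ∈ Q, q).Coprime a).card := by
    rw [← hj]
    refine Finset.card_bij (fun w _ => w.val) (fun w hw => ?_)
      (fun a _ b _ h => ZMod.val_injective v h) fun a ha => ?_
    · simp only [Finset.mem_filter, Finset.mem_univ, true_and] at hw
      simpa [ZMod.val_lt] using hw
    · simp only [Finset.mem_filter, Finset.mem_range] at ha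
      refine ⟨(a : ZMod v), ?_, ZMod.val_natCast_of_lt ha.1⟩
      simpa [ZMod.val_natCast_of_lt ha.1] using ha.2
  rw [hcard, card_coprime_range_mul]
  have := Nat.totient_mul_prod_primeFactors (∏ q ∈ Q, q)
  rw [Nat.primeFactors_prod hprime] at this
  rw [mul_assoc, this]
  conv_rhs => rw [hj]
  ring

lemma prod_le_two_pow_mul_prod_pred {Q : Finset ℕ} (hQ : ∀ q ∈ Q, 2 ≤ q) :
    ∏ q ∈ Q, q ≤ 2 ^ Q.card * ∏ q ∈ Q, (q - 1) := by
  rw [← Finset.prod_const, ← Finset.prod_mul_distrib]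
  exact Finset.prod_le_prod' fun q hq => by have := hQ q hq; omega

lemma prod_le_two_pow_mul_prod_pred_of_odd {Q : Finset ℕ} {f : ℕ} (hQ : ∀ q ∈ Q, 3 ≤ q ∧ Odd q)
    (hf : 1 ≤ f) (hQf : Q.card ≤ f + 1) :
    ∏ q ∈ Q, q ≤ 2 ^ f * ∏ q ∈ Q, (q - 1) := by
  rcases Nat.lt_or_ge Q.card 2 with h | h
  · refine (prod_le_two_pow_mul_prod_pred fun q hq => by have := (hQ q hq).1; omega).trans ?_
    exact Nat.mul_le_mul_right _ (Nat.pow_le_pow_right two_pos (by omega))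
  · obtain ⟨a, ha, b, hb, hab⟩ := Finset.one_lt_card.1 h
    have hb' : b ∈ Q.erase a := Finset.mem_erase.2 ⟨hab.symm, hb⟩
    rw [← Finset.mul_prod_erase _ _ ha, ← Finset.mul_prod_erase _ _ hb',
      ← Finset.mul_prod_erase _ _ ha, ← Finset.mul_prod_erase _ _ hb']
    set R := (Q.erase a).erase b with hR
    have hcard : R.card + 1 ≤ f := by
      rw [hR, Finset.card_erase_of_mem hb', Finset.card_erase_of_mem ha]; omega
    have hRle := prod_le_two_pow_mul_prod_pred (Q := R) fun q hq => by
      have := (hQ q (Finset.mem_of_mem_erase (Finset.mem_of_mem_erase hq))).1; omega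
    have hpair : a * b ≤ 2 * ((a - 1) * (b - 1)) := by
      obtain ⟨ha3, a', rfl⟩ := hQ a ha
      obtain ⟨hb3, b', rfl⟩ := hQ b hb
      have h1 : 1 ≤ a' := by omega
      have h2 : 1 ≤ b' := by omega
      have h3 : 3 ≤ a' + b' := by omega
      simp only [Nat.add_sub_cancel]
      nlinarith [Nat.mul_le_mul h1 h2]
    calc a * (b * ∏ q ∈ R, q) = a * b * ∏ q ∈ R, q := by ring
      _ ≤ 2 * ((a - 1) * (b - 1)) * (2 ^ R.card * ∏ q ∈ R, (q - 1)) := Nat.mul_le_mul hpair hRle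
      _ = 2 ^ (R.card + 1) * ((a - 1) * ((b - 1) * ∏ q ∈ R, (q - 1))) := by ring
      _ ≤ _ := Nat.mul_le_mul_right _ (Nat.pow_le_pow_right two_pos hcard)

end HittingPrimes

section FreeSubgroups

variable {v : ℕ} [NeZero v] {D : Set (Block v)} {Q : Finset ℕ} {g : ℕ → ZMod v}

lemma exists_free_of_four_le {k : ℕ} [NeZero k] (hk : 4 ≤ k) (hv : Odd v)
    (hD : IsCyclicDesign v k D)
    (hg : ∀ q ∈ Q, Closed D (AddSubgroup.zmultiples (g q)) ∧
      AddSubgroup.zmultiples (g q) ≠ ⊤ ∧ g q ≠ 0)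
    (hsep : ∀ q ∈ Q, ∀ q' ∈ Q, g q ∈ AddSubgroup.zmultiples (g q') → q = q') :
    ∃ 𝓛 : Finset (AddSubgroup (ZMod v)), (∀ J ∈ 𝓛, FreeAt k D J) ∧ Q.card ≤ 𝓛.card := by
  classical
  have hone : AddSubgroup.zmultiples (1 : ZMod v) = ⊤ := by
    rw [AddSubgroup.eq_top_iff']
    exact fun x => mem_zmultiples_of_dvd (by rw [ZMod.addOrderOf_one]; exact addOrderOf_dvd x)
  have key : ∀ q, ∃ L : AddSubgroup (ZMod v), q ∈ Q → FreeAt k D L ∧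
      (L = AddSubgroup.zmultiples (g q) ∨ (addOrderOf (g q) = k ∧ L = ⊤) ∨
        ∃ δ, k = 2 * δ ∧ δ ∣ addOrderOf (g q) ∧ δ.Coprime (addOrderOf (g q) / δ) ∧
          L = cl D (δ • g q)) := by
    intro q
    by_cases hq : q ∈ Q
    swap
    · exact ⟨⊤, fun h => absurd h hq⟩
    obtain ⟨hcl, htop, h0⟩ := hg q hq
    by_cases hfree : FreeAt k D (AddSubgroup.zmultiples (g q))
    · exact ⟨_, fun _ => ⟨hfree, Or.inl rfl⟩⟩
    rcases order_of_not_freeAt hk hv hD hfree h0 (cl_eq_of_zmultiples hcl rfl) with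
      hord | ⟨δ, hkδ, hdvd, hne, hcop⟩
    · refine ⟨⊤, fun _ => ⟨?_, Or.inr (Or.inl ⟨hord, rfl⟩)⟩⟩
      by_contra hnf
      have hv1 : (1 : ZMod v) ≠ 0 := by
        intro h1
        exact h0 (by rw [← mul_one (g q), h1, mul_zero])
      rcases order_of_not_freeAt hk hv hD hnf hv1 (cl_eq_of_zmultiples (closed_top D) hone) with
        h | ⟨δ, h, -⟩
      · rw [ZMod.addOrderOf_one] at h
        refine htop (AddSubgroup.eq_top_of_card_eq _ ?_)
        rw [Nat.card_zmultiples, Nat.card_zmod]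
        omega
      · have := odd_addOrderOf hv (g q)
        rw [hord, h] at this
        exact absurd this (by simp)
    · refine ⟨cl D (δ • g q), fun _ => ⟨?_, Or.inr (Or.inr ⟨δ, hkδ, hdvd, hcop, rfl⟩)⟩⟩
      have hδ : δ ≠ 0 := by omega
      have hord : addOrderOf (δ • g q) = addOrderOf (g q) / δ := addOrderOf_nsmul_of_dvd hδ hdvd
      by_contra hnf
      have hx : δ • g q ≠ 0 := by
        intro h
        rw [h, addOrderOf_zero] at hord
        obtain ⟨m, hm⟩ := hdvd
        rw [hm, Nat.mul_div_cancel_left _ (by omega)] at hord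
        exact hne (by rw [hm, ← hord, mul_one])
      rcases order_of_not_freeAt hk hv hD hnf hx rfl with h | ⟨δ', hkδ', h, -⟩
      · have := odd_addOrderOf hv (δ • g q)
        rw [h, hkδ] at this
        exact absurd this (by simp)
      · have hδδ : δ' = δ := by omega
        rw [hδδ, hord] at h
        have := Nat.Coprime.eq_one_of_dvd hcop h
        omega
  choose L hL using key
  have hmem : ∀ x : ZMod v, x ∈ AddSubgroup.zmultiples x := AddSubgroup.mem_zmultiples
  have hcl_le : ∀ q ∈ Q, ∀ δ : ℕ, cl D (δ • g q) ≤ AddSubgroup.zmultiples (g q) := fun q hq δ =>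
    cl_le (hg q hq).1 (nsmul_mem (hmem _) δ)
  refine ⟨Q.image L, by simpa using fun q hq => (hL q hq).1, ?_⟩
  rw [Finset.card_image_of_injOn]
  intro q hq q' hq' h
  have hq : q ∈ Q := hq
  have hq' : q' ∈ Q := hq'
  obtain ⟨-, h1 | ⟨ho, h1⟩ | ⟨δ, hδ, hdvd, hcop, h1⟩⟩ := hL q hq <;>
  obtain ⟨-, h2 | ⟨ho', h2⟩ | ⟨δ', hδ', hdvd', hcop', h2⟩⟩ := hL q' hq' <;>
  simp only [h1, h2] at h
  · exact hsep q hq q' hq' (h ▸ hmem _)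
  · exact absurd h (hg q hq).2.1
  · exact hsep q hq q' hq' (hcl_le q' hq' δ' (h ▸ hmem _))
  · exact absurd h.symm (hg q' hq').2.1
  · exact hsep q hq q' hq' (mem_zmultiples_of_dvd (by rw [ho, ho']))
  · exact absurd (top_le_iff.1 (h ▸ hcl_le q' hq' δ')) (hg q' hq').2.1
  · exact (hsep q' hq' q hq (hcl_le q hq δ (h ▸ hmem _))).symm
  · exact absurd (top_le_iff.1 (h ▸ hcl_le q hq δ)) (hg q hq).2.1
  · have hδδ : δ' = δ := by omega
    subst hδδ
    have hδ0 : δ' ≠ 0 := by omega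
    have hx : δ' • g q' ∈ AddSubgroup.zmultiples (g q) := hcl_le q hq δ' (h ▸ mem_cl D _)
    refine (hsep q' hq' q hq (mem_zmultiples_of_dvd ?_)).symm
    have hdiv := addOrderOf_dvd_of_mem_zmultiples hx
    rw [addOrderOf_nsmul_of_dvd hδ0 hdvd'] at hdiv
    rw [← Nat.mul_div_cancel' hdvd] at hdiv
    rw [← Nat.mul_div_cancel' hdvd, ← Nat.mul_div_cancel' hdvd']
    exact Nat.mul_dvd_mul_left _ (hcop'.symm.dvd_of_dvd_mul_left hdiv)

lemma exists_free_three (hv : Odd v) (hD : IsCyclicDesign v 3 D)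
    (hp : ¬ v.Prime) (h1 : v ≠ 1) (h9 : v ≠ 9) (h15 : v ≠ 15) (h21 : v ≠ 21)
    (hQ : Q ⊆ v.primeFactors)
    (hg : ∀ q ∈ Q, Closed D (AddSubgroup.zmultiples (g q)) ∧
      AddSubgroup.zmultiples (g q) ≠ ⊤ ∧
      ∀ q' ∈ Q, q' ≠ q → g q ∉ AddSubgroup.zmultiples (q' : ZMod v))
    (hsep : ∀ q ∈ Q, ∀ q' ∈ Q, g q ∈ AddSubgroup.zmultiples (g q') → q = q') :
    ∃ 𝓛 : Finset (AddSubgroup (ZMod v)), (∀ J ∈ 𝓛, FreeAt 3 D J) ∧ 1 ≤ 𝓛.card ∧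
      Q.card ≤ 𝓛.card + 1 := by
  classical
  have hone : AddSubgroup.zmultiples (1 : ZMod v) = ⊤ := by
    rw [AddSubgroup.eq_top_iff']
    exact fun x => mem_zmultiples_of_dvd (by rw [ZMod.addOrderOf_one]; exact addOrderOf_dvd x)
  have htop : FreeAt 3 D (⊤ : AddSubgroup (ZMod v)) := by
    refine freeAt_three hv hD (closed_top D) hone ?_ ?_ ?_ ?_ ?_ <;> rwa [ZMod.addOrderOf_one]
  rcases Nat.lt_or_ge Q.card 3 with hcard | hcard
  · exact ⟨{⊤}, by simpa using htop, by simp, by simp; omega⟩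
  let P : ℕ → Prop := fun q => addOrderOf (g q) ∈ ({15, 21} : Finset ℕ)
  have hbad : (Q.filter P).card ≤ 2 := by
    refine (Finset.card_le_card_of_injOn (t := {15, 21}) (fun q => addOrderOf (g q))
      (fun q hq => (Finset.mem_filter.1 hq).2) fun q hq q' hq' h => ?_).trans Finset.card_le_two
    exact hsep q (Finset.mem_filter.1 hq).1 q' (Finset.mem_filter.1 hq').1
      (mem_zmultiples_of_dvd (dvd_of_eq h))
  have hgood : ∀ q ∈ Q.filter fun q => ¬ P q, FreeAt 3 D (AddSubgroup.zmultiples (g q)) := by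
    intro q hq
    obtain ⟨hq, hP⟩ := Finset.mem_filter.1 hq
    obtain ⟨a, ha, b, hb, hab⟩ := Finset.one_lt_card.1
      (show 1 < (Q.erase q).card by rw [Finset.card_erase_of_mem hq]; omega)
    have hdvd : ∀ a ∈ Q.erase q, a.Prime ∧ a ∣ addOrderOf (g q) := fun a ha => by
      obtain ⟨haq, haQ⟩ := Finset.mem_erase.1 ha
      have hap := Nat.prime_of_mem_primeFactors (hQ haQ)
      exact ⟨hap, dvd_addOrderOf_of_not_mem hap (Nat.dvd_of_mem_primeFactors (hQ haQ))
        ((hg q hq).2.2 a haQ haq)⟩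
    obtain ⟨hap, had⟩ := hdvd a ha
    obtain ⟨hbp, hbd⟩ := hdvd b hb
    simp only [P, Finset.mem_insert, Finset.mem_singleton, not_or] at hP
    refine freeAt_three hv hD (hg q hq).1 rfl (fun h => hab ?_) (fun h => ?_) (fun h => hab ?_)
      hP.1 hP.2
    · rw [(Nat.prime_dvd_prime_iff_eq hap h).1 had, (Nat.prime_dvd_prime_iff_eq hbp h).1 hbd]
    · exact hap.one_lt.ne' (Nat.dvd_one.1 (h ▸ had))
    · have h3 : ∀ p : ℕ, p.Prime → p ∣ addOrderOf (g q) → p = 3 := fun p hp hpd =>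
        (Nat.prime_dvd_prime_iff_eq hp Nat.prime_three).1
          (hp.dvd_of_dvd_pow (n := 2) (by rwa [h] at hpd))
      rw [h3 a hap had, h3 b hbp hbd]
  refine ⟨insert ⊤ ((Q.filter fun q => ¬ P q).image fun q => AddSubgroup.zmultiples (g q)),
    ?_, ?_, ?_⟩
  · simp only [Finset.mem_insert, Finset.mem_image]
    rintro J (rfl | ⟨q, hq, rfl⟩)
    exacts [htop, hgood q hq]
  · exact Finset.card_pos.2 ⟨⊤, Finset.mem_insert_self _ _⟩
  · rw [Finset.card_insert_of_notMem, Finset.card_image_of_injOn]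
    · have := Finset.card_filter_add_card_filter_not (s := Q) P
      omega
    · intro q hq q' hq' h
      have h : AddSubgroup.zmultiples (g q) = AddSubgroup.zmultiples (g q') := h
      exact hsep q (Finset.mem_filter.1 hq).1 q' (Finset.mem_filter.1 hq').1
        (h ▸ AddSubgroup.mem_zmultiples _)
    · simp only [Finset.mem_image, not_exists, not_and]
      exact fun q hq => (hg q (Finset.mem_filter.1 hq).1).2.1

end FreeSubgroups

section Count

variable {v k : ℕ} [NeZero v] {D : Set (Block v)}

lemma card_classes_mul_le (hk : 3 ≤ k) (hD : IsCyclicDesign v k D) (m : ℕ) :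
    ((classes D).filter fun X => X.card = m).card * m ≤ v - 1 := by
  classical
  have hdis : ∀ X ∈ (classes D).filter (fun X => X.card = m),
      ∀ Y ∈ (classes D).filter (fun X => X.card = m), X ≠ Y → Disjoint X Y := by
    intro X hX Y hY hXY
    obtain ⟨E, hE, rfl⟩ := mem_classes.1 (Finset.mem_filter.1 hX).1
    obtain ⟨E', hE', rfl⟩ := mem_classes.1 (Finset.mem_filter.1 hY).1
    rw [Finset.disjoint_left]
    exact fun x hx hx' => hXY (hD.diffs_eq hk hE hE' hx hx')
  have hsum := Finset.card_biUnion (t := fun X : Finset (ZMod v) => X) hdis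
  rw [Finset.sum_congr rfl fun X hX => (Finset.mem_filter.1 hX).2, Finset.sum_const,
    smul_eq_mul] at hsum
  rw [← hsum]
  refine (Finset.card_le_card (t := Finset.univ.erase 0) fun x hx => ?_).trans ?_
  · obtain ⟨X, hX, hxX⟩ := Finset.mem_biUnion.1 hx
    obtain ⟨E, hE, rfl⟩ := mem_classes.1 (Finset.mem_filter.1 hX).1
    exact Finset.mem_erase.2 ⟨hD.ne_zero hk hE hxX, Finset.mem_univ _⟩
  · rw [Finset.card_erase_of_mem (Finset.mem_univ _), Finset.card_univ, ZMod.card]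

lemma two_pow_le_NC_mul_totient_of_weight (hk : 3 ≤ k) (hv : 2 ≤ v) (hD : IsCyclicDesign v k D)
    {s : ℕ} (hs : s ≤ ((classes D).filter fun X => X.card = 2 * k).card)
    (𝓛 : Finset (AddSubgroup (ZMod v))) (hfree : ∀ J ∈ 𝓛, FreeAt k D J)
    (W : Finset (ZMod v)) (hW : (0 : ZMod v) ∉ W) (hgen : ∀ w ∈ W, Generates D w)
    (hcard : v - 1 ≤ 2 ^ 𝓛.card * W.card) : 2 ^ s ≤ NC v k * v.totient := by
  obtain ⟨S, hS, hSD⟩ := exists_many_designs hk hD 𝓛 hfree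
  have hmain := card_mul_card_le_NC hk W hW S fun B hB =>
    ⟨(hSD B hB).1, fun w hw J hJ hwJ => hgen w hw J ((hSD B hB).2 J hJ) hwJ⟩
  refine Nat.le_of_mul_le_mul_right (c := v - 1) ?_ (by omega)
  calc 2 ^ s * (v - 1) ≤ 2 ^ s * (2 ^ 𝓛.card * W.card) := Nat.mul_le_mul_left _ hcard
    _ = 2 ^ (s + 𝓛.card) * W.card := by rw [pow_add, mul_assoc]
    _ ≤ S.card * W.card :=
      Nat.mul_le_mul_right _ ((Nat.pow_le_pow_right two_pos (by omega)).trans hS)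
    _ ≤ NC v k * v.totient * (v - 1) := by rw [mul_assoc]; exact hmain

lemma NC_pos (hD : IsCyclicDesign v k D) : 0 < NC v k := by
  have : Nonempty (Quot fun B B' : {B : Set (Block v) // IsCyclicDesign v k B} =>
    Isomorphic B.1 B'.1) := ⟨Quot.mk _ ⟨D, hD⟩⟩
  exact Nat.card_pos

/-- For `k = 3` and `v ∈ {9, 15, 21}` the bound is trivial, as `2 ^ s ≤ φ v`. -/
lemma two_pow_le_NC_mul_totient_of_small (hD : IsCyclicDesign v 3 D) {s : ℕ}
    (hs : s ≤ ((classes D).filter fun X => X.card = 2 * 3).card)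
    (hv : v = 9 ∨ v = 15 ∨ v = 21) : 2 ^ s ≤ NC v 3 * v.totient := by
  have hle := card_classes_mul_le le_rfl hD (2 * 3)
  have hpos := NC_pos hD
  have hs' : s * 6 ≤ v - 1 := (Nat.mul_le_mul_right 6 hs).trans hle
  refine le_trans ?_ (Nat.le_mul_of_pos_left _ hpos)
  have h9 : Nat.totient 9 = 6 := by decide
  have h15 : Nat.totient 15 = 8 := by decide
  have h21 : Nat.totient 21 = 12 := by decide
  have key : ∀ n, s ≤ n → 2 ^ s ≤ 2 ^ n := fun n h => Nat.pow_le_pow_right two_pos h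
  rcases hv with rfl | rfl | rfl
  · rw [h9]; exact (key 1 (by omega)).trans (by norm_num)
  · rw [h15]; exact (key 2 (by omega)).trans (by norm_num)
  · rw [h21]; exact (key 3 (by omega)).trans (by norm_num)

lemma two_pow_le_NC_mul_totient (hk : 3 ≤ k) (hv : Odd v) (hv3 : 3 ≤ v)
    (hD : IsCyclicDesign v k D) {s : ℕ}
    (hs : s ≤ ((classes D).filter fun X => X.card = 2 * k).card) :
    2 ^ s ≤ NC v k * v.totient := by
  classical
  obtain ⟨Q, hQ, hhit, g, hg⟩ := exists_hitting_primes D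
  have hgenerates : ∀ w : ZMod v, w ≠ 0 → (∀ q ∈ Q, w ∉ AddSubgroup.zmultiples (q : ZMod v)) →
      Generates D w := by
    intro w hw hwQ J hJ hwJ
    by_contra htop
    obtain ⟨q, hq, hle⟩ := hhit J hJ htop fun hbot => hw (by simpa [hbot] using hwJ)
    exact hwQ q hq (hle hwJ)
  rcases Q.eq_empty_or_nonempty with rfl | hne
  · refine two_pow_le_NC_mul_totient_of_weight hk (by omega) hD hs ∅ (by simp)
      (Finset.univ.erase 0) (by simp)
      (fun w hw => hgenerates w (Finset.ne_of_mem_erase hw) (by simp)) ?_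
    rw [Finset.card_erase_of_mem (Finset.mem_univ _), Finset.card_univ, ZMod.card]
    simp
  have hprime : ∀ q ∈ Q, q.Prime := fun q hq => Nat.prime_of_mem_primeFactors (hQ hq)
  have hdvd : ∀ q ∈ Q, q ∣ v := fun q hq => Nat.dvd_of_mem_primeFactors (hQ hq)
  have hodd : ∀ q ∈ Q, 3 ≤ q ∧ Odd q := fun q hq => by
    have h1 := hv.of_dvd_nat (hdvd q hq)
    have h2 := (hprime q hq).two_le
    refine ⟨?_, h1⟩
    rcases h1 with ⟨m, rfl⟩
    omega
  have hnp : ¬ v.Prime := by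
    intro hp
    obtain ⟨q, hq⟩ := hne
    obtain rfl := (Nat.prime_dvd_prime_iff_eq (hprime q hq) hp).1 (hdvd q hq)
    obtain ⟨-, -, h0, hmem, -⟩ := hg q hq
    rw [ZMod.natCast_self, AddSubgroup.zmultiples_zero_eq_bot, AddSubgroup.mem_bot] at hmem
    exact h0 hmem
  have hsep : ∀ q ∈ Q, ∀ q' ∈ Q, g q ∈ AddSubgroup.zmultiples (g q') → q = q' := by
    intro q hq q' hq' h
    by_contra hqq
    exact (hg q hq).2.2.2.2 q' hq' (Ne.symm hqq)
      (AddSubgroup.zmultiples_le_of_mem (hg q' hq').2.2.2.1 h)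
  have main : ∀ 𝓛 : Finset (AddSubgroup (ZMod v)), (∀ J ∈ 𝓛, FreeAt k D J) → 1 ≤ 𝓛.card →
      Q.card ≤ 𝓛.card + 1 → 2 ^ s ≤ NC v k * v.totient := by
    intro 𝓛 hfree h1 hcard
    have hcop : ∀ w : ZMod v, (∏ q ∈ Q, q).Coprime w.val → ∀ q ∈ Q,
        w ∉ AddSubgroup.zmultiples (q : ZMod v) := fun w hw q hq hmem =>
      (hprime q hq).one_lt.ne' (Nat.eq_one_of_dvd_coprimes hw (Finset.dvd_prod_of_mem _ hq)
        (dvd_val_of_mem_zmultiples (hdvd q hq) hmem))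
    have hzero : ¬ (∏ q ∈ Q, q).Coprime (0 : ZMod v).val := fun h =>
      hcop 0 h _ hne.choose_spec (zero_mem _)
    refine two_pow_le_NC_mul_totient_of_weight hk (by omega) hD hs 𝓛 hfree
      (Finset.univ.filter fun w : ZMod v => (∏ q ∈ Q, q).Coprime w.val)
      (by simpa using hzero) (fun w hw => ?_) ?_
    · have hw := (Finset.mem_filter.1 hw).2
      exact hgenerates w (by rintro rfl; exact hzero hw) (hcop w hw)
    · have hpos : 0 < ∏ q ∈ Q, q := Finset.prod_pos fun q hq => (hprime q hq).pos
      refine (Nat.sub_le v 1).trans (Nat.le_of_mul_le_mul_right (c := ∏ q ∈ Q, q) ?_ hpos)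
      rw [mul_assoc, card_coprime_val_mul hQ, mul_left_comm]
      exact Nat.mul_le_mul_left _ (prod_le_two_pow_mul_prod_pred_of_odd hodd h1 hcard)
  rcases hk.lt_or_eq with hk4 | rfl
  · have : NeZero k := ⟨by omega⟩
    obtain ⟨𝓛, hfree, hcard⟩ := exists_free_of_four_le hk4 hv hD
      (fun q hq => ⟨(hg q hq).1, (hg q hq).2.1, (hg q hq).2.2.1⟩) hsep
    have := hne.card_pos
    exact main 𝓛 hfree (by omega) (by omega)
  · by_cases hsmall : v = 9 ∨ v = 15 ∨ v = 21
    · exact two_pow_le_NC_mul_totient_of_small hD hs hsmall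
    push Not at hsmall
    obtain ⟨𝓛, hfree, h1, hcard⟩ := exists_free_three hv hD hnp (by omega) hsmall.1 hsmall.2.1
      hsmall.2.2 hQ (fun q hq => ⟨(hg q hq).1, (hg q hq).2.1, (hg q hq).2.2.2.2⟩) hsep
    exact main 𝓛 hfree h1 hcard

end Count

end CCS

/-- If `F = {C_1, …, C_n}` is a `(K_v, C_k)`-difference system and
`s` (with `1 ≤ s ≤ n`) is the number of cycles of `F` of type 1, then
`NC(v,k) ≥ ⌈2^s / φ(v)⌉`. -/
theorem stmt1 (v k : ℕ) (hv : 3 ≤ v) (hvodd : Odd v) (hk : 3 ≤ k)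
    (F : Finset (CCS.Block v)) (hF : CCS.IsDifferenceSystem v k F)
    (s : ℕ) (hs : s = (F.filter fun E => CCS.cycleType E = 1).card)
    (hs1 : 1 ≤ s) (hsn : s ≤ F.card) :
    (⌈(2 ^ s : ℚ) / (v.totient : ℚ)⌉ : ℤ) ≤ (CCS.NC v k : ℤ) := by
  have : NeZero v := ⟨by omega⟩
  obtain ⟨D, hD, hcard⟩ := CCS.exists_design_of_differenceSystem hk hF
  have h := CCS.two_pow_le_NC_mul_totient hk hvodd hv hD (hs.le.trans hcard)
  have hφ : (0 : ℚ) < v.totient := by exact_mod_cast Nat.totient_pos.2 (by omega)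
  rw [Int.ceil_le, div_le_iff₀ hφ]
  exact_mod_cast h
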